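/- arXiv:1711.06847 — 4 statements merged into one kernel-verified Lean document; each statement's English description precedes it below -/
import Mathlib

section
/- Let k ≥ 2 and let (M_1, …, M_k) be an anarchy harmonious k-tuple of positive integers, and set K = ω(M_1 ⋯ M_k). Then M_1 ⋯ M_k < (π²/6) · 2^{4^K − 2·2^K}. -/
/-- `sigma n` is the sum of all positive divisors of `n`. -/
def sigma (n : ℕ) : ℕ := ∑ d ∈ n.divisors, d

open Finset

theorem one_div_mul_log_sub_log_le {x y : ℝ} (hx : 1 < x) (hy : 1 < y) :
    1 / (x - 1) * (Real.log x - Real.log y) ≤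
      Real.log (1 - 1 / x) - Real.log (1 - 1 / y) := by
  have hx0 : 0 < x - 1 := by linarith
  have hy0 : 0 < y - 1 := by linarith
  have h1 : Real.log (1 - 1 / x) = Real.log (x - 1) - Real.log x := by
    rw [← Real.log_div (by positivity) (by positivity)]; congr 1; field_simp
  have h2 : Real.log (1 - 1 / y) = Real.log (y - 1) - Real.log y := by
    rw [← Real.log_div (by positivity) (by positivity)]; congr 1; field_simp
  have hA : (y - 1) / (x - 1) ∈ Set.Ioi (0 : ℝ) := Set.mem_Ioi.2 (by positivity)
  have hB : (1 : ℝ) ∈ Set.Ioi (0 : ℝ) := Set.mem_Ioi.2 one_pos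
  have ha : 0 ≤ (x - 1) / x := by positivity
  have hb : 0 ≤ 1 / x := by positivity
  have key := strictConcaveOn_log_Ioi.concaveOn.2 hA hB ha hb (by field_simp; ring)
  have e : (x - 1) / x * ((y - 1) / (x - 1)) + 1 / x * 1 = y / x := by field_simp; ring
  simp only [smul_eq_mul] at key
  rw [e, Real.log_one, Real.log_div (by positivity) (by positivity),
    Real.log_div (by positivity) (by positivity)] at key
  rw [h1, h2]
  rw [div_mul_eq_mul_div, div_le_iff₀ hx0]
  rw [mul_zero, add_zero, div_mul_eq_mul_div, div_le_iff₀ (by positivity)] at key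
  linarith

theorem weighted_log_sum_le {ι : Type*} [DecidableEq ι] (x : ι → ℝ) (y : ℕ → ℝ)
    (hy : ∀ j, 1 < y j) (U : Finset ι) (hx : ∀ i ∈ U, 1 < x i)
    (hsub : ∀ R ⊆ U, ∑ j ∈ range #R, Real.log (y j) ≤ ∑ i ∈ R, Real.log (x i))
    (X : ℝ) (hX : 1 < X) (hXU : ∀ i ∈ U, x i ≤ X) :
    1 / (X - 1) * (∑ i ∈ U, Real.log (x i) - ∑ j ∈ range #U, Real.log (y j)) ≤
      ∑ i ∈ U, Real.log (1 - 1 / x i) - ∑ j ∈ range #U, Real.log (1 - 1 / y j) := by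
  induction U using Finset.induction_on_max_value x generalizing X with
  | empty => simp
  | insert b s hb hmax ih =>
    have hb1 := hx b (mem_insert_self b s)
    have h1 := ih (fun i hi => hx i (mem_insert_of_mem hi))
      (fun R hR => hsub R (hR.trans (subset_insert b s))) (x b) hb1 hmax
    have h2 := one_div_mul_log_sub_log_le hb1 (hy #s)
    have h3 := hsub _ subset_rfl
    have h4 : 1 / (X - 1) ≤ 1 / (x b - 1) :=
      one_div_le_one_div_of_le (by linarith) (by linarith [hXU b (mem_insert_self b s)])
    have h5 := mul_le_mul_of_nonneg_right h4 (sub_nonneg.2 h3)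
    rw [card_insert_of_notMem hb, sum_insert hb, sum_insert hb, sum_range_succ,
      sum_range_succ] at *
    linarith

theorem mul_prod_pow_two_pow_add_one (a m : ℕ) :
    a * ∏ j ∈ range m, ((a + 1) ^ 2 ^ j + 1) + 1 = (a + 1) ^ 2 ^ m := by
  induction m with
  | zero => simp
  | succ m ih =>
    rw [prod_range_succ, pow_succ 2 m, pow_mul, ← ih]
    ring

theorem lt_prod_one_sub_one_div (a m : ℕ) (ha : 1 ≤ a) :
    (a : ℝ) / (a + 1) < ∏ j ∈ range m, (1 - 1 / ((a + 1 : ℝ) ^ 2 ^ j + 1)) := by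
  have key : (∏ j ∈ range m, (1 - 1 / ((a + 1 : ℝ) ^ 2 ^ j + 1))) * (a + 1 : ℝ) *
      ((a + 1 : ℝ) ^ 2 ^ m - 1) = a * (a + 1 : ℝ) ^ 2 ^ m := by
    induction m with
    | zero => simp; ring
    | succ m ih =>
      rw [prod_range_succ, pow_succ 2 m, pow_mul]
      set q := (a + 1 : ℝ) ^ 2 ^ m
      have hq : 0 < q := by positivity
      have : (1 - 1 / (q + 1)) * (q ^ 2 - 1) = q * (q - 1) := by field_simp; ring
      linear_combination q * ih +
        (∏ j ∈ range m, (1 - 1 / ((a + 1 : ℝ) ^ 2 ^ j + 1))) * (a + 1 : ℝ) * this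
  have ha' : (0 : ℝ) < a := by exact_mod_cast ha
  have hq : 1 < (a + 1 : ℝ) ^ 2 ^ m := one_lt_pow₀ (by linarith) (by positivity)
  rw [div_lt_iff₀ (by positivity)]
  by_contra! h
  have := mul_le_mul_of_nonneg_right h (sub_nonneg.2 hq.le)
  rw [key] at this
  nlinarith

/-- If a product of factors `1 - 1 / x i` is at most `a / (a + 1)`, then some of the `x i`
have a small product. -/
theorem exists_subset_mul_prod_lt {ι : Type*} [DecidableEq ι] (a : ℕ) (ha : 1 ≤ a)
    (U : Finset ι) (x : ι → ℕ) (hx : ∀ i ∈ U, 1 < x i)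
    (h : ∏ i ∈ U, (1 - 1 / (x i : ℝ)) ≤ a / (a + 1)) :
    ∃ R ⊆ U, R.Nonempty ∧ a * ∏ i ∈ R, x i + 1 ≤ (a + 1) ^ 2 ^ #R := by
  by_contra! hcon
  have ha' : (0 : ℝ) < a := by exact_mod_cast ha
  have hy : ∀ j, (1 : ℝ) < (a + 1) ^ 2 ^ j + 1 := fun j => by
    have : (0 : ℝ) < (a + 1) ^ 2 ^ j := by positivity
    linarith
  have hx' : ∀ i ∈ U, (1 : ℝ) < x i := fun i hi => by exact_mod_cast hx i hi
  have hsub : ∀ R ⊆ U, ∑ j ∈ range #R, Real.log ((a + 1 : ℝ) ^ 2 ^ j + 1) ≤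
      ∑ i ∈ R, Real.log (x i) := by
    intro R hR
    rcases R.eq_empty_or_nonempty with rfl | hne
    · simp
    rw [← Real.log_prod fun j _ => by linarith [hy j],
      ← Real.log_prod fun i hi => by linarith [hx' i (hR hi)]]
    apply Real.log_le_log (prod_pos fun j _ => by linarith [hy j])
    have h1 := hcon R hR hne
    rw [← mul_prod_pow_two_pow_add_one] at h1
    have h2 := Nat.le_of_mul_le_mul_left (Nat.le_of_lt_succ (Nat.lt_succ_of_lt
      (Nat.lt_of_add_lt_add_right h1))) ha
    exact_mod_cast h2
  have hXU : ∀ i ∈ U, (x i : ℝ) ≤ 2 + ∑ i ∈ U, (x i : ℝ) := fun i hi => by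
    linarith [single_le_sum (f := fun i => (x i : ℝ)) (fun i _ => by positivity) hi]
  have hX0 : 0 ≤ ∑ i ∈ U, (x i : ℝ) := sum_nonneg fun i _ => by positivity
  have main := weighted_log_sum_le (fun i => (x i : ℝ)) _ hy U hx' hsub
    (2 + ∑ i ∈ U, (x i : ℝ)) (by linarith) hXU
  have hnn := mul_nonneg (one_div_nonneg.2 (by linarith : 0 ≤ 2 + ∑ i ∈ U, (x i : ℝ) - 1))
    (sub_nonneg.2 (hsub U subset_rfl))
  have hu : ∀ i ∈ U, 0 < 1 - 1 / (x i : ℝ) := fun i hi => by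
    have := (div_lt_one (by linarith [hx' i hi])).2 (hx' i hi)
    linarith
  have hv : ∀ j, 0 < 1 - 1 / ((a + 1 : ℝ) ^ 2 ^ j + 1) := fun j => by
    have := (div_lt_one (by linarith [hy j])).2 (hy j)
    linarith
  have hlt := (lt_prod_one_sub_one_div a #U ha).trans_le' h
  have := Real.log_lt_log (prod_pos hu) hlt
  rw [Real.log_prod fun i hi => (hu i hi).ne', Real.log_prod fun j _ => (hv j).ne'] at this
  linarith

/-- The factor `p ^ e / σ (p ^ e)` if `p ∈ V`, and its limit as `e → ∞` otherwise. -/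
noncomputable def localFactor (e : ℕ → ℕ) (V : Finset ℕ) (p : ℕ) : ℝ :=
  if p ∈ V then (p : ℝ) ^ e p * (p - 1) / ((p : ℝ) ^ (e p + 1) - 1) else 1 - 1 / (p : ℝ)

/-- A denominator of `localFactor e V p`. -/
def localDenom (e : ℕ → ℕ) (V : Finset ℕ) (p : ℕ) : ℕ :=
  if p ∈ V then p ^ (e p + 1) - 1 else p

/-- The sum of the products of the local factors at the primes in `T`. -/
noncomputable def partialSum {k : ℕ} (S : Fin k → Finset ℕ) (e : ℕ → ℕ) (T V : Finset ℕ) : ℝ :=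
  ∑ i, ∏ p ∈ T ∩ S i, localFactor e V p

theorem localFactor_mul_of_mem {e : ℕ → ℕ} {V : Finset ℕ} {p : ℕ} (hp : 2 ≤ p) (hV : p ∈ V) :
    localFactor e V p * (1 - 1 / ((p ^ (e p + 1) : ℕ) : ℝ)) = 1 - 1 / (p : ℝ) := by
  have hp' : (2 : ℝ) ≤ p := by exact_mod_cast hp
  have h1 : (1 : ℝ) < (p : ℝ) ^ (e p + 1) := one_lt_pow₀ (by linarith) (by omega)
  have h2 : (p : ℝ) ^ (e p + 1) - 1 ≠ 0 := by linarith
  rw [localFactor, if_pos hV]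
  push_cast
  have h3 : (1 - 1 / (p : ℝ) ^ (e p + 1)) = ((p : ℝ) ^ (e p + 1) - 1) / (p : ℝ) ^ (e p + 1) := by
    field_simp
  rw [h3, div_mul_div_cancel₀ h2, pow_succ]
  field_simp

theorem localFactor_pos {e : ℕ → ℕ} {V : Finset ℕ} {p : ℕ} (hp : 2 ≤ p) :
    0 < localFactor e V p := by
  have hp' : (2 : ℝ) ≤ p := by exact_mod_cast hp
  have h1 : (1 : ℝ) < (p : ℝ) ^ (e p + 1) := one_lt_pow₀ (by linarith) (by omega)
  rw [localFactor]
  split_ifs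
  · exact div_pos (mul_pos (by positivity) (by linarith)) (by linarith)
  · rw [sub_pos, div_lt_one (by linarith)]
    linarith

theorem localFactor_lt_one {e : ℕ → ℕ} {V : Finset ℕ} {p : ℕ} (hp : 2 ≤ p) (he : 1 ≤ e p) :
    localFactor e V p < 1 := by
  have hp' : (2 : ℝ) ≤ p := by exact_mod_cast hp
  have h1 : (1 : ℝ) < (p : ℝ) ^ (e p + 1) := one_lt_pow₀ (by linarith) (by omega)
  have h2 : (1 : ℝ) < (p : ℝ) ^ e p := one_lt_pow₀ (by linarith) (by omega)
  rw [localFactor]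
  split_ifs
  · rw [div_lt_one (by linarith), pow_succ]
    linarith
  · rw [sub_lt_self_iff]
    positivity

theorem localFactor_mono {e : ℕ → ℕ} {V V' : Finset ℕ} {p : ℕ} (hp : 2 ≤ p) (hV : V ⊆ V') :
    localFactor e V p ≤ localFactor e V' p := by
  by_cases h : p ∈ V'
  · by_cases h' : p ∈ V
    · simp [localFactor, h, h']
    · rw [localFactor, if_neg h', ← localFactor_mul_of_mem hp h]
      refine mul_le_of_le_one_right (localFactor_pos hp).le ?_
      rw [sub_le_self_iff]
      positivity
  · rw [localFactor, localFactor, if_neg h, if_neg fun h' => h (hV h')]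

theorem exists_localDenom_mul_localFactor_eq (e : ℕ → ℕ) (V : Finset ℕ) {p : ℕ} (hp : 2 ≤ p) :
    ∃ m : ℕ, localDenom e V p * localFactor e V p = m := by
  have hp' : (2 : ℝ) ≤ p := by exact_mod_cast hp
  have h1 : (1 : ℝ) < (p : ℝ) ^ (e p + 1) := one_lt_pow₀ (by linarith) (by omega)
  rw [localDenom, localFactor]
  split_ifs
  · refine ⟨p ^ e p * (p - 1), ?_⟩
    rw [mul_comm]
    have h2 : 1 ≤ p ^ (e p + 1) := Nat.one_le_pow _ _ (by omega)
    push_cast [h2, (by omega : 1 ≤ p)]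
    exact div_mul_cancel₀ _ (by linarith)
  · refine ⟨p - 1, ?_⟩
    push_cast [(by omega : 1 ≤ p)]
    field_simp

theorem localDenom_pos (e : ℕ → ℕ) (V : Finset ℕ) {p : ℕ} (hp : 2 ≤ p) :
    0 < localDenom e V p := by
  rw [localDenom]
  split_ifs
  · have := Nat.one_lt_pow (n := e p + 1) (by omega) (by omega : 1 < p)
    omega
  · omega

theorem exists_prod_localDenom_mul_partialSum_eq {k : ℕ} (S : Fin k → Finset ℕ) (e : ℕ → ℕ)
    (T V : Finset ℕ) (hT : ∀ p ∈ T, 2 ≤ p) :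
    ∃ m : ℕ, ((∏ p ∈ T, localDenom e V p : ℕ) : ℝ) * partialSum S e T V = m := by
  have h : ∀ i, ∃ m : ℕ, ((∏ p ∈ T, localDenom e V p : ℕ) : ℝ) *
      ∏ p ∈ T ∩ S i, localFactor e V p = m := by
    intro i
    have h' : ∀ p, ∃ m : ℕ, p ∈ T →
        (localDenom e V p : ℝ) * (if p ∈ S i then localFactor e V p else 1) = m := by
      intro p
      by_cases hp : p ∈ T
      · split_ifs
        · obtain ⟨m, hm⟩ := exists_localDenom_mul_localFactor_eq e V (hT p hp)
          exact ⟨m, fun _ => hm⟩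
        · exact ⟨localDenom e V p, fun _ => mul_one _⟩
      · exact ⟨0, fun h => absurd h hp⟩
    choose m hm using h'
    refine ⟨∏ p ∈ T, m p, ?_⟩
    push_cast
    rw [← filter_mem_eq_inter, prod_filter, ← prod_mul_distrib]
    exact prod_congr rfl fun p hp => hm p hp
  choose m hm using h
  refine ⟨∑ i, m i, ?_⟩
  rw [partialSum, mul_sum, Nat.cast_sum]
  exact sum_congr rfl fun i _ => hm i

theorem prod_le_prod_of_superset_of_le_one {ι : Type*} [DecidableEq ι] {s t : Finset ι}
    {f : ι → ℝ} (hst : s ⊆ t) (h0 : ∀ i ∈ t, 0 ≤ f i) (h1 : ∀ i ∈ t, f i ≤ 1) :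
    ∏ i ∈ t, f i ≤ ∏ i ∈ s, f i := by
  rw [← prod_sdiff hst]
  exact mul_le_of_le_one_left (prod_nonneg fun i hi => h0 i (hst hi))
    (prod_le_one (fun i hi => h0 i (mem_sdiff.1 hi).1) fun i hi => h1 i (mem_sdiff.1 hi).1)

theorem prod_pred_add_one_le {ι : Type*} [DecidableEq ι] {R : Finset ι} (hR : R.Nonempty)
    {z : ι → ℕ} (hz : ∀ i ∈ R, 1 ≤ z i) : ∏ i ∈ R, (z i - 1) + 1 ≤ ∏ i ∈ R, z i := by
  obtain ⟨r, hr⟩ := hR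
  rw [← mul_prod_erase R _ hr, ← mul_prod_erase R z hr]
  have h1 : ∏ i ∈ R.erase r, (z i - 1) ≤ ∏ i ∈ R.erase r, z i :=
    prod_le_prod' fun i _ => Nat.sub_le _ _
  have h2 : 1 ≤ ∏ i ∈ R.erase r, z i :=
    Nat.one_le_iff_ne_zero.2 (prod_ne_zero_iff.2 fun i hi =>
      Nat.one_le_iff_ne_zero.1 (hz i (mem_of_mem_erase hi)))
  obtain ⟨c, hc⟩ := Nat.exists_eq_add_of_le (hz r hr)
  rw [hc, Nat.add_sub_cancel_left]
  nlinarith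

theorem le_of_mul_add_one_le_pow {a Z n : ℕ} (ha : 1 ≤ a) (h : a * Z + 1 ≤ (a + 1) ^ (n + 2)) :
    Z ≤ 1 + (a + 1) * (a + 2) ^ n := by
  have key : (a + 1) ^ (n + 2) ≤ 1 + a * (1 + (a + 1) * (a + 2) ^ n) := by
    clear h
    induction n with
    | zero => apply le_of_eq; ring
    | succ n ih =>
      have h1 : 1 ≤ (a + 2) ^ n := Nat.one_le_pow _ _ (by omega)
      calc (a + 1) ^ (n + 1 + 2) = (a + 1) ^ (n + 2) * (a + 1) := by ring
        _ ≤ (1 + a * (1 + (a + 1) * (a + 2) ^ n)) * (a + 1) := Nat.mul_le_mul_right _ ih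
        _ ≤ 1 + a * (1 + (a + 1) * (a + 2) ^ (n + 1)) := by
          rw [pow_succ]
          nlinarith [Nat.mul_le_mul_left (a * (a + 1)) h1]
  exact Nat.le_of_mul_le_mul_left (by linarith : a * Z ≤ a * (1 + (a + 1) * (a + 2) ^ n)) ha

/-- The invariant of the search: the primes in `T` are bounded, and so are the prime powers
`p ^ e p` with `p ∈ V`. -/
structure IsControlled (e : ℕ → ℕ) (P T V : Finset ℕ) : Prop where
  subset : V ⊆ T
  subset_all : T ⊆ P
  denom_lt : ∏ p ∈ T, localDenom e V p + 1 ≤ 2 ^ 2 ^ (#T + #V)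
  powers_le : (∏ p ∈ V, (p ^ (e p + 1) - 1)) * 2 ^ 2 ^ #T ≤ 2 ^ 2 ^ (#T + #V)
  final : V = P → (∏ p ∈ V, (p ^ (e p + 1) - 1)) * (2 ^ 2 ^ #T) ^ 2 ≤
    2 ^ 2 ^ (#T + #V) * ∏ p ∈ P, p

theorem IsControlled.union_primes {e : ℕ → ℕ} {P T V R : Finset ℕ} (h : IsControlled e P T V)
    (hV : V ≠ P) (hR : R ⊆ P \ T)
    (hlt : (∏ p ∈ T, localDenom e V p) * ∏ p ∈ R, p + 1 ≤
      (∏ p ∈ T, localDenom e V p + 1) ^ 2 ^ #R) :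
    IsControlled e P (T ∪ R) V := by
  have hdisj : Disjoint T R := disjoint_of_subset_right hR disjoint_sdiff
  have hcard : 2 ^ 2 ^ (#(T ∪ R) + #V) = (2 ^ 2 ^ (#T + #V)) ^ 2 ^ #R := by
    rw [card_union_of_disjoint hdisj, ← pow_mul, ← pow_add]
    congr 2; omega
  refine ⟨h.subset.trans subset_union_left, union_subset h.subset_all (hR.trans sdiff_subset),
    ?_, ?_, fun h' => absurd h' hV⟩
  · rw [hcard, prod_union hdisj]
    have hRV : ∏ p ∈ R, localDenom e V p = ∏ p ∈ R, p := prod_congr rfl fun p hp => by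
      rw [localDenom, if_neg fun hpV => disjoint_left.1 hdisj (h.subset hpV) hp]
    rw [hRV]
    exact hlt.trans (Nat.pow_le_pow_left h.denom_lt _)
  · rw [hcard]
    have h1 : 2 ^ 2 ^ #(T ∪ R) = (2 ^ 2 ^ #T) ^ 2 ^ #R := by
      rw [card_union_of_disjoint hdisj, ← pow_mul, ← pow_add]
    rw [h1]
    refine le_trans ?_ (Nat.pow_le_pow_left h.powers_le (2 ^ #R))
    rw [mul_pow]
    exact Nat.mul_le_mul_right _ (Nat.le_self_pow (by positivity) _)

theorem IsControlled.union_powers {e : ℕ → ℕ} {P T V R : Finset ℕ} (h : IsControlled e P T V)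
    (hP : ∀ p ∈ P, 2 ≤ p) (hR : R ⊆ T \ V) (hne : R.Nonempty) {a : ℕ} (ha : 1 ≤ a)
    (hD : ∏ p ∈ T, localDenom e V p = a + 1)
    (hlt : a * ∏ p ∈ R, p ^ (e p + 1) + 1 ≤ (a + 1) ^ 2 ^ #R) :
    IsControlled e P T (V ∪ R) := by
  have hdisj : Disjoint V R := disjoint_of_subset_right hR disjoint_sdiff
  have hcard : 2 ^ 2 ^ (#T + #(V ∪ R)) = (2 ^ 2 ^ (#T + #V)) ^ 2 ^ #R := by
    rw [card_union_of_disjoint hdisj, ← pow_mul, ← pow_add]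
    congr 2; omega
  have hRT : R ⊆ T := hR.trans sdiff_subset
  have hVR : V ∪ R ⊆ T := union_subset h.subset hRT
  obtain ⟨n, hn⟩ : ∃ n, 2 ^ #R = n + 2 := by
    have := Nat.pow_le_pow_right (n := 2) (by norm_num) (card_pos.2 hne)
    exact ⟨2 ^ #R - 2, by omega⟩
  have hz : ∏ p ∈ R, (p ^ (e p + 1) - 1) ≤ (a + 1) * (a + 2) ^ n := by
    rw [hn] at hlt
    have h1 := le_of_mul_add_one_le_pow ha hlt
    have h2 := prod_pred_add_one_le (z := fun p => p ^ (e p + 1)) hne fun p hp =>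
      Nat.one_le_pow _ _ (by have := hP p (h.subset_all (hRT hp)); omega)
    omega
  have hB := h.denom_lt
  rw [hD] at hB
  set B := 2 ^ 2 ^ (#T + #V)
  have hpow : (a + 2) ^ n ≤ B ^ n := Nat.pow_le_pow_left hB _
  have hVprod : ∏ p ∈ V ∪ R, (p ^ (e p + 1) - 1) =
      (∏ p ∈ V, (p ^ (e p + 1) - 1)) * ∏ p ∈ R, (p ^ (e p + 1) - 1) := prod_union hdisj
  have hTprod : a + 1 = (∏ p ∈ V, (p ^ (e p + 1) - 1)) * ∏ p ∈ T \ V, p := by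
    rw [← hD, ← prod_sdiff h.subset, mul_comm]
    congr 1
    · exact prod_congr rfl fun p hp => by rw [localDenom, if_pos hp]
    · exact prod_congr rfl fun p hp => by rw [localDenom, if_neg (mem_sdiff.1 hp).2]
  refine ⟨hVR, h.subset_all, ?_, ?_, fun hfin => ?_⟩
  · have h1 : ∏ p ∈ T, localDenom e (V ∪ R) p ≤
        (a + 1) * ∏ p ∈ R, (p ^ (e p + 1) - 1) := by
      rw [← hD, ← prod_sdiff hRT, ← prod_sdiff hRT, mul_assoc]
      have e1 : ∏ p ∈ T \ R, localDenom e (V ∪ R) p = ∏ p ∈ T \ R, localDenom e V p :=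
        prod_congr rfl fun p hp => by
          simp [localDenom, (mem_sdiff.1 hp).2]
      have e2 : ∏ p ∈ R, localDenom e (V ∪ R) p = ∏ p ∈ R, (p ^ (e p + 1) - 1) :=
        prod_congr rfl fun p hp => by simp [localDenom, hp]
      rw [e1, e2]
      refine Nat.mul_le_mul_left _ (Nat.le_mul_of_pos_left _ ?_)
      exact prod_pos fun p hp => localDenom_pos e V (hP p (h.subset_all (hRT hp)))
    rw [hcard, hn]
    have h2 : (a + 1) * ((a + 1) * (a + 2) ^ n) + 1 ≤ (a + 2) ^ (n + 2) := by
      have h3 : 1 ≤ (a + 2) ^ n := Nat.one_le_pow _ _ (by omega)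
      rw [pow_add]
      nlinarith
    calc _ ≤ (a + 1) * ((a + 1) * (a + 2) ^ n) + 1 :=
          Nat.add_le_add_right (h1.trans (Nat.mul_le_mul_left _ hz)) 1
      _ ≤ (a + 2) ^ (n + 2) := h2
      _ ≤ B ^ (n + 2) := Nat.pow_le_pow_left hB _
  · rw [hcard, hn, hVprod]
    calc _ = ((∏ p ∈ V, (p ^ (e p + 1) - 1)) * 2 ^ 2 ^ #T) *
          ∏ p ∈ R, (p ^ (e p + 1) - 1) := by ring
      _ ≤ B * (B * B ^ n) := by
        refine Nat.mul_le_mul h.powers_le (hz.trans (Nat.mul_le_mul (by omega) hpow))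
      _ = B ^ (n + 2) := by ring
  · have hT : T \ V ⊆ P := sdiff_subset.trans h.subset_all
    have hρ : ∏ p ∈ T \ V, p ≤ ∏ p ∈ P, p :=
      prod_le_prod_of_subset_of_one_le' hT fun p hp _ => by have := hP p hp; omega
    rw [hcard, hn, hVprod]
    set Y := ∏ p ∈ V, (p ^ (e p + 1) - 1)
    calc Y * (∏ p ∈ R, (p ^ (e p + 1) - 1)) * (2 ^ 2 ^ #T) ^ 2
        ≤ Y * ((a + 1) * (a + 2) ^ n) * (2 ^ 2 ^ #T) ^ 2 := by gcongr
      _ = (Y * 2 ^ 2 ^ #T) ^ 2 * ((a + 2) ^ n * ∏ p ∈ T \ V, p) := by rw [hTprod]; ring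
      _ ≤ B ^ 2 * (B ^ n * ∏ p ∈ P, p) := by gcongr; exact h.powers_le
      _ = B ^ (n + 2) * ∏ p ∈ P, p := by ring

theorem partialSum_union_ge {k : ℕ} (S : Fin k → Finset ℕ) (e : ℕ → ℕ) {P T V : Finset ℕ}
    (hP : ∀ p ∈ P, 2 ≤ p) (hTP : T ⊆ P) (hVT : V ⊆ T) :
    partialSum S e T V * ∏ p ∈ P \ T, (1 - 1 / (p : ℝ)) ≤ partialSum S e P V := by
  rw [partialSum, partialSum, sum_mul]
  refine sum_le_sum fun i _ => ?_
  have hpos : ∀ p ∈ P, 0 ≤ 1 - 1 / (p : ℝ) := fun p hp => by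
    have : (2 : ℝ) ≤ p := by exact_mod_cast hP p hp
    rw [sub_nonneg, div_le_one (by linarith)]
    linarith
  have h1 : ∏ p ∈ P ∩ S i, localFactor e V p =
      (∏ p ∈ T ∩ S i, localFactor e V p) * ∏ p ∈ (P \ T) ∩ S i, (1 - 1 / (p : ℝ)) := by
    have h2 : ∏ p ∈ (P \ T) ∩ S i, (1 - 1 / (p : ℝ)) =
        ∏ p ∈ (P \ T) ∩ S i, localFactor e V p := prod_congr rfl fun p hp => by
      rw [localFactor, if_neg fun h => (mem_sdiff.1 (mem_inter.1 hp).1).2 (hVT h)]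
    rw [h2, ← prod_union (disjoint_of_subset_left inter_subset_left
      (disjoint_of_subset_right inter_subset_left disjoint_sdiff)), ← union_inter_distrib_right,
      union_sdiff_of_subset hTP]
  rw [h1]
  refine mul_le_mul_of_nonneg_left (prod_le_prod_of_superset_of_le_one inter_subset_left
    (fun p hp => hpos p (mem_sdiff.1 hp).1) fun p hp => ?_)
    (prod_nonneg fun p hp => (localFactor_pos (hP p (hTP (mem_inter.1 hp).1))).le)
  rw [sub_le_self_iff]
  positivity

theorem partialSum_mul_prod_le {k : ℕ} (S : Fin k → Finset ℕ) (e : ℕ → ℕ) {T V : Finset ℕ}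
    {P : Finset ℕ} (hP : ∀ p ∈ P, 2 ≤ p) (hTP : T ⊆ P) :
    partialSum S e T P * ∏ p ∈ T \ V, (1 - 1 / ((p ^ (e p + 1) : ℕ) : ℝ)) ≤
      partialSum S e T V := by
  rw [partialSum, partialSum, sum_mul]
  refine sum_le_sum fun i _ => ?_
  have hpos : ∀ p ∈ P, 0 ≤ 1 - 1 / ((p ^ (e p + 1) : ℕ) : ℝ) := fun p hp => by
    have h1 : 1 ≤ p ^ (e p + 1) := Nat.one_le_pow _ _ (by have := hP p hp; omega)
    have h2 : (1 : ℝ) ≤ (p ^ (e p + 1) : ℕ) := by exact_mod_cast h1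
    rw [sub_nonneg, div_le_one (by linarith)]
    exact h2
  have h1 : ∏ p ∈ T ∩ S i, localFactor e V p = (∏ p ∈ T ∩ S i, localFactor e P p) *
      ∏ p ∈ T ∩ S i with p ∉ V, (1 - 1 / ((p ^ (e p + 1) : ℕ) : ℝ)) := by
    rw [prod_filter, ← prod_mul_distrib]
    refine prod_congr rfl fun p hp => ?_
    have hpP := hTP (mem_inter.1 hp).1
    split_ifs with h
    · rw [mul_one, localFactor, localFactor, if_pos h, if_pos hpP]
    · rw [localFactor_mul_of_mem (hP p hpP) hpP, localFactor, if_neg h]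
  rw [h1]
  refine mul_le_mul_of_nonneg_left (prod_le_prod_of_superset_of_le_one (fun p hp => ?_)
    (fun p hp => hpos p (hTP (mem_sdiff.1 hp).1)) fun p hp => ?_)
    (prod_nonneg fun p hp => (localFactor_pos (hP p (hTP (mem_inter.1 hp).1))).le)
  · rw [mem_filter, mem_inter] at hp
    exact mem_sdiff.2 ⟨hp.1.1, hp.2⟩
  · rw [sub_le_self_iff]
    positivity

theorem partialSum_mono_right {k : ℕ} (S : Fin k → Finset ℕ) (e : ℕ → ℕ) {T V V' : Finset ℕ}
    (hT : ∀ p ∈ T, 2 ≤ p) (hV : V ⊆ V') : partialSum S e T V ≤ partialSum S e T V' :=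
  sum_le_sum fun _ _ => prod_le_prod
    (fun p hp => (localFactor_pos (hT p (mem_inter.1 hp).1)).le)
    fun p hp => localFactor_mono (hT p (mem_inter.1 hp).1) hV

theorem partialSum_anti_left {k : ℕ} (S : Fin k → Finset ℕ) (e : ℕ → ℕ) {T T' V : Finset ℕ}
    (hT : ∀ p ∈ T', 2 ≤ p) (he : ∀ p ∈ T', 1 ≤ e p) (hTT : T ⊆ T') :
    partialSum S e T' V ≤ partialSum S e T V :=
  sum_le_sum fun _ _ => prod_le_prod_of_superset_of_le_one (inter_subset_inter_right hTT)
    (fun p hp => (localFactor_pos (hT p (mem_inter.1 hp).1)).le)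
    fun p hp => (localFactor_lt_one (hT p (mem_inter.1 hp).1) (he p (mem_inter.1 hp).1)).le

theorem partialSum_self_lt {k : ℕ} (S : Fin k → Finset ℕ) (e : ℕ → ℕ) {P V : Finset ℕ}
    (hP : ∀ p ∈ P, 2 ≤ p) (he : ∀ p ∈ P, 1 ≤ e p) (hS : ∀ p ∈ P, ∃ i, p ∈ S i)
    (hV : V ⊂ P) : partialSum S e P P < partialSum S e V V := by
  obtain ⟨q, hqP, hqV⟩ := exists_of_ssubset hV
  have hcongr : ∀ i, ∏ p ∈ V ∩ S i, localFactor e V p = ∏ p ∈ V ∩ S i, localFactor e P p :=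
    fun i => prod_congr rfl fun p hp => by
      have := (mem_inter.1 hp).1
      rw [localFactor, localFactor, if_pos this, if_pos (hV.subset this)]
  have hpos : ∀ i, ∀ p ∈ P ∩ S i, 0 < localFactor e P p := fun i p hp =>
    localFactor_pos (hP p (mem_inter.1 hp).1)
  have hle : ∀ i, ∀ p ∈ P ∩ S i, localFactor e P p < 1 := fun i p hp =>
    localFactor_lt_one (hP p (mem_inter.1 hp).1) (he p (mem_inter.1 hp).1)
  obtain ⟨i, hi⟩ := hS q hqP
  refine sum_lt_sum (fun j _ => ?_) ⟨i, mem_univ i, ?_⟩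
  · rw [hcongr]
    exact prod_le_prod_of_superset_of_le_one (inter_subset_inter_right hV.subset)
      (fun p hp => (hpos j p hp).le) fun p hp => (hle j p hp).le
  · rw [hcongr]
    have hq : q ∈ P ∩ S i := mem_inter.2 ⟨hqP, hi⟩
    rw [← mul_prod_erase _ _ hq]
    have h0 : 0 < ∏ p ∈ (P ∩ S i).erase q, localFactor e P p :=
      prod_pos fun p hp => hpos i p (mem_of_mem_erase hp)
    refine (mul_lt_of_lt_one_left h0 (hle i q hq)).trans_le
      (prod_le_prod_of_superset_of_le_one (fun p hp => ?_)
      (fun p hp => (hpos i p (mem_of_mem_erase hp)).le)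
      fun p hp => (hle i p (mem_of_mem_erase hp)).le)
    rw [mem_inter] at hp
    exact mem_erase.2 ⟨fun h => hqV (h ▸ hp.1), mem_inter.2 ⟨hV.subset hp.1, hp.2⟩⟩

theorem IsControlled.exists_larger {k : ℕ} {S : Fin k → Finset ℕ} {e : ℕ → ℕ}
    {P T V : Finset ℕ} (hP : ∀ p ∈ P, 2 ≤ p) (he : ∀ p ∈ P, 1 ≤ e p)
    (hS : ∀ p ∈ P, ∃ i, p ∈ S i) (hone : partialSum S e P P = 1)
    (hne : ∀ T V, V ⊂ T → T ⊆ P → partialSum S e T V ≠ 1)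
    (h : IsControlled e P T V) (hV : V ≠ P) :
    ∃ T' V', IsControlled e P T' V' ∧ #T + #V < #T' + #V' := by
  obtain ⟨m, hm⟩ := exists_prod_localDenom_mul_partialSum_eq S e T V
    fun p hp => hP p (h.subset_all hp)
  have hDpos : 0 < ∏ p ∈ T, localDenom e V p :=
    prod_pos fun p hp => localDenom_pos e V (hP p (h.subset_all hp))
  have hDpos' : (0 : ℝ) < (∏ p ∈ T, localDenom e V p : ℕ) := by exact_mod_cast hDpos
  have hVP : V ⊆ P := h.subset.trans h.subset_all
  rcases lt_or_ge 1 (partialSum S e T V) with hF | hF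
  · have hm' : ∏ p ∈ T, localDenom e V p + 1 ≤ m := by
      have h1 := mul_lt_mul_of_pos_left hF hDpos'
      rw [hm, mul_one] at h1
      exact_mod_cast h1
    have hprod : ∏ p ∈ P \ T, (1 - 1 / (p : ℝ)) ≤
        ((∏ p ∈ T, localDenom e V p : ℕ) : ℝ) /
          (((∏ p ∈ T, localDenom e V p : ℕ) : ℝ) + 1) := by
      have h1 := (partialSum_union_ge S e hP h.subset_all h.subset).trans
        ((partialSum_mono_right S e hP hVP).trans hone.le)
      have h2 := mul_le_mul_of_nonneg_left h1 hDpos'.le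
      rw [← mul_assoc, hm, mul_one] at h2
      rw [le_div_iff₀ (by positivity), mul_comm]
      refine le_trans (mul_le_mul_of_nonneg_right ?_ (prod_nonneg fun p hp => ?_)) h2
      · exact_mod_cast hm'
      · have : (2 : ℝ) ≤ p := by exact_mod_cast hP p (mem_sdiff.1 hp).1
        rw [sub_nonneg, div_le_one (by linarith)]
        linarith
    obtain ⟨R, hR, hRne, hlt⟩ := exists_subset_mul_prod_lt _ hDpos (P \ T) (fun p => p)
      (fun p hp => hP p (mem_sdiff.1 hp).1) hprod
    refine ⟨T ∪ R, V, h.union_primes hV hR hlt, ?_⟩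
    rw [card_union_of_disjoint (disjoint_of_subset_right hR disjoint_sdiff)]
    have := card_pos.2 hRne
    omega
  · have hVT : V ⊂ T := by
      refine h.subset.ssubset_of_ne ?_
      rintro rfl
      have := partialSum_self_lt S e hP he hS (hVP.ssubset_of_ne hV)
      linarith
    have hF' := hF.lt_of_ne (hne T V hVT h.subset_all)
    have hm' : m + 1 ≤ ∏ p ∈ T, localDenom e V p := by
      have h1 := mul_lt_mul_of_pos_left hF' hDpos'
      rw [hm, mul_one] at h1
      exact_mod_cast h1
    have hprod := (partialSum_mul_prod_le S e (V := V) hP h.subset_all)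
    have hTP : 1 ≤ partialSum S e T P :=
      hone.ge.trans (partialSum_anti_left S e hP he h.subset_all)
    have hzpos : ∀ p ∈ P, 1 < p ^ (e p + 1) := fun p hp =>
      Nat.one_lt_pow (by omega) (hP p hp)
    have hupos : 0 < ∏ p ∈ T \ V, (1 - 1 / ((p ^ (e p + 1) : ℕ) : ℝ)) :=
      prod_pos fun p hp => by
        have : (1 : ℝ) < (p ^ (e p + 1) : ℕ) := by
          exact_mod_cast hzpos p (h.subset_all (mem_sdiff.1 hp).1)
        rw [sub_pos, div_lt_one (by linarith)]
        exact this
    have hprod' : ∏ p ∈ T \ V, (1 - 1 / ((p ^ (e p + 1) : ℕ) : ℝ)) ≤ partialSum S e T V :=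
      (le_mul_of_one_le_left hupos.le hTP).trans hprod
    have hmpos : 0 < m := by
      have := mul_pos hDpos' (hupos.trans_le hprod')
      rw [hm] at this
      exact_mod_cast this
    obtain ⟨a, ha⟩ : ∃ a, ∏ p ∈ T, localDenom e V p = a + 1 := ⟨_, (Nat.sub_add_cancel hDpos).symm⟩
    rw [ha] at hm' hm hDpos'
    have ha1 : 1 ≤ a := by omega
    have hprod'' : ∏ p ∈ T \ V, (1 - 1 / ((p ^ (e p + 1) : ℕ) : ℝ)) ≤ (a : ℝ) / (a + 1) := by
      refine hprod'.trans ?_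
      push_cast at hm
      rw [le_div_iff₀ (by positivity), mul_comm, hm]
      exact_mod_cast (by omega : m ≤ a)
    obtain ⟨R, hR, hRne, hlt⟩ := exists_subset_mul_prod_lt a ha1 (T \ V)
      (fun p => p ^ (e p + 1)) (fun p hp => hzpos p (h.subset_all (mem_sdiff.1 hp).1)) hprod''
    refine ⟨T, V ∪ R, h.union_powers hP hR hRne ha1 ha hlt, ?_⟩
    rw [card_union_of_disjoint (disjoint_of_subset_right hR disjoint_sdiff)]
    have := card_pos.2 hRne
    omega

theorem prod_pow_sub_one_le {k : ℕ} {S : Fin k → Finset ℕ} {e : ℕ → ℕ}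
    {P : Finset ℕ} (hP : ∀ p ∈ P, 2 ≤ p) (he : ∀ p ∈ P, 1 ≤ e p)
    (hS : ∀ p ∈ P, ∃ i, p ∈ S i) (hone : partialSum S e P P = 1)
    (hne : ∀ T V, V ⊂ T → T ⊆ P → partialSum S e T V ≠ 1) (hPne : P.Nonempty) :
    (∏ p ∈ P, (p ^ (e p + 1) - 1)) * (2 ^ 2 ^ #P) ^ 2 ≤ 2 ^ 4 ^ #P * ∏ p ∈ P, p := by
  have key : ∀ n T V, IsControlled e P T V → 2 * #P ≤ #T + #V + n →
      IsControlled e P P P := by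
    intro n
    induction n with
    | zero =>
      intro T V h hn
      have hV := card_le_card h.subset
      have hT := card_le_card h.subset_all
      have e1 : T = P := eq_of_subset_of_card_le h.subset_all (by omega)
      have e2 : V = T := eq_of_subset_of_card_le h.subset (by omega)
      rwa [e2, e1] at h
    | succ n ih =>
      intro T V h hn
      by_cases hV : V = P
      · have hT : T = P := h.subset_all.antisymm (hV ▸ h.subset)
        rwa [hV, hT] at h
      · obtain ⟨T', V', h', hlt⟩ := h.exists_larger hP he hS hone hne hV
        exact ih T' V' h' (by omega)
  have h0 : IsControlled e P ∅ ∅ :=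
    ⟨subset_rfl, empty_subset _, by simp, by simp, fun h => absurd h.symm hPne.ne_empty⟩
  have := (key (2 * #P) ∅ ∅ h0 (by simp)).final rfl
  rwa [← two_mul, pow_mul 2 2 #P] at this

/-- A sum of fractions of which exactly one has a denominator divisible by the prime `p`, its
numerator being prime to `p`, is not `1`. -/
theorem sum_div_ne_one {ι : Type*} [Fintype ι] [DecidableEq ι] {p : ℕ} (hp : p.Prime) (i : ι)
    (n c : ι → ℕ) (hc : ∀ j, c j ≠ 0) (hi : p ∣ c i) (hn : ¬ p ∣ n i)
    (hj : ∀ j, j ≠ i → ¬ p ∣ c j) : ∑ j, (n j : ℝ) / (c j : ℝ) ≠ 1 := by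
  intro h
  have hcR : ∀ j, (c j : ℝ) ≠ 0 := fun j => by exact_mod_cast hc j
  set E := ∏ j ∈ univ.erase i, c j
  have hE : ¬ p ∣ E := by
    rw [hp.prime.dvd_finsetProd_iff]
    rintro ⟨j, hj', hd⟩
    exact hj j (mem_erase.1 hj').1 hd
  obtain ⟨m, hm⟩ : ∃ m : ℕ, (∑ j ∈ univ.erase i, (n j : ℝ) / (c j : ℝ)) * E = m := by
    refine ⟨∑ j ∈ univ.erase i, n j * ∏ l ∈ (univ.erase i).erase j, c l, ?_⟩
    rw [sum_mul, Nat.cast_sum]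
    refine sum_congr rfl fun j hj' => ?_
    have hEj : E = c j * ∏ l ∈ (univ.erase i).erase j, c l := (mul_prod_erase _ c hj').symm
    rw [hEj, Nat.cast_mul, Nat.cast_mul, ← mul_assoc, div_mul_cancel₀ _ (hcR j)]
  rw [← add_sum_erase _ _ (mem_univ i)] at h
  have key : (n i : ℝ) * E + c i * m = c i * E := by
    rw [← hm]
    have h2 : (c i : ℝ) * ((n i : ℝ) / c i) = n i := mul_div_cancel₀ _ (hcR i)
    linear_combination (c i * E : ℝ) * h - E * h2
  have key' : n i * E + c i * m = c i * E := by exact_mod_cast key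
  have hd : p ∣ n i * E := (Nat.dvd_add_left (hi.mul_right m)).1 (key' ▸ hi.mul_right E)
  exact (hp.dvd_mul.1 hd).elim hn hE

theorem one_lt_pi_sq_div_six_mul_prod {P : Finset ℕ} (hP : ∀ p ∈ P, p.Prime) :
    1 < Real.pi ^ 2 / 6 * ∏ p ∈ P, (1 - 1 / (p : ℝ) ^ 2) := by
  let f : ℕ →* ℝ :=
    { toFun := fun n => 1 / (n : ℝ) ^ 2
      map_one' := by simp
      map_mul' := fun m n => by simp [mul_pow, mul_comm] }
  have hf : HasSum f (Real.pi ^ 2 / 6) := hasSum_zeta_two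
  have hfp : ∀ {p : ℕ}, p.Prime → f p < 1 := fun {p} hp => by
    have : (1 : ℝ) < p := by exact_mod_cast hp.one_lt
    exact (div_lt_one (by positivity)).2 (one_lt_pow₀ this two_ne_zero)
  have hf0 : ∀ n, 0 ≤ f n := fun n => div_nonneg zero_le_one (sq_nonneg _)
  have h1 := (EulerProduct.summable_and_hasSum_factoredNumbers_prod_filter_prime_geometric
    (f := f) (fun {p} hp => by rw [Real.norm_of_nonneg (hf0 p)]; exact hfp hp) P).2
  rw [filter_true_of_mem hP] at h1
  have h2 : HasSum ((Nat.factoredNumbers P).indicator f) (∏ p ∈ P, (1 - f p)⁻¹) :=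
    hasSum_subtype_iff_indicator.1 h1
  obtain ⟨q, hqP, hq⟩ := Nat.exists_infinite_primes (P.sup id + 1)
  have hqn : q ∉ Nat.factoredNumbers P := fun h => by
    have hmem := Nat.primeFactors_subset_of_mem_factoredNumbers h
      (hq.mem_primeFactors_self)
    have := le_sup (f := id) hmem
    simp only [id] at this
    omega
  have hlt : ∏ p ∈ P, (1 - f p)⁻¹ < Real.pi ^ 2 / 6 := by
    refine hasSum_lt (i := q) (fun n => Set.indicator_le_self' (fun _ _ => hf0 _) n) ?_ h2 hf
    rw [Set.indicator_of_notMem hqn]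
    have : (0 : ℝ) < q := by exact_mod_cast hq.pos
    exact div_pos one_pos (by positivity)
  have hpos : 0 < ∏ p ∈ P, (1 - f p) := prod_pos fun p hp => sub_pos.2 (hfp (hP p hp))
  rw [prod_inv_distrib, inv_lt_iff_one_lt_mul₀ hpos] at hlt
  exact hlt

theorem sigma_eq_prod {n : ℕ} (hn : n ≠ 0) :
    sigma n = ∏ p ∈ n.primeFactors, ∑ j ∈ range (n.factorization p + 1), p ^ j :=
  Nat.sum_divisors hn

theorem localFactor_eq_of_mem {e : ℕ → ℕ} {V : Finset ℕ} {p : ℕ} (hp : 2 ≤ p) (h : p ∈ V) :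
    localFactor e V p = (p ^ e p : ℕ) / (∑ j ∈ range (e p + 1), p ^ j : ℕ) := by
  have hp' : (2 : ℝ) ≤ p := by exact_mod_cast hp
  rw [localFactor, if_pos h]
  push_cast
  rw [geom_sum_eq (by linarith), div_div_eq_mul_div]

section Anarchy

variable {k : ℕ} {M : Fin k → ℕ}

theorem factorization_prod_apply_of_mem (hpos : ∀ i, 0 < M i)
    (hcop : ∀ i j, i ≠ j → Nat.Coprime (M i) (M j)) {i : Fin k} {p : ℕ}
    (hp : p ∈ (M i).primeFactors) : (∏ j, M j).factorization p = (M i).factorization p := by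
  rw [Nat.factorization_prod fun j _ => (hpos j).ne', Finsupp.finsetSum_apply]
  refine sum_eq_single i (fun j _ hj => ?_) fun h => absurd (mem_univ i) h
  refine Nat.factorization_eq_zero_of_not_dvd fun hd => ?_
  exact (Nat.prime_of_mem_primeFactors hp).one_lt.ne'
    (Nat.eq_one_of_dvd_coprimes (hcop i j hj.symm) (Nat.dvd_of_mem_primeFactors hp) hd)

theorem primeFactors_subset_prod (hpos : ∀ i, 0 < M i) (i : Fin k) :
    (M i).primeFactors ⊆ (∏ j, M j).primeFactors :=
  Nat.primeFactors_mono (dvd_prod_of_mem M (mem_univ i))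
    (prod_ne_zero_iff.2 fun j _ => (hpos j).ne')

theorem partialSum_primeFactors (hpos : ∀ i, 0 < M i)
    (hcop : ∀ i j, i ≠ j → Nat.Coprime (M i) (M j)) :
    partialSum (fun i => (M i).primeFactors) (∏ i, M i).factorization
      (∏ i, M i).primeFactors (∏ i, M i).primeFactors =
      ∑ i, (M i : ℝ) / (sigma (M i) : ℝ) := by
  refine sum_congr rfl fun i _ => ?_
  rw [inter_eq_right.2 (primeFactors_subset_prod hpos i)]
  rw [sigma_eq_prod (hpos i).ne']
  conv_rhs => enter [1, 1]; rw [← Nat.prod_factorization_pow_eq_self (hpos i).ne']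
  rw [Finsupp.prod, Nat.support_factorization, Nat.cast_prod, Nat.cast_prod, ← prod_div_distrib]
  refine prod_congr rfl fun p hp => ?_
  rw [localFactor_eq_of_mem (Nat.prime_of_mem_primeFactors hp).two_le
    (primeFactors_subset_prod hpos i hp), factorization_prod_apply_of_mem hpos hcop hp]

theorem partialSum_ne_one (hpos : ∀ i, 0 < M i)
    (hanarchy : ∀ i j, i ≠ j → Nat.gcd (M i) (M j * sigma (M j)) = 1) {T V : Finset ℕ}
    (hVT : V ⊂ T) (hT : T ⊆ (∏ i, M i).primeFactors) :
    partialSum (fun i => (M i).primeFactors) (∏ i, M i).factorization T V ≠ 1 := by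
  set e := (∏ i, M i).factorization
  have hcop : ∀ i j, i ≠ j → Nat.Coprime (M i) (M j) := fun i j hij =>
    Nat.Coprime.coprime_mul_right_right (hanarchy i j hij)
  have hcop' : ∀ i j, i ≠ j → Nat.Coprime (M i) (sigma (M j)) := fun i j hij =>
    Nat.Coprime.coprime_mul_left_right (hanarchy i j hij)
  have hprime : ∀ q ∈ T, q.Prime := fun q hq => Nat.prime_of_mem_primeFactors (hT hq)
  have hne : (T \ V).Nonempty := sdiff_nonempty.2 hVT.not_subset
  set p := (T \ V).max' hne
  have hpmem : p ∈ T \ V := max'_mem _ hne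
  obtain ⟨hpT, hpV⟩ := mem_sdiff.1 hpmem
  have hp := hprime p hpT
  obtain ⟨i, -, hpi⟩ := (hp.prime.dvd_finsetProd_iff _).1 (Nat.dvd_of_mem_primeFactors (hT hpT))
  let c : ℕ → ℕ := fun q => if q ∈ V then ∑ j ∈ range (e q + 1), q ^ j else q
  let n : ℕ → ℕ := fun q => if q ∈ V then q ^ e q else q - 1
  have hloc : ∀ q ∈ T, localFactor e V q = n q / c q := fun q hq => by
    have hq2 := (hprime q hq).two_le
    by_cases h : q ∈ V
    · simp only [n, c, if_pos h]
      exact localFactor_eq_of_mem hq2 h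
    · simp only [n, c, if_neg h, localFactor]
      have : (q : ℝ) ≠ 0 := by exact_mod_cast (hprime q hq).ne_zero
      push_cast [(by omega : 1 ≤ q)]
      field_simp
  have hsum : partialSum (fun i => (M i).primeFactors) e T V =
      ∑ j, ((∏ q ∈ T ∩ (M j).primeFactors, n q : ℕ) : ℝ) /
        ((∏ q ∈ T ∩ (M j).primeFactors, c q : ℕ) : ℝ) := by
    refine sum_congr rfl fun j _ => ?_
    rw [Nat.cast_prod, Nat.cast_prod, ← prod_div_distrib]
    exact prod_congr rfl fun q hq => hloc q (mem_inter.1 hq).1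
  rw [hsum]
  refine sum_div_ne_one hp i _ _ (fun j => prod_ne_zero_iff.2 fun q hq => ?_) ?_ ?_
    fun j hj => ?_
  · have hq0 := (hprime q (mem_inter.1 hq).1).pos
    simp only [c]
    split_ifs
    · exact (sum_pos (fun _ _ => pow_pos hq0 _) (by simp)).ne'
    · exact hq0.ne'
  · have hpS : p ∈ T ∩ (M i).primeFactors :=
      mem_inter.2 ⟨hpT, Nat.mem_primeFactors.2 ⟨hp, hpi, (hpos i).ne'⟩⟩
    have := dvd_prod_of_mem c hpS
    simpa only [c, if_neg hpV] using this
  · rw [hp.prime.dvd_finsetProd_iff]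
    rintro ⟨q, hq, hd⟩
    have hqT := (mem_inter.1 hq).1
    by_cases h : q ∈ V
    · simp only [n, if_pos h] at hd
      have := (Nat.prime_dvd_prime_iff_eq hp (hprime q hqT)).1 (hp.dvd_of_dvd_pow hd)
      exact hpV (this ▸ h)
    · simp only [n, if_neg h] at hd
      have h1 := (T \ V).le_max' q (mem_sdiff.2 ⟨hqT, h⟩)
      have h2 := (hprime q hqT).two_le
      have h3 := Nat.le_of_dvd (by omega) hd
      change q ≤ p at h1
      omega
  · rw [hp.prime.dvd_finsetProd_iff]
    rintro ⟨q, hq, hd⟩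
    have hqj := (mem_inter.1 hq).2
    by_cases h : q ∈ V
    · simp only [c, if_pos h] at hd
      have h1 : p ∣ sigma (M j) := by
        rw [sigma_eq_prod (hpos j).ne']
        refine hd.trans ?_
        simp only [e]
        rw [factorization_prod_apply_of_mem hpos hcop hqj]
        exact dvd_prod_of_mem (fun q => ∑ l ∈ range ((M j).factorization q + 1), q ^ l) hqj
      exact hp.one_lt.ne' (Nat.eq_one_of_dvd_coprimes (hcop' i j hj.symm) hpi h1)
    · simp only [c, if_neg h] at hd
      exact hp.one_lt.ne' (Nat.eq_one_of_dvd_coprimes (hcop i j hj.symm) hpi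
        (hd.trans (Nat.dvd_of_mem_primeFactors hqj)))

end Anarchy

theorem lt_pi_sq_div_six_mul {N : ℕ} (hN : N ≠ 0) {C : ℝ}
    (h : ((∏ p ∈ N.primeFactors, (p ^ (N.factorization p + 1) - 1) : ℕ) : ℝ) ≤
      C * ((∏ p ∈ N.primeFactors, p : ℕ) : ℝ)) : (N : ℝ) < Real.pi ^ 2 / 6 * C := by
  have hprime : ∀ p ∈ N.primeFactors, p.Prime := fun p => Nat.prime_of_mem_primeFactors
  have hrad : (0 : ℝ) < (∏ p ∈ N.primeFactors, p : ℕ) := by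
    exact_mod_cast prod_pos fun p hp => (hprime p hp).pos
  have hE := one_lt_pi_sq_div_six_mul_prod hprime
  have hle : (N : ℝ) * ((∏ p ∈ N.primeFactors, p : ℕ) : ℝ) *
      ∏ p ∈ N.primeFactors, (1 - 1 / (p : ℝ) ^ 2) ≤
      ((∏ p ∈ N.primeFactors, (p ^ (N.factorization p + 1) - 1) : ℕ) : ℝ) := by
    have hNprod : N = ∏ p ∈ N.primeFactors, p ^ N.factorization p :=
      (Nat.prod_factorization_pow_eq_self hN).symm
    have hNprod' : (N : ℝ) = ∏ p ∈ N.primeFactors, (p : ℝ) ^ N.factorization p := by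
      exact_mod_cast hNprod
    rw [hNprod', Nat.cast_prod, Nat.cast_prod, ← prod_mul_distrib, ← prod_mul_distrib]
    refine prod_le_prod (fun p hp => ?_) fun p hp => ?_
    · have : (1 : ℝ) < p := by exact_mod_cast (hprime p hp).one_lt
      refine mul_nonneg (by positivity) ?_
      rw [sub_nonneg, div_le_one (by positivity)]
      exact one_le_pow₀ this.le
    · have h1 : (1 : ℝ) < p := by exact_mod_cast (hprime p hp).one_lt
      have h2 : 1 ≤ p ^ (N.factorization p + 1) := Nat.one_le_pow _ _ (hprime p hp).pos
      have h3 : N.factorization p ≠ 0 := Finsupp.mem_support_iff.1 hp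
      obtain ⟨e, he⟩ := Nat.exists_eq_succ_of_ne_zero h3
      have h4 : (1 : ℝ) ≤ (p : ℝ) ^ e := one_le_pow₀ h1.le
      push_cast [h2]
      rw [he, Nat.succ_eq_add_one]
      have h5 : (p : ℝ) ^ (e + 1) * p * (1 - 1 / (p : ℝ) ^ 2) =
          (p : ℝ) ^ (e + 1 + 1) - (p : ℝ) ^ e := by
        field_simp
        ring
      rw [h5]
      linarith
  have hN' : (0 : ℝ) < N := by exact_mod_cast Nat.pos_of_ne_zero hN
  have h1 : (N : ℝ) * ∏ p ∈ N.primeFactors, (1 - 1 / (p : ℝ) ^ 2) ≤ C := by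
    refine le_of_mul_le_mul_right ?_ hrad
    linarith
  calc (N : ℝ) < N * (Real.pi ^ 2 / 6 * ∏ p ∈ N.primeFactors, (1 - 1 / (p : ℝ) ^ 2)) :=
        lt_mul_of_one_lt_right hN' hE
    _ = Real.pi ^ 2 / 6 * (N * ∏ p ∈ N.primeFactors, (1 - 1 / (p : ℝ) ^ 2)) := by ring
    _ ≤ Real.pi ^ 2 / 6 * C := mul_le_mul_of_nonneg_left h1 (by positivity)

theorem amicable_tuples_stmt0 (k : ℕ) (hk : 2 ≤ k) (M : Fin k → ℕ)
    (hpos : ∀ i, 0 < M i) (hdist : Function.Injective M)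
    (hanarchy : ∀ i j, i ≠ j → Nat.gcd (M i) (M j * sigma (M j)) = 1)
    (hharm : ∑ i, (M i : ℝ) / (sigma (M i) : ℝ) = 1)
    (K : ℕ) (hK : K = (∏ i, M i).primeFactors.card) :
    ((∏ i, M i : ℕ) : ℝ) <
      Real.pi ^ 2 / 6 * (2 : ℝ) ^ ((4 : ℝ) ^ K - 2 * (2 : ℝ) ^ K) := by
  have hcop : ∀ i j, i ≠ j → Nat.Coprime (M i) (M j) := fun i j hij =>
    Nat.Coprime.coprime_mul_right_right (hanarchy i j hij)
  have hN : ∏ i, M i ≠ 0 := prod_ne_zero_iff.2 fun i _ => (hpos i).ne'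
  have hprime : ∀ p ∈ (∏ i, M i).primeFactors, p.Prime := fun p => Nat.prime_of_mem_primeFactors
  have hne : (∏ i, M i).primeFactors.Nonempty := by
    by_contra! h
    have h1 : ∏ i, M i = 1 := (Nat.primeFactors_eq_empty.1 h).resolve_left hN
    have h2 : ∀ i, M i = 1 := fun i =>
      Nat.dvd_one.1 (h1 ▸ dvd_prod_of_mem M (mem_univ i))
    have h3 : (⟨0, by omega⟩ : Fin k) = ⟨1, by omega⟩ := hdist (by rw [h2, h2])
    simp at h3
  have key := prod_pow_sub_one_le (S := fun i => (M i).primeFactors)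
    (e := (∏ i, M i).factorization) (fun p hp => (hprime p hp).two_le)
    (fun p hp => Nat.one_le_iff_ne_zero.2 (Finsupp.mem_support_iff.1 hp))
    (fun p hp => by
      obtain ⟨i, -, hi⟩ := ((hprime p hp).prime.dvd_finsetProd_iff _).1
        (Nat.dvd_of_mem_primeFactors hp)
      exact ⟨i, Nat.mem_primeFactors.2 ⟨hprime p hp, hi, (hpos i).ne'⟩⟩)
    ((partialSum_primeFactors hpos hcop).trans hharm)
    (fun T V hVT hT => partialSum_ne_one hpos hanarchy hVT hT) hne
  rw [← hK] at key
  have hexp : (2 : ℝ) ^ ((4 : ℝ) ^ K - 2 * (2 : ℝ) ^ K) =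
      (2 : ℝ) ^ 4 ^ K / ((2 : ℝ) ^ 2 ^ K) ^ 2 := by
    rw [Real.rpow_sub two_pos, ← Real.rpow_natCast 2 (4 ^ K), ← pow_mul,
      ← Real.rpow_natCast 2 (2 ^ K * 2)]
    push_cast
    rw [mul_comm ((2 : ℝ) ^ K)]
  rw [hexp]
  refine lt_pi_sq_div_six_mul hN ?_
  rw [div_mul_eq_mul_div, le_div_iff₀ (by positivity)]
  exact_mod_cast key
end

section
/- Let (M, N) be an amicable pair with gcd(M, N) = 1, and set K = ω(MN). Then MN < (π²/6) · 2^{4^K − 2·2^K}. -/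
section AmicableBound

open Finset

theorem sum_mul_nonneg_of_prefix {c d : ℕ → ℝ} {k : ℕ}
    (hc : ∀ i j, i ≤ j → j < k → c j ≤ c i) (hc0 : ∀ i < k, 0 ≤ c i)
    (hd : ∀ j ≤ k, 0 ≤ ∑ i ∈ range j, d i) : 0 ≤ ∑ i ∈ range k, c i * d i := by
  have key : ∀ j, j < k → c j * ∑ i ∈ range (j + 1), d i ≤ ∑ i ∈ range (j + 1), c i * d i := by
    intro j
    induction j with
    | zero => intro _; simp
    | succ j ih =>
      intro hj
      rw [sum_range_succ, sum_range_succ _ (j + 1), mul_add]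
      have h1 := ih (by omega)
      have h2 := mul_le_mul_of_nonneg_right (hc j (j + 1) (by omega) hj) (hd (j + 1) (by omega))
      linarith
  rcases k with _ | k
  · simp
  · exact (mul_nonneg (hc0 k (by omega)) (hd (k + 1) le_rfl)).trans (key k (by omega))

theorem log_one_sub_inv_tangent {x y : ℝ} (hx : 1 < x) (hy : 1 < y) :
    (x - 1)⁻¹ * (Real.log x - Real.log y) ≤ Real.log (1 - x⁻¹) - Real.log (1 - y⁻¹) := by
  have hx1 : 0 < x - 1 := by linarith
  have hy1 : 0 < y - 1 := by linarith
  have hx' : 0 < 1 - x⁻¹ := sub_pos.2 (inv_lt_one_of_one_lt₀ hx)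
  have hy' : 0 < 1 - y⁻¹ := sub_pos.2 (inv_lt_one_of_one_lt₀ hy)
  have h1 : Real.log ((1 - y⁻¹) / (1 - x⁻¹)) ≤ (1 - y⁻¹) / (1 - x⁻¹) - 1 :=
    Real.log_le_sub_one_of_pos (by positivity)
  have h2 : Real.log (x / y) ≤ x / y - 1 := Real.log_le_sub_one_of_pos (by positivity)
  rw [Real.log_div (by positivity) (by positivity)] at h1 h2
  have h3 : (1 - y⁻¹) / (1 - x⁻¹) - 1 = - ((x - 1)⁻¹ * (x / y - 1)) := by
    have : x ≠ 0 := by positivity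
    have : y ≠ 0 := by positivity
    have := hx1.ne'
    have : 1 - x⁻¹ = (x - 1) / x := by field_simp
    rw [this]
    field_simp
    ring
  have h4 := mul_le_mul_of_nonneg_left h2 (inv_pos.2 hx1).le
  linarith

theorem log_one_add_inv_tangent {z w : ℝ} (hz : 0 < z) (hw : 0 < w) :
    Real.log (1 + z⁻¹) - Real.log (1 + w⁻¹) ≤ (z + 1)⁻¹ * (Real.log w - Real.log z) := by
  have h := strictConcaveOn_log_Ioi.concaveOn.2 (Set.mem_Ioi.2 (show 0 < w⁻¹ * z by positivity))
    (Set.mem_Ioi.2 one_pos) (show 0 ≤ (z + 1)⁻¹ by positivity)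
    (show 0 ≤ z / (z + 1) by positivity) (by field_simp; ring)
  have e : (z + 1)⁻¹ • (w⁻¹ * z) + (z / (z + 1)) • (1 : ℝ) = (1 + w⁻¹) / (1 + z⁻¹) := by
    simp only [smul_eq_mul]; field_simp; ring
  rw [e, Real.log_div (by positivity) (by positivity), Real.log_mul (by positivity) (by positivity)] at h
  simp only [smul_eq_mul, Real.log_one, Real.log_inv, mul_zero, add_zero] at h
  linarith

theorem prod_pow_two_pow_range (a : ℝ) (k : ℕ) :
    (∏ i ∈ range k, (a ^ 2 ^ i + 1)) * (a - 1) = a ^ 2 ^ k - 1 := by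
  induction k with
  | zero => simp
  | succ k ih =>
    rw [prod_range_succ, mul_right_comm, ih, pow_succ 2 k, pow_mul]; ring

theorem prod_pow_two_pow_range' (a : ℝ) (k : ℕ) :
    (∏ i ∈ range k, a ^ 2 ^ i) * a = a ^ 2 ^ k := by
  induction k with
  | zero => simp
  | succ k ih =>
    rw [prod_range_succ, mul_right_comm, ih, pow_succ 2 k, pow_mul]; ring

theorem prod_one_sub_inv_le {x y : ℕ → ℝ} {k : ℕ} (hx : ∀ i < k, 1 < x i) (hy : ∀ i < k, 1 < y i)
    (hmono : ∀ i j, i ≤ j → j < k → x i ≤ x j)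
    (hxy : ∀ j ≤ k, ∏ i ∈ range j, y i ≤ ∏ i ∈ range j, x i) :
    ∏ i ∈ range k, (1 - (y i)⁻¹) ≤ ∏ i ∈ range k, (1 - (x i)⁻¹) := by
  have hpos : ∀ {f : ℕ → ℝ}, (∀ i < k, 1 < f i) → ∀ i < k, 0 < 1 - (f i)⁻¹ := fun hf i hi =>
    sub_pos.2 (inv_lt_one_of_one_lt₀ (hf i hi))
  have key := sum_mul_nonneg_of_prefix (c := fun i => (x i - 1)⁻¹)
    (d := fun i => Real.log (x i) - Real.log (y i)) (k := k)
    (fun i j hij hj => inv_anti₀ (by linarith [hx i (by omega)]) (by linarith [hmono i j hij hj]))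
    (fun i hi => inv_nonneg.2 (by linarith [hx i hi]))
    (fun j hj => by
      have hy0 : ∀ i ∈ range j, 0 < y i := fun i hi => by
        linarith [hy i (by have := mem_range.1 hi; omega)]
      have hx0 : ∀ i ∈ range j, 0 < x i := fun i hi => by
        linarith [hx i (by have := mem_range.1 hi; omega)]
      rw [sum_sub_distrib, ← Real.log_prod (fun i hi => (hx0 i hi).ne'),
        ← Real.log_prod (fun i hi => (hy0 i hi).ne'), sub_nonneg]
      exact Real.log_le_log (prod_pos hy0) (hxy j hj))
  have h2 := key.trans (sum_le_sum fun i hi =>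
    log_one_sub_inv_tangent (hx i (mem_range.1 hi)) (hy i (mem_range.1 hi)))
  rw [sum_sub_distrib, ← Real.log_prod (fun i hi => (hpos hx i (mem_range.1 hi)).ne'),
    ← Real.log_prod (fun i hi => (hpos hy i (mem_range.1 hi)).ne'), sub_nonneg] at h2
  exact (Real.log_le_log_iff (prod_pos fun i hi => hpos hy i (mem_range.1 hi))
    (prod_pos fun i hi => hpos hx i (mem_range.1 hi))).1 h2

theorem prod_one_add_inv_le {z w : ℕ → ℝ} {k : ℕ} (hz : ∀ i < k, 0 < z i) (hw : ∀ i < k, 0 < w i)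
    (hmono : ∀ i j, i ≤ j → j < k → z i ≤ z j)
    (hzw : ∀ j ≤ k, ∏ i ∈ range j, w i ≤ ∏ i ∈ range j, z i) :
    ∏ i ∈ range k, (1 + (z i)⁻¹) ≤ ∏ i ∈ range k, (1 + (w i)⁻¹) := by
  have hpos : ∀ {f : ℕ → ℝ}, (∀ i < k, 0 < f i) → ∀ i < k, 0 < 1 + (f i)⁻¹ := fun hf i hi => by
    have := inv_pos.2 (hf i hi)
    linarith
  have key := sum_mul_nonneg_of_prefix (c := fun i => (z i + 1)⁻¹)
    (d := fun i => Real.log (z i) - Real.log (w i)) (k := k)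
    (fun i j hij hj => inv_anti₀ (by linarith [hz i (by omega)]) (by linarith [hmono i j hij hj]))
    (fun i hi => inv_nonneg.2 (by linarith [hz i hi]))
    (fun j hj => by
      have hw0 : ∀ i ∈ range j, 0 < w i := fun i hi => hw i (by have := mem_range.1 hi; omega)
      have hz0 : ∀ i ∈ range j, 0 < z i := fun i hi => hz i (by have := mem_range.1 hi; omega)
      rw [sum_sub_distrib, ← Real.log_prod (fun i hi => (hz0 i hi).ne'),
        ← Real.log_prod (fun i hi => (hw0 i hi).ne'), sub_nonneg]
      exact Real.log_le_log (prod_pos hw0) (hzw j hj))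
  have h2 : (0:ℝ) ≤ ∑ i ∈ range k, (Real.log (1 + (w i)⁻¹) - Real.log (1 + (z i)⁻¹)) :=
    key.trans (sum_le_sum fun i hi => by
      have := log_one_add_inv_tangent (hz i (mem_range.1 hi)) (hw i (mem_range.1 hi))
      linarith)
  rw [sum_sub_distrib, ← Real.log_prod (fun i hi => (hpos hw i (mem_range.1 hi)).ne'),
    ← Real.log_prod (fun i hi => (hpos hz i (mem_range.1 hi)).ne'), sub_nonneg] at h2
  exact (Real.log_le_log_iff (prod_pos fun i hi => hpos hz i (mem_range.1 hi))
    (prod_pos fun i hi => hpos hw i (mem_range.1 hi))).1 h2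

theorem exists_prefix_prod_le {x : ℕ → ℕ} {k D : ℕ} (hD : 0 < D) (hx : ∀ i < k, 2 ≤ x i)
    (hmono : ∀ i j, i ≤ j → j < k → x i ≤ x j)
    (h : (D + 1) * ∏ i ∈ range k, (x i - 1) ≤ D * ∏ i ∈ range k, x i) :
    ∃ j, 1 ≤ j ∧ j ≤ k ∧ D * ∏ i ∈ range j, x i + 1 ≤ (D + 1) ^ 2 ^ j := by
  by_contra! hcon
  set a : ℝ := (D : ℝ) + 1 with ha
  have hD' : (0 : ℝ) < D := by exact_mod_cast hD
  have ha1 : 1 < a := by linarith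
  have hx' : ∀ i < k, (1 : ℝ) < x i := fun i hi => by exact_mod_cast hx i hi
  have hmaj := prod_one_sub_inv_le (x := fun i => (x i : ℝ)) (y := fun i => a ^ 2 ^ i + 1) (k := k)
    hx' (fun i _ => by have : 0 < a ^ 2 ^ i := by positivity
                       linarith)
    (fun i j hij hj => by exact_mod_cast hmono i j hij hj)
    (fun j hj => by
      rcases Nat.eq_zero_or_pos j with rfl | hj0
      · simp
      have h1 := prod_pow_two_pow_range a j
      have h2 : a ^ 2 ^ j < D * ∏ i ∈ range j, (x i : ℝ) + 1 := by
        rw [ha]; exact_mod_cast hcon j hj0 hj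
      refine le_of_mul_le_mul_right (a := (D : ℝ)) ?_ hD'
      have h3 : a - 1 = D := by rw [ha]; ring
      rw [h3] at h1
      linarith)
  have e1 : ∏ i ∈ range k, (1 - (a ^ 2 ^ i + 1)⁻¹)
      = (∏ i ∈ range k, a ^ 2 ^ i) / ∏ i ∈ range k, (a ^ 2 ^ i + 1) := by
    rw [← prod_div_distrib]
    refine prod_congr rfl fun i _ => ?_
    have : 0 < a ^ 2 ^ i := by positivity
    field_simp
    ring
  have e2 : ∏ i ∈ range k, (1 - ((x i : ℝ))⁻¹)
      = (∏ i ∈ range k, ((x i : ℝ) - 1)) / ∏ i ∈ range k, (x i : ℝ) := by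
    rw [← prod_div_distrib]
    refine prod_congr rfl fun i hi => ?_
    have := hx' i (mem_range.1 hi)
    have : (x i : ℝ) ≠ 0 := by positivity
    field_simp
  have hxpos : 0 < ∏ i ∈ range k, (x i : ℝ) := prod_pos fun i hi => by
    linarith [hx' i (mem_range.1 hi)]
  have hypos : 0 < ∏ i ∈ range k, (a ^ 2 ^ i + 1) := prod_pos fun i hi => by positivity
  have h' : a * ∏ i ∈ range k, ((x i : ℝ) - 1) ≤ D * ∏ i ∈ range k, (x i : ℝ) := by
    have h0 : ((D + 1 : ℕ) : ℝ) * ((∏ i ∈ range k, (x i - 1) : ℕ) : ℝ)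
      ≤ (D : ℝ) * ((∏ i ∈ range k, x i : ℕ) : ℝ) := by exact_mod_cast h
    have h1 : ((∏ i ∈ range k, (x i - 1) : ℕ) : ℝ) = ∏ i ∈ range k, ((x i : ℝ) - 1) := by
      rw [Nat.cast_prod]
      refine prod_congr rfl fun i hi => ?_
      rw [Nat.cast_sub (by have := hx i (mem_range.1 hi); omega)]; simp
    rw [h1] at h0
    push_cast at h0
    exact h0
  simp only [e1, e2] at hmaj
  rw [div_le_div_iff₀ hypos hxpos] at hmaj
  have p1 := prod_pow_two_pow_range a k
  have p2 := prod_pow_two_pow_range' a k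
  have h3 : a - 1 = D := by rw [ha]; ring
  rw [h3] at p1
  set P := ∏ i ∈ range k, (x i : ℝ)
  set Q := ∏ i ∈ range k, ((x i : ℝ) - 1)
  set Y := ∏ i ∈ range k, (a ^ 2 ^ i + 1)
  set Z := ∏ i ∈ range k, a ^ 2 ^ i
  have q1 : (Z * P) * a ≤ (Q * Y) * a := mul_le_mul_of_nonneg_right hmaj (by linarith)
  have q2 : (a * Q) * Y ≤ (D * P) * Y := mul_le_mul_of_nonneg_right h' hypos.le
  have q3 : P * (Z * a) ≤ P * (Y * D) := by linarith
  have := le_of_mul_le_mul_left q3 hxpos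
  linarith

theorem exists_prefix_prod_sub_one_lt {X : ℕ → ℕ} {k h : ℕ} (hh : 0 < h) (hX : ∀ i < k, 2 ≤ X i)
    (hmono : ∀ i j, i ≤ j → j < k → X i ≤ X j)
    (hle : h * ∏ i ∈ range k, (X i - 1) ≤ (h - 1) * ∏ i ∈ range k, X i) :
    ∃ j, 1 ≤ j ∧ j ≤ k ∧ h * ∏ i ∈ range j, (X i - 1) < h ^ 2 ^ j := by
  by_contra! hcon
  set a : ℝ := (h : ℝ) with ha
  have ha0 : 0 < a := by rw [ha]; exact_mod_cast hh
  have hz : ∀ i < k, (0 : ℝ) < (X i : ℝ) - 1 := fun i hi => by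
    have : (2 : ℝ) ≤ X i := by exact_mod_cast hX i hi
    linarith
  have hcast : ∀ j ≤ k, ((∏ i ∈ range j, (X i - 1) : ℕ) : ℝ) = ∏ i ∈ range j, ((X i : ℝ) - 1) := by
    intro j hj
    rw [Nat.cast_prod]
    refine prod_congr rfl fun i hi => ?_
    rw [Nat.cast_sub (by have := hX i (by have := mem_range.1 hi; omega); omega)]; simp
  have hmaj := prod_one_add_inv_le (z := fun i => (X i : ℝ) - 1) (w := fun i => a ^ 2 ^ i) (k := k)
    hz (fun i _ => by positivity)
    (fun i j hij hj => by
      have : (X i : ℝ) ≤ X j := by exact_mod_cast hmono i j hij hj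
      simpa using this)
    (fun j hj => by
      rcases Nat.eq_zero_or_pos j with rfl | hj0
      · simp
      have h1 := prod_pow_two_pow_range' a j
      have h2 : a ^ 2 ^ j ≤ a * ∏ i ∈ range j, ((X i : ℝ) - 1) := by
        rw [ha, ← hcast j hj]; exact_mod_cast hcon j hj0 hj
      refine le_of_mul_le_mul_right (a := a) ?_ ha0
      linarith)
  have e1 : ∏ i ∈ range k, (1 + (a ^ 2 ^ i)⁻¹)
      = (∏ i ∈ range k, (a ^ 2 ^ i + 1)) / ∏ i ∈ range k, a ^ 2 ^ i := by
    rw [← prod_div_distrib]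
    refine prod_congr rfl fun i _ => ?_
    field_simp
  have e2 : ∏ i ∈ range k, (1 + ((X i : ℝ) - 1)⁻¹)
      = (∏ i ∈ range k, (X i : ℝ)) / ∏ i ∈ range k, ((X i : ℝ) - 1) := by
    rw [← prod_div_distrib]
    refine prod_congr rfl fun i hi => ?_
    have := (hz i (mem_range.1 hi)).ne'
    field_simp
    ring
  have hQpos : 0 < ∏ i ∈ range k, ((X i : ℝ) - 1) := prod_pos fun i hi => hz i (mem_range.1 hi)
  have hZpos : 0 < ∏ i ∈ range k, a ^ 2 ^ i := prod_pos fun i hi => by positivity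
  have h' : a * ∏ i ∈ range k, ((X i : ℝ) - 1) ≤ (a - 1) * ∏ i ∈ range k, (X i : ℝ) := by
    have h0 : (h : ℝ) * ((∏ i ∈ range k, (X i - 1) : ℕ) : ℝ)
      ≤ ((h - 1 : ℕ) : ℝ) * ((∏ i ∈ range k, X i : ℕ) : ℝ) := by exact_mod_cast hle
    rw [hcast k le_rfl, Nat.cast_sub (by omega)] at h0
    push_cast at h0
    exact h0
  simp only [e1, e2] at hmaj
  rw [div_le_div_iff₀ hQpos hZpos] at hmaj
  have p1 := prod_pow_two_pow_range a k
  have p2 := prod_pow_two_pow_range' a k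
  have hP : 0 < ∏ i ∈ range k, (X i : ℝ) := prod_pos fun i hi => by
    linarith [hz i (mem_range.1 hi)]
  set P := ∏ i ∈ range k, (X i : ℝ)
  set Q := ∏ i ∈ range k, ((X i : ℝ) - 1)
  set Y := ∏ i ∈ range k, (a ^ 2 ^ i + 1)
  set Z := ∏ i ∈ range k, a ^ 2 ^ i
  have ha1 : 0 < a - 1 := by
    by_contra! hneg
    have := mul_pos ha0 hQpos
    nlinarith
  have q1 : (P * Z) * (a - 1) ≤ (Y * Q) * (a - 1) := mul_le_mul_of_nonneg_right hmaj ha1.le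
  have q2 : (a * Q) * Z ≤ ((a - 1) * P) * Z := mul_le_mul_of_nonneg_right h' hZpos.le
  have q3 : Q * (Z * a) ≤ Q * (Y * (a - 1)) := by linarith
  have := le_of_mul_le_mul_left q3 hQpos
  linarith


theorem mul_prod_add_one_le_pow {k : ℕ} : ∀ {D : ℕ} {x g : ℕ → ℕ}, 0 < D → (∀ i < k, 2 ≤ x i) →
    (∀ i j, i ≤ j → j < k → x i ≤ x j) → (∀ i < k, (x i - 1) * g i ≤ g (i + 1)) →
    (∀ j < k, D * ∏ i ∈ range j, x i < g j) → g k ≤ D * ∏ i ∈ range k, x i →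
    D * ∏ i ∈ range k, x i + 1 ≤ (D + 1) ^ 2 ^ k := by
  induction k using Nat.strong_induction_on with
  | _ k ih =>
    intro D x g hD hx hmono hg hlt hle
    rcases Nat.eq_zero_or_pos k with rfl | hk
    · simp
    have hgk : ∀ j ≤ k, (∏ i ∈ range j, (x i - 1)) * g 0 ≤ g j := by
      intro j
      induction j with
      | zero => simp
      | succ j ihj =>
        intro hj
        rw [prod_range_succ, mul_comm _ (x j - 1), mul_assoc]
        exact (Nat.mul_le_mul_left _ (ihj (by omega))).trans (hg j (by omega))
    have h0 : D + 1 ≤ g 0 := by simpa using hlt 0 hk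
    obtain ⟨j, hj1, hjk, hj⟩ := exists_prefix_prod_le (k := k) hD hx hmono (by
      calc (D + 1) * ∏ i ∈ range k, (x i - 1) ≤ (∏ i ∈ range k, (x i - 1)) * g 0 := by
            rw [mul_comm]; exact Nat.mul_le_mul_left _ h0
        _ ≤ _ := (hgk k le_rfl).trans hle)
    obtain ⟨m, rfl⟩ := Nat.exists_eq_add_of_le hjk
    have hpos : 0 < ∏ i ∈ range j, x i := prod_pos fun i hi => by
      have := hx i (by have := mem_range.1 hi; omega)
      omega
    have := ih m (by omega) (D := D * ∏ i ∈ range j, x i) (x := fun i => x (j + i))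
      (g := fun i => g (j + i)) (by positivity) (fun i hi => hx _ (by omega))
      (fun i i' h h' => hmono _ _ (by omega) (by omega)) (fun i hi => hg (j + i) (by omega))
      (fun i hi => by rw [mul_assoc, ← prod_range_add]; exact hlt _ (by omega))
      (by rw [mul_assoc, ← prod_range_add]; exact hle)
    rw [mul_assoc, ← prod_range_add] at this
    refine this.trans ?_
    rw [pow_add 2 j, pow_mul]
    exact Nat.pow_le_pow_left hj _

theorem mul_prod_sub_one_lt_pow {k : ℕ} (hk : 0 < k) : ∀ {h : ℕ} {X c : ℕ → ℕ},
    (∀ i < k, 2 ≤ X i) → (∀ i j, i ≤ j → j < k → X i ≤ X j) →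
    (∀ i < k, c (i + 1) ≤ X i * c i) → (∀ j < k, c j < h * ∏ i ∈ range j, (X i - 1)) →
    h * ∏ i ∈ range k, (X i - 1) ≤ c k →
    h * ∏ i ∈ range k, (X i - 1) < h ^ 2 ^ k := by
  induction k using Nat.strong_induction_on with
  | _ k ih =>
    intro h X c hX hmono hc hlt hle
    have hck : ∀ j ≤ k, c j ≤ (∏ i ∈ range j, X i) * c 0 := by
      intro j
      induction j with
      | zero => simp
      | succ j ihj =>
        intro hj
        rw [prod_range_succ, mul_comm _ (X j), mul_assoc]
        exact (hc j (by omega)).trans (Nat.mul_le_mul_left _ (ihj (by omega)))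
    have h0 : c 0 < h := by simpa using hlt 0 hk
    obtain ⟨j, hj1, hjk, hj⟩ := exists_prefix_prod_sub_one_lt (k := k) (h := h) (by omega) hX hmono (by
      refine (hle.trans (hck k le_rfl)).trans ?_
      rw [mul_comm]
      exact Nat.mul_le_mul_right _ (by omega))
    obtain ⟨m, rfl⟩ := Nat.exists_eq_add_of_le hjk
    rcases Nat.eq_zero_or_pos m with rfl | hm
    · exact hj
    have := ih m (by omega) hm (h := h * ∏ i ∈ range j, (X i - 1)) (X := fun i => X (j + i))
      (c := fun i => c (j + i)) (fun i hi => hX _ (by omega))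
      (fun i i' h h' => hmono _ _ (by omega) (by omega)) (fun i hi => hc (j + i) (by omega))
      (fun i hi => by
        rw [mul_assoc, ← prod_range_add (fun i => X i - 1)]; exact hlt _ (by omega))
      (by rw [mul_assoc, ← prod_range_add (fun i => X i - 1)]; exact hle)
    rw [mul_assoc, ← prod_range_add (fun i => X i - 1)] at this
    refine this.trans_le ?_
    rw [pow_add 2 j, pow_mul]
    exact Nat.pow_le_pow_left hj.le _

theorem exists_monotone_enumeration (f : ℕ → ℕ) (U : Finset ℕ) :
    ∃ e : ℕ → ℕ, Set.InjOn e (range #U) ∧ (range #U).image e = U ∧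
      ∀ i j, i ≤ j → j < #U → f (e i) ≤ f (e j) := by
  induction U using Finset.induction_on_max_value f with
  | empty => exact ⟨id, by simp, by simp, by simp⟩
  | insert a s ha hmax ih =>
    obtain ⟨e, hinj, himg, hmono⟩ := ih
    have hmem : ∀ i < #s, e i ∈ s := fun i hi => by
      rw [← himg]; exact mem_image_of_mem _ (mem_range.2 hi)
    have hup : ∀ i < #s, Function.update e #s a i = e i := fun i hi =>
      Function.update_of_ne hi.ne _ _
    refine ⟨Function.update e #s a, ?_, ?_, ?_⟩
    · rw [card_insert_of_notMem ha]
      intro i hi j hj hij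
      simp only [coe_range, Set.mem_Iio] at hi hj
      rcases Nat.lt_succ_iff_lt_or_eq.1 hi with hi | rfl <;>
        rcases Nat.lt_succ_iff_lt_or_eq.1 hj with hj | rfl
      · rw [hup i hi, hup j hj] at hij
        exact hinj (by simpa using hi) (by simpa using hj) hij
      · rw [hup i hi, Function.update_self] at hij
        exact absurd (hij ▸ hmem i hi) ha
      · rw [hup j hj, Function.update_self] at hij
        exact absurd (hij ▸ hmem j hj) ha
      · rfl
    · have himg' : (range #s).image (Function.update e #s a) = s :=
        (image_congr fun i hi => hup i (mem_range.1 (mem_coe.1 hi))).trans himg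
      rw [card_insert_of_notMem ha, range_add_one, image_insert, Function.update_self, himg']
    · intro i j hij hj
      rw [card_insert_of_notMem ha] at hj
      rcases Nat.lt_succ_iff_lt_or_eq.1 hj with hj | rfl
      · rw [hup i (by omega), hup j hj]
        exact hmono i j hij hj
      · rw [Function.update_self]
        rcases hij.lt_or_eq with hi | rfl
        · rw [hup i hi]
          exact hmax _ (hmem i hi)
        · rw [Function.update_self]

theorem exists_subset_prod_le {U : Finset ℕ} {D : ℕ} {x : ℕ → ℕ} {G : Finset ℕ → ℕ} (hD : 0 < D)
    (hx : ∀ p ∈ U, 2 ≤ x p)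
    (hG : ∀ S ⊆ U, ∀ p ∈ U, p ∉ S → (x p - 1) * G S ≤ G (insert p S))
    (hU : G U ≤ D * ∏ p ∈ U, x p) :
    ∃ S ⊆ U, G S ≤ D * ∏ p ∈ S, x p ∧ D * ∏ p ∈ S, x p + 1 ≤ (D + 1) ^ 2 ^ #S := by
  obtain ⟨e, hinj, himg, hmono⟩ := exists_monotone_enumeration x U
  have hmem : ∀ i < #U, e i ∈ U := fun i hi => by
    have := mem_image_of_mem e (mem_range.2 hi)
    rwa [himg] at this
  have hinj' : ∀ j ≤ #U, Set.InjOn e (range j) := fun j hj =>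
    hinj.mono (by exact_mod_cast range_subset_range.2 hj)
  have hprod : ∀ j ≤ #U, ∏ p ∈ (range j).image e, x p = ∏ i ∈ range j, x (e i) := fun j hj =>
    prod_image (hinj' j hj)
  have hsub : ∀ j ≤ #U, (range j).image e ⊆ U := fun j hj => by
    conv_rhs => rw [← himg]
    exact image_subset_image (range_subset_range.2 hj)
  have hex : ∃ j, j ≤ #U ∧ G ((range j).image e) ≤ D * ∏ p ∈ (range j).image e, x p :=
    ⟨#U, le_rfl, by rwa [himg]⟩
  classical
  obtain ⟨hk, hkle⟩ := Nat.find_spec hex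
  have hmin := fun j (hj : j < Nat.find hex) => Nat.find_min hex hj
  set k := Nat.find hex
  refine ⟨(range k).image e, hsub k hk, hkle, ?_⟩
  rw [hprod k hk, card_image_of_injOn (hinj' k hk), card_range]
  refine mul_prod_add_one_le_pow (g := fun j => G ((range j).image e)) hD
    (fun i hi => hx _ (hmem i (by omega))) (fun i j hij hj => hmono i j hij (by omega))
    (fun i hi => ?_) (fun j hj => ?_) (by rwa [← hprod k hk])
  · rw [range_add_one, image_insert]
    refine hG _ (hsub i (by omega)) _ (hmem i (by omega)) fun hcon => ?_
    obtain ⟨j, hj, hji⟩ := mem_image.1 hcon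
    have hj := mem_range.1 hj
    have := hinj (by simp; omega) (by simp; omega) hji
    omega
  · have := hmin j hj
    push Not at this
    rw [← hprod j (by omega)]
    exact this (by omega)

theorem exists_subset_prod_sub_one_lt {U : Finset ℕ} {h : ℕ} {X : ℕ → ℕ} {c : Finset ℕ → ℕ}
    (hX : ∀ p ∈ U, 2 ≤ X p) (h0 : c ∅ < h)
    (hc : ∀ V ⊆ U, ∀ p ∈ U, p ∉ V → c (insert p V) ≤ X p * c V)
    (hU : h * ∏ p ∈ U, (X p - 1) ≤ c U) :
    ∃ V ⊆ U, V.Nonempty ∧ h * ∏ p ∈ V, (X p - 1) ≤ c V ∧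
      h * ∏ p ∈ V, (X p - 1) < h ^ 2 ^ #V := by
  obtain ⟨e, hinj, himg, hmono⟩ := exists_monotone_enumeration X U
  have hmem : ∀ i < #U, e i ∈ U := fun i hi => by
    have := mem_image_of_mem e (mem_range.2 hi)
    rwa [himg] at this
  have hinj' : ∀ j ≤ #U, Set.InjOn e (range j) := fun j hj =>
    hinj.mono (by exact_mod_cast range_subset_range.2 hj)
  have hprod : ∀ j ≤ #U, ∏ p ∈ (range j).image e, (X p - 1) = ∏ i ∈ range j, (X (e i) - 1) :=
    fun j hj => prod_image (hinj' j hj)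
  have hsub : ∀ j ≤ #U, (range j).image e ⊆ U := fun j hj => by
    conv_rhs => rw [← himg]
    exact image_subset_image (range_subset_range.2 hj)
  have hex : ∃ j, j ≤ #U ∧ h * ∏ p ∈ (range j).image e, (X p - 1) ≤ c ((range j).image e) :=
    ⟨#U, le_rfl, by rwa [himg]⟩
  classical
  obtain ⟨hk, hkle⟩ := Nat.find_spec hex
  have hmin := fun j (hj : j < Nat.find hex) => Nat.find_min hex hj
  set k := Nat.find hex
  have hk0 : 0 < k := by
    by_contra! hk0
    rw [Nat.le_zero.1 hk0] at hkle
    simp at hkle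
    omega
  refine ⟨(range k).image e, hsub k hk, (nonempty_range_iff.2 hk0.ne').image e, hkle, ?_⟩
  rw [hprod k hk, card_image_of_injOn (hinj' k hk), card_range]
  refine mul_prod_sub_one_lt_pow hk0 (X := fun i => X (e i)) (c := fun j => c ((range j).image e))
    (fun i hi => hX _ (hmem i (by omega))) (fun i j hij hj => hmono i j hij (by omega))
    (fun i hi => ?_) (fun j hj => ?_) (by rwa [← hprod k hk])
  · rw [range_add_one, image_insert]
    refine hc _ (hsub i (by omega)) _ (hmem i (by omega)) fun hcon => ?_
    obtain ⟨j, hj, hji⟩ := mem_image.1 hcon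
    have hj := mem_range.1 hj
    have := hinj (by simp; omega) (by simp; omega) hji
    omega
  · have := hmin j hj
    push Not at this
    rw [← hprod j (by omega)]
    exact this (by omega)


/-- The sum of the divisors of `p ^ e p`, for `p` prime. -/
def geomFactor (e : ℕ → ℕ) (p : ℕ) : ℕ := ∑ i ∈ range (e p + 1), p ^ i

/-- The common denominator `∏_{p ∈ R} σ(p ^ e p) * ∏_{p ∈ W} p`. -/
def ratioDenom (e : ℕ → ℕ) (R W : Finset ℕ) : ℕ := (∏ p ∈ R, geomFactor e p) * ∏ p ∈ W, p

/-- The numerator over `ratioDenom e R W` of the product of `p ^ e p / σ(p ^ e p)` over `p ∈ R`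
and of `(p - 1) / p` over `p ∈ W`, both restricted to the `p` on the side selected by `c`. -/
def ratioNum (e : ℕ → ℕ) (c : ℕ → Bool) (R W : Finset ℕ) : ℕ :=
  (∏ p ∈ R, if c p then p ^ e p else geomFactor e p) * ∏ p ∈ W, if c p then p - 1 else p

/-- The sum of the numerators of the two sides. -/
def ratioSum (e : ℕ → ℕ) (c : ℕ → Bool) (R W : Finset ℕ) : ℕ :=
  ratioNum e c R W + ratioNum e (fun p => !c p) R W

theorem geomFactor_mul_sub_one (e : ℕ → ℕ) {p : ℕ} (hp : 1 ≤ p) :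
    geomFactor e p * (p - 1) = p ^ (e p + 1) - 1 :=
  geom_sum_mul_of_one_le hp _

theorem geomFactor_pos (e : ℕ → ℕ) (p : ℕ) : 0 < geomFactor e p := by
  rw [geomFactor, sum_range_succ']
  simp

theorem pow_le_geomFactor (e : ℕ → ℕ) (p : ℕ) : p ^ e p ≤ geomFactor e p := by
  rw [geomFactor, sum_range_succ]
  omega

theorem pow_lt_geomFactor {e : ℕ → ℕ} {p : ℕ} (he : 1 ≤ e p) : p ^ e p < geomFactor e p := by
  rw [geomFactor, sum_range_succ]
  obtain ⟨m, hm⟩ := Nat.exists_eq_add_of_le' he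
  rw [hm, sum_range_succ']
  simp

section

variable {e : ℕ → ℕ} {c : ℕ → Bool} {R V W S P : Finset ℕ}

theorem ratioNum_sdiff (hRV : Disjoint R V) (hVW : V ⊆ W) (hW : ∀ p ∈ W, 2 ≤ p) :
    ratioNum e c (R ∪ V) (W \ V) * ∏ p ∈ V, p * (p - 1) =
      ratioNum e c R W *
        ∏ p ∈ V, if c p then p ^ (e p + 1) else p ^ (e p + 1) - 1 := by
  have h : (∏ p ∈ V, if c p then p ^ e p else geomFactor e p) * ∏ p ∈ V, p * (p - 1) =
      (∏ p ∈ V, if c p then p - 1 else p) *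
        ∏ p ∈ V, if c p then p ^ (e p + 1) else p ^ (e p + 1) - 1 := by
    rw [← prod_mul_distrib, ← prod_mul_distrib]
    refine prod_congr rfl fun p hp => ?_
    have := hW p (hVW hp)
    rw [← geomFactor_mul_sub_one e (by omega)]
    split_ifs <;> ring
  rw [ratioNum, ratioNum, prod_union hRV, ← prod_sdiff hVW]
  linear_combination
    (∏ p ∈ R, if c p then p ^ e p else geomFactor e p) * (∏ p ∈ W \ V, if c p then p - 1 else p) * h

theorem ratioDenom_sdiff (hRV : Disjoint R V) (hVW : V ⊆ W) (hW : ∀ p ∈ W, 2 ≤ p) :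
    ratioDenom e (R ∪ V) (W \ V) * ∏ p ∈ V, p * (p - 1) =
      ratioDenom e R W * ∏ p ∈ V, (p ^ (e p + 1) - 1) := by
  have h : (∏ p ∈ V, geomFactor e p) * ∏ p ∈ V, p * (p - 1) =
      (∏ p ∈ V, p) * ∏ p ∈ V, (p ^ (e p + 1) - 1) := by
    rw [← prod_mul_distrib, ← prod_mul_distrib]
    refine prod_congr rfl fun p hp => ?_
    have := hW p (hVW hp)
    rw [← geomFactor_mul_sub_one e (by omega)]
    ring
  rw [ratioDenom, ratioDenom, prod_union hRV, ← prod_sdiff hVW]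
  linear_combination (∏ p ∈ R, geomFactor e p) * (∏ p ∈ W \ V, p) * h

theorem ratioNum_insert_ge (p : ℕ) (hp : p ∉ W) :
    (p - 1) * ratioNum e c R W ≤ ratioNum e c R (insert p W) := by
  rw [ratioNum, ratioNum, prod_insert hp, mul_left_comm]
  refine Nat.mul_le_mul_left _ (Nat.mul_le_mul_right _ ?_)
  split_ifs <;> omega

theorem ratioNum_union_le (hRV : Disjoint R V) :
    ratioNum e c (R ∪ V) ∅ ≤ ratioNum e c R ∅ * ∏ p ∈ V, geomFactor e p := by
  simp only [ratioNum, prod_union hRV, prod_empty, mul_one]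
  refine Nat.mul_le_mul_left _ (prod_le_prod' fun p _ => ?_)
  split_ifs
  · exact pow_le_geomFactor e p
  · exact le_rfl

theorem ratioNum_pos (hR : ∀ p ∈ R, 2 ≤ p) (hW : ∀ p ∈ W, 2 ≤ p) : 0 < ratioNum e c R W := by
  refine mul_pos (prod_pos fun p hp => ?_) (prod_pos fun p hp => ?_)
  · have := hR p hp
    split_ifs
    · positivity
    · exact geomFactor_pos e p
  · have := hW p hp
    split_ifs <;> omega

theorem ratioNum_union_lt (hRV : Disjoint R V) (hR : ∀ p ∈ R, 2 ≤ p) {q : ℕ} (hq : q ∈ V)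
    (hcq : c q = true) (he : 1 ≤ e q) :
    ratioNum e c (R ∪ V) ∅ < ratioNum e c R ∅ * ∏ p ∈ V, geomFactor e p := by
  have hpos : 0 < ∏ p ∈ V.erase q, geomFactor e p := prod_pos fun p _ => geomFactor_pos e p
  have hle : (∏ p ∈ V.erase q, if c p then p ^ e p else geomFactor e p) ≤
      ∏ p ∈ V.erase q, geomFactor e p := by
    refine prod_le_prod' fun p _ => ?_
    split_ifs
    · exact pow_le_geomFactor e p
    · exact le_rfl
  have hRpos : 0 < ratioNum e c R ∅ := ratioNum_pos hR (by simp)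
  simp only [ratioNum, prod_union hRV, prod_empty, mul_one] at hRpos ⊢
  refine Nat.mul_lt_mul_of_pos_left ?_ hRpos
  rw [← mul_prod_erase _ _ hq, ← mul_prod_erase _ _ hq, if_pos hcq]
  exact (Nat.mul_le_mul_left _ hle).trans_lt (Nat.mul_lt_mul_of_pos_right (pow_lt_geomFactor he) hpos)

theorem ratioDenom_pos (hW : ∀ p ∈ W, 2 ≤ p) : 0 < ratioDenom e R W :=
  mul_pos (prod_pos fun p _ => geomFactor_pos e p) (prod_pos fun p hp => by
    have := hW p hp
    omega)

theorem ratioDenom_union (hRV : Disjoint R V) :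
    ratioDenom e (R ∪ V) ∅ = ratioDenom e R ∅ * ∏ p ∈ V, geomFactor e p := by
  simp [ratioDenom, prod_union hRV]

theorem ratioDenom_union_right (hWS : Disjoint W S) :
    ratioDenom e R (W ∪ S) = ratioDenom e R W * ∏ p ∈ S, p := by
  rw [ratioDenom, ratioDenom, prod_union hWS, mul_assoc]

theorem ratioDenom_le_ratioSum (hRP : R ⊆ P)
    (hP : ratioSum e c P ∅ = ratioDenom e P ∅) : ratioDenom e R ∅ ≤ ratioSum e c R ∅ := by
  have hdis : Disjoint R (P \ R) := disjoint_sdiff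
  have hpos : 0 < ∏ p ∈ P \ R, geomFactor e p := prod_pos fun p _ => geomFactor_pos e p
  refine Nat.le_of_mul_le_mul_right ?_ hpos
  rw [← ratioDenom_union hdis, union_sdiff_of_subset hRP, ← hP, ratioSum, ratioSum, add_mul]
  conv_lhs => rw [← union_sdiff_of_subset hRP]
  exact add_le_add (ratioNum_union_le hdis) (ratioNum_union_le hdis)

theorem ratioDenom_lt_ratioSum (hRP : R ⊂ P) (h2 : ∀ p ∈ P, 2 ≤ p) (he : ∀ p ∈ P, 1 ≤ e p)
    (hP : ratioSum e c P ∅ = ratioDenom e P ∅) : ratioDenom e R ∅ < ratioSum e c R ∅ := by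
  have hdis : Disjoint R (P \ R) := disjoint_sdiff
  obtain ⟨q, hqP, hqR⟩ := exists_of_ssubset hRP
  have hq : q ∈ P \ R := mem_sdiff.2 ⟨hqP, hqR⟩
  have hR2 : ∀ p ∈ R, 2 ≤ p := fun p hp => h2 p (hRP.1 hp)
  refine Nat.lt_of_mul_lt_mul_right (a := ∏ p ∈ P \ R, geomFactor e p) ?_
  rw [← ratioDenom_union hdis, union_sdiff_of_subset hRP.1, ← hP, ratioSum, ratioSum, add_mul]
  conv_lhs => rw [← union_sdiff_of_subset hRP.1]
  cases hcq : c q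
  · exact add_lt_add_of_le_of_lt (ratioNum_union_le hdis)
      (ratioNum_union_lt hdis hR2 hq (by simp [hcq]) (he q hqP))
  · exact add_lt_add_of_lt_of_le (ratioNum_union_lt hdis hR2 hq hcq (he q hqP))
      (ratioNum_union_le hdis)

theorem pow_succ_sub_one_pos {p k : ℕ} (hp : 2 ≤ p) : 0 < p ^ (k + 1) - 1 := by
  have : 1 < p ^ (k + 1) := Nat.one_lt_pow (by omega) hp
  omega

theorem ratioSum_sdiff_le_ratioDenom (hRP : R ⊆ P) (h2 : ∀ p ∈ P, 2 ≤ p)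
    (hP : ratioSum e c P ∅ = ratioDenom e P ∅) :
    ratioSum e c R (P \ R) ≤ ratioDenom e R (P \ R) := by
  have hdis : Disjoint R (P \ R) := disjoint_sdiff
  have h2' : ∀ p ∈ P \ R, 2 ≤ p := fun p hp => h2 p (mem_sdiff.1 hp).1
  have hge : ∀ c : ℕ → Bool, ∏ p ∈ P \ R, (p ^ (e p + 1) - 1) ≤
      ∏ p ∈ P \ R, if c p then p ^ (e p + 1) else p ^ (e p + 1) - 1 := fun c =>
    prod_le_prod' fun p _ => by split_ifs <;> omega
  have hpos : 0 < ∏ p ∈ P \ R, (p ^ (e p + 1) - 1) :=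
    prod_pos fun p hp => pow_succ_sub_one_pos (h2' p hp)
  refine Nat.le_of_mul_le_mul_right ?_ hpos
  rw [← ratioDenom_sdiff hdis subset_rfl h2', union_sdiff_of_subset hRP, sdiff_self, bot_eq_empty,
    ← hP, ratioSum, ratioSum, add_mul, add_mul]
  have key : ∀ c : ℕ → Bool, ratioNum e c R (P \ R) * ∏ p ∈ P \ R, (p ^ (e p + 1) - 1) ≤
      ratioNum e c P ∅ * ∏ p ∈ P \ R, p * (p - 1) := fun c => by
    have := ratioNum_sdiff (e := e) (c := c) hdis subset_rfl h2'
    rw [union_sdiff_of_subset hRP, sdiff_self, bot_eq_empty] at this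
    rw [this]
    exact Nat.mul_le_mul_left _ (hge c)
  exact add_le_add (key _) (key _)

theorem ratioSum_insert_ge (p : ℕ) (hp : p ∉ W) :
    (p - 1) * ratioSum e c R W ≤ ratioSum e c R (insert p W) := by
  rw [ratioSum, ratioSum, mul_add]
  exact add_le_add (ratioNum_insert_ge p hp) (ratioNum_insert_ge p hp)

/-- Starting from a ratio larger than one, adjoin a controlled set of unseen primes to push it to
at most one. -/
theorem exists_adjoin_primes (hRP : R ⊆ P) (hWP : W ⊆ P \ R) (h2 : ∀ p ∈ P, 2 ≤ p)
    (hP : ratioSum e c P ∅ = ratioDenom e P ∅) :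
    ∃ S ⊆ P \ (R ∪ W), ratioSum e c R (W ∪ S) ≤ ratioDenom e R (W ∪ S) ∧
      ratioDenom e R (W ∪ S) + 1 ≤ (ratioDenom e R W + 1) ^ 2 ^ #S := by
  have hWP' : W ⊆ P := hWP.trans sdiff_subset
  have hdis : ∀ S ⊆ P \ (R ∪ W), Disjoint W S := fun S hS =>
    disjoint_left.2 fun p hpW hpS => (mem_sdiff.1 (hS hpS)).2 (mem_union_right _ hpW)
  have hU : W ∪ P \ (R ∪ W) = P \ R := by
    ext p
    have := @hWP p
    simp only [mem_union, mem_sdiff] at this ⊢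
    tauto
  obtain ⟨S, hS, h1, h3⟩ := exists_subset_prod_le (U := P \ (R ∪ W)) (D := ratioDenom e R W)
    (x := fun p => p) (G := fun S => ratioSum e c R (W ∪ S))
    (ratioDenom_pos fun p hp => h2 p (hWP' hp))
    (fun p hp => h2 p (mem_sdiff.1 hp).1)
    (fun S hS p hp hpS => by
      simp only [union_insert]
      refine ratioSum_insert_ge p fun hcon => ?_
      rcases mem_union.1 hcon with hcon | hcon
      · exact (mem_sdiff.1 hp).2 (mem_union_right _ hcon)
      · exact hpS hcon)
    (by
      rw [← ratioDenom_union_right (hdis _ subset_rfl), hU]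
      exact ratioSum_sdiff_le_ratioDenom hRP h2 hP)
  rw [← ratioDenom_union_right (hdis _ hS)] at h1 h3
  exact ⟨S, hS, h1, h3⟩

/-- Starting from a ratio less than one, replace a controlled nonempty set of primes by their full
prime powers to bring it back to at least one. -/
theorem exists_resolve_primes (hRP : R ⊆ P) (hWP : W ⊆ P \ R) (h2 : ∀ p ∈ P, 2 ≤ p)
    (hP : ratioSum e c P ∅ = ratioDenom e P ∅) (hlt : ratioSum e c R W < ratioDenom e R W) :
    ∃ V ⊆ W, V.Nonempty ∧ ratioDenom e (R ∪ V) (W \ V) ≤ ratioSum e c (R ∪ V) (W \ V) ∧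
      ratioDenom e R W * ∏ p ∈ V, (p ^ (e p + 1) - 1) < ratioDenom e R W ^ 2 ^ #V := by
  have h2W : ∀ p ∈ W, 2 ≤ p := fun p hp => h2 p (mem_sdiff.1 (hWP hp)).1
  have hdisW : Disjoint R W := disjoint_left.2 fun p hR hW => (mem_sdiff.1 (hWP hW)).2 hR
  have hequiv : ∀ V ⊆ W, (ratioDenom e R W * ∏ p ∈ V, (p ^ (e p + 1) - 1) ≤
      ratioNum e c R W * (∏ p ∈ V, if c p then p ^ (e p + 1) else p ^ (e p + 1) - 1) +
      ratioNum e (fun p => !c p) R W *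
        (∏ p ∈ V, if !c p then p ^ (e p + 1) else p ^ (e p + 1) - 1) ↔
      ratioDenom e (R ∪ V) (W \ V) ≤ ratioSum e c (R ∪ V) (W \ V)) := fun V hV => by
    have hdis : Disjoint R V := hdisW.mono_right hV
    have hpos : 0 < ∏ p ∈ V, p * (p - 1) := prod_pos fun p hp => by
      have := h2W p (hV hp)
      exact mul_pos (by omega) (by omega)
    rw [← ratioDenom_sdiff hdis hV h2W, ← ratioNum_sdiff hdis hV h2W,
      ← ratioNum_sdiff hdis hV h2W, ← add_mul]
    exact Nat.mul_le_mul_right_iff hpos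
  have hins : ∀ (c : ℕ → Bool) (V : Finset ℕ) (p : ℕ), p ∉ V →
      (∏ p ∈ insert p V, if c p then p ^ (e p + 1) else p ^ (e p + 1) - 1) ≤
      p ^ (e p + 1) * ∏ p ∈ V, if c p then p ^ (e p + 1) else p ^ (e p + 1) - 1 :=
    fun c V p hp => by
      rw [prod_insert hp]
      refine Nat.mul_le_mul_right _ ?_
      split_ifs <;> omega
  obtain ⟨V, hV, hne, h1, h3⟩ := exists_subset_prod_sub_one_lt (U := W) (h := ratioDenom e R W)
    (X := fun p => p ^ (e p + 1)) (c := fun V =>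
      ratioNum e c R W * (∏ p ∈ V, if c p then p ^ (e p + 1) else p ^ (e p + 1) - 1) +
      ratioNum e (fun p => !c p) R W *
        (∏ p ∈ V, if !c p then p ^ (e p + 1) else p ^ (e p + 1) - 1))
    (fun p hp => by
      have := pow_succ_sub_one_pos (k := e p) (h2W p hp)
      omega)
    (by simpa [ratioSum] using hlt)
    (fun V _ p _ hpV => by
      rw [mul_add, mul_left_comm _ (ratioNum e c R W), mul_left_comm _ (ratioNum e _ R W)]
      exact add_le_add (Nat.mul_le_mul_left _ (hins c V p hpV))
        (Nat.mul_le_mul_left _ (hins (fun p => !c p) V p hpV)))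
    ((hequiv W subset_rfl).2 (by
      rw [sdiff_self, bot_eq_empty]
      exact ratioDenom_le_ratioSum (union_subset hRP (hWP.trans sdiff_subset)) hP))
  exact ⟨V, hV, hne, (hequiv V hV).1 h1, h3⟩

end


theorem two_pow_exponent_le {s₁ s₂ v₁ v₂ : ℕ} (h : 1 ≤ v₂) :
    2 ^ s₁ * (2 * (2 ^ v₁ - 1) + 2 ^ v₁ * (2 ^ (s₂ + v₂) - 2 * 2 ^ s₂)) ≤
      2 ^ (s₁ + s₂ + (v₁ + v₂)) - 2 * 2 ^ (s₁ + s₂) := by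
  obtain ⟨m, rfl⟩ := Nat.exists_eq_add_of_le' h
  have e1 : 2 ^ (s₂ + (m + 1)) - 2 * 2 ^ s₂ = 2 * 2 ^ s₂ * (2 ^ m - 1) := by
    rw [Nat.mul_sub, pow_add, pow_succ]; congr 1 <;> ring
  rw [e1]
  refine Nat.le_sub_of_add_le ?_
  obtain ⟨b, hb⟩ := Nat.exists_eq_add_of_le' (Nat.one_le_two_pow (n := s₂))
  obtain ⟨u, hu⟩ := Nat.exists_eq_add_of_le' (Nat.one_le_two_pow (n := v₁))
  obtain ⟨w, hw⟩ := Nat.exists_eq_add_of_le' (Nat.one_le_two_pow (n := m))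
  simp only [pow_add, pow_one, hb, hu, hw, Nat.add_sub_cancel]
  nlinarith [Nat.zero_le (2 ^ s₁ * (u * b))]

theorem final_step_bound {D D' Q pX pR r πR πV πW πS πP s v : ℕ} (hv : 1 ≤ v)
    (hD' : D' = D * πS) (hVS : πW * πS = πV) (hr : D' = r * πV) (hpX : pX = pR * Q)
    (hpR : pR ≤ r * πR) (hπP : πP = πR * πV) (hπR : 0 < πR) (hπV : 0 < πV)
    (hle : D' + 1 ≤ (D + 1) ^ 2 ^ s) (hQ : D' * Q < D' ^ 2 ^ v) :
    pX * πW ^ 2 < πP * D ^ 2 * (D + 1) ^ (2 ^ (s + v) - 2 * 2 ^ s) := by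
  have hE : D' ^ 2 ^ v ≤ D' ^ 2 * (D + 1) ^ (2 ^ (s + v) - 2 * 2 ^ s) := by
    have h2 : 2 ≤ 2 ^ v := by simpa using Nat.pow_le_pow_right (n := 2) (by norm_num) hv
    have e1 : 2 ^ (s + v) - 2 * 2 ^ s = 2 ^ s * (2 ^ v - 2) := by
      rw [Nat.mul_sub, pow_add, mul_comm 2]
    rw [e1, pow_mul]
    calc D' ^ 2 ^ v = D' ^ 2 * D' ^ (2 ^ v - 2) := by rw [← pow_add]; congr 1; omega
      _ ≤ _ := Nat.mul_le_mul_left _ (Nat.pow_le_pow_left (by omega) _)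
  have h1 := hQ.trans_le hE
  set B := (D + 1) ^ (2 ^ (s + v) - 2 * 2 ^ s)
  refine Nat.lt_of_mul_lt_mul_right (a := πV * πS ^ 2) ?_
  calc pX * πW ^ 2 * (πV * πS ^ 2) = pR * (Q * πV * (πW * πS) ^ 2) := by rw [hpX]; ring
    _ ≤ r * πR * (Q * πV * (πW * πS) ^ 2) := Nat.mul_le_mul_right _ hpR
    _ = πR * πV ^ 2 * (D' * Q) := by rw [hVS, hr]; ring
    _ < πR * πV ^ 2 * (D' ^ 2 * B) := Nat.mul_lt_mul_of_pos_left h1 (by positivity)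
    _ = πP * D ^ 2 * B * (πV * πS ^ 2) := by rw [hD', hπP]; ring

theorem intermediate_step_bound {D D' D₂ Q pX φV πV πW πW₂ πS πP s₁ s₂ v₁ v₂ : ℕ} (hv : 1 ≤ v₂)
    (hD' : D' = D * πS) (hVS : πW₂ * πV = πW * πS) (hD₂ : D₂ * (πV * φV) = D' * Q)
    (hφ : 0 < φV) (hπV : 0 < πV) (hD0 : 0 < D')
    (hle : D' + 1 ≤ (D + 1) ^ 2 ^ s₁) (hQ : D' * Q < D' ^ 2 ^ v₁)
    (ih : pX * πW₂ ^ 2 < πP * D₂ ^ 2 * (D₂ + 1) ^ (2 ^ (s₂ + v₂) - 2 * 2 ^ s₂)) :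
    pX * πW ^ 2 < πP * D ^ 2 *
      (D + 1) ^ (2 ^ (s₁ + s₂ + (v₁ + v₂)) - 2 * 2 ^ (s₁ + s₂)) := by
  have hD₂V : D₂ * πV ≤ D' * Q := by
    rw [← hD₂, ← mul_assoc]; exact Nat.le_mul_of_pos_right _ hφ
  have hD₂le : D₂ + 1 ≤ D' ^ 2 ^ v₁ :=
    lt_of_le_of_lt ((Nat.le_mul_of_pos_right _ hπV).trans hD₂V) hQ
  have hQle : Q ≤ D' ^ (2 ^ v₁ - 1) := by
    refine (Nat.lt_of_mul_lt_mul_left (a := D') ?_).le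
    rw [← pow_succ', Nat.sub_add_cancel Nat.one_le_two_pow]
    exact hQ
  set E₂ := 2 ^ (s₂ + v₂) - 2 * 2 ^ s₂ with hE₂
  have hE : Q ^ 2 * (D₂ + 1) ^ E₂ ≤
      (D + 1) ^ (2 ^ (s₁ + s₂ + (v₁ + v₂)) - 2 * 2 ^ (s₁ + s₂)) := by
    calc Q ^ 2 * (D₂ + 1) ^ E₂ ≤ (D' ^ (2 ^ v₁ - 1)) ^ 2 * (D' ^ 2 ^ v₁) ^ E₂ :=
          Nat.mul_le_mul (Nat.pow_le_pow_left hQle _) (Nat.pow_le_pow_left hD₂le _)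
      _ = D' ^ (2 * (2 ^ v₁ - 1) + 2 ^ v₁ * E₂) := by
          rw [← pow_mul, ← pow_mul, ← pow_add, mul_comm 2]
      _ ≤ ((D + 1) ^ 2 ^ s₁) ^ (2 * (2 ^ v₁ - 1) + 2 ^ v₁ * E₂) :=
          Nat.pow_le_pow_left (by omega) _
      _ ≤ _ := by
          rw [← pow_mul]
          exact Nat.pow_le_pow_right (by omega) (two_pow_exponent_le hv)
  have hS : 0 < πS := Nat.pos_of_ne_zero fun h => by simp [h] at hD'; omega
  refine Nat.lt_of_mul_lt_mul_right (a := πS ^ 2) ?_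
  calc pX * πW ^ 2 * πS ^ 2 = pX * πW₂ ^ 2 * πV ^ 2 := by
        rw [mul_assoc, ← mul_pow, ← hVS]; ring
    _ < πP * D₂ ^ 2 * (D₂ + 1) ^ E₂ * πV ^ 2 := Nat.mul_lt_mul_of_pos_right ih (by positivity)
    _ = πP * (D₂ + 1) ^ E₂ * (D₂ * πV) ^ 2 := by ring
    _ ≤ πP * (D₂ + 1) ^ E₂ * (D' * Q) ^ 2 := Nat.mul_le_mul_left _ (Nat.pow_le_pow_left hD₂V _)
    _ = πP * D ^ 2 * πS ^ 2 * (Q ^ 2 * (D₂ + 1) ^ E₂) := by rw [hD']; ring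
    _ ≤ πP * D ^ 2 * πS ^ 2 * _ := Nat.mul_le_mul_left _ hE
    _ = _ := by ring

theorem prod_pow_succ_sub_one_mul_lt {e : ℕ → ℕ} {c : ℕ → Bool} {P : Finset ℕ}
    (h2 : ∀ p ∈ P, 2 ≤ p) (he : ∀ p ∈ P, 1 ≤ e p)
    (hP : ratioSum e c P ∅ = ratioDenom e P ∅)
    (hne : ∀ R W, R ⊆ P → W ⊆ P \ R → W.Nonempty → ratioSum e c R W ≠ ratioDenom e R W)
    {n : ℕ} : ∀ {R W : Finset ℕ}, #(P \ R) = n → R ⊆ P → W ⊆ P \ R →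
      ratioDenom e R W < ratioSum e c R W →
      (∏ p ∈ P, (p ^ (e p + 1) - 1)) * (∏ p ∈ W, p) ^ 2 <
        (∏ p ∈ P, p) * ratioDenom e R W ^ 2 * (ratioDenom e R W + 1) ^
          (2 ^ (#(P \ (R ∪ W)) + #(P \ R)) - 2 * 2 ^ #(P \ (R ∪ W))) := by
  induction n using Nat.strong_induction_on with
  | _ n ih =>
    intro R W hn hRP hWP hgt
    obtain ⟨S, hS, hSle, hSpow⟩ := exists_adjoin_primes (c := c) hRP hWP h2 hP
    have hdisWS : Disjoint W S := disjoint_left.2 fun p hpW hpS =>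
      (mem_sdiff.1 (hS hpS)).2 (mem_union_right _ hpW)
    have hW'P : W ∪ S ⊆ P \ R := union_subset hWP fun p hp => by
      have := hS hp
      simp only [mem_sdiff, mem_union] at this ⊢
      tauto
    have hW'ne : (W ∪ S).Nonempty := by
      by_contra hcon
      rw [not_nonempty_iff_eq_empty] at hcon
      have hW0 : W = ∅ := (union_eq_empty.1 hcon).1
      rw [hcon] at hSle
      rw [hW0] at hgt
      omega
    obtain ⟨V, hV, hVne, hVle, hVpow⟩ := exists_resolve_primes (c := c) hRP hW'P h2 hP
      (lt_of_le_of_ne hSle (hne R _ hRP hW'P hW'ne))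
    have hD' := ratioDenom_union_right (e := e) (R := R) hdisWS
    have h2W' : ∀ p ∈ W ∪ S, 2 ≤ p := fun p hp => h2 p (mem_sdiff.1 (hW'P hp)).1
    have hD0 : 0 < ratioDenom e R (W ∪ S) := ratioDenom_pos h2W'
    have hVP : V ⊆ P \ R := hV.trans hW'P
    have hdisRV : Disjoint R V := disjoint_left.2 fun p hR hpV => (mem_sdiff.1 (hVP hpV)).2 hR
    have hπV : 0 < ∏ p ∈ V, p := prod_pos fun p hp => by
      have := h2W' p (hV hp)
      omega
    have hsdiff : P \ (R ∪ V) = (P \ R) \ V := by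
      ext p
      simp only [mem_sdiff, mem_union]
      tauto
    by_cases hfin : R ∪ V = P
    · have hVeq : V = P \ R := by
        rw [← hfin, union_sdiff_left, sdiff_eq_self_of_disjoint hdisRV.symm]
      have hWSV : W ∪ S = V := subset_antisymm (hVeq ▸ hW'P) hV
      have hSeq : P \ (R ∪ W) = S := by
        refine subset_antisymm (fun p hp => ?_) hS
        have : p ∈ W ∪ S := by
          rw [hWSV, hVeq]
          simp only [mem_sdiff, mem_union] at hp ⊢
          tauto
        simp only [mem_sdiff, mem_union] at hp this
        tauto
      rw [hSeq, ← hVeq]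
      refine final_step_bound (D' := ratioDenom e R (W ∪ S)) (Q := ∏ p ∈ V, (p ^ (e p + 1) - 1))
        (pR := ∏ p ∈ R, (p ^ (e p + 1) - 1)) (r := ∏ p ∈ R, geomFactor e p) (πR := ∏ p ∈ R, p)
        (πV := ∏ p ∈ V, p) (πS := ∏ p ∈ S, p) hVne.card_pos hD' ?_ ?_ ?_ ?_ ?_ ?_ hπV hSpow hVpow
      · rw [← hWSV, prod_union hdisWS]
      · rw [hWSV, ratioDenom]
      · rw [← prod_union hdisRV, hfin]
      · rw [← prod_mul_distrib]
        refine prod_le_prod' fun p hp => ?_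
        rw [← geomFactor_mul_sub_one e (by have := h2 p (hRP hp); omega)]
        exact Nat.mul_le_mul_left _ (by omega)
      · rw [← prod_union hdisRV, hfin]
      · exact prod_pos fun p hp => by
          have := h2 p (hRP hp)
          omega
    · have hR'P : R ∪ V ⊆ P := union_subset hRP (hVP.trans sdiff_subset)
      have hW₂P : (W ∪ S) \ V ⊆ P \ (R ∪ V) := by
        rw [hsdiff]
        exact sdiff_subset_sdiff hW'P subset_rfl
      have hgt₂ : ratioDenom e (R ∪ V) ((W ∪ S) \ V) < ratioSum e c (R ∪ V) ((W ∪ S) \ V) := by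
        rcases ((W ∪ S) \ V).eq_empty_or_nonempty with h0 | h0
        · rw [h0]
          exact ratioDenom_lt_ratioSum (lt_of_le_of_ne hR'P hfin) h2 he hP
        · exact lt_of_le_of_ne hVle (hne _ _ hR'P hW₂P h0).symm
      have hcardV : #(P \ R) = #V + #(P \ (R ∪ V)) := by
        rw [hsdiff, card_sdiff_of_subset hVP]
        have := card_le_card hVP
        omega
      have hcardS : #(P \ (R ∪ W)) = #S + #(P \ ((R ∪ V) ∪ ((W ∪ S) \ V))) := by
        have : P \ ((R ∪ V) ∪ ((W ∪ S) \ V)) = (P \ (R ∪ W)) \ S := by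
          ext p
          have := @hV p
          simp only [mem_sdiff, mem_union] at this ⊢
          tauto
        rw [this, card_sdiff_of_subset hS]
        have := card_le_card hS
        omega
      have hv₂ : 1 ≤ #(P \ (R ∪ V)) := card_pos.2 (sdiff_nonempty.2 fun hsub =>
        hfin (subset_antisymm hR'P hsub))
      have hIH := ih #(P \ (R ∪ V)) (by have := hVne.card_pos; omega) rfl hR'P hW₂P hgt₂
      rw [hcardV, hcardS]
      refine intermediate_step_bound (φV := ∏ p ∈ V, (p - 1)) hv₂ hD' ?_ ?_ ?_ hπV hD0 hSpow hVpow
        hIH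
      · rw [prod_sdiff hV, prod_union hdisWS]
      · rw [← prod_mul_distrib]
        exact ratioDenom_sdiff hdisRV hV h2W'
      · exact prod_pos fun p hp => by
          have := h2W' p (hV hp)
          omega

theorem ratioSum_ne_ratioDenom {e : ℕ → ℕ} {c : ℕ → Bool} {R W : Finset ℕ} {q : ℕ}
    (hq : q ∈ W) (hcq : c q = true) (hR : ∀ p ∈ R, p.Prime) (hW : ∀ p ∈ W, p.Prime)
    (hmax : ∀ p ∈ W, p ≤ q) (hqR : q ∉ R)
    (hgeom : ∀ p ∈ R, c p = false → ¬ q ∣ geomFactor e p) :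
    ratioSum e c R W ≠ ratioDenom e R W := by
  intro heq
  have hqp := hW q hq
  have h1 : q ∣ ratioDenom e R W := dvd_mul_of_dvd_right (dvd_prod_of_mem _ hq) _
  have h2 : q ∣ ratioNum e (fun p => !c p) R W := by
    refine dvd_mul_of_dvd_right (Dvd.dvd.trans ?_ (dvd_prod_of_mem _ hq)) _
    simp [hcq]
  rw [← heq, ratioSum, Nat.dvd_add_left h2, ratioNum, hqp.dvd_mul,
    hqp.prime.dvd_finsetProd_iff, hqp.prime.dvd_finsetProd_iff] at h1
  rcases h1 with ⟨p, hp, hdvd⟩ | ⟨p, hp, hdvd⟩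
  · cases hcp : c p
    · exact hgeom p hp hcp (by simpa [hcp] using hdvd)
    · rw [if_pos hcp] at hdvd
      exact hqR ((Nat.prime_dvd_prime_iff_eq hqp (hR p hp)).1 (hqp.dvd_of_dvd_pow hdvd) ▸ hp)
  · have hp2 := (hW p hp).two_le
    have hpq := hmax p hp
    split_ifs at hdvd with hcp
    · have := Nat.le_of_dvd (by omega) hdvd
      omega
    · rw [(Nat.prime_dvd_prime_iff_eq hqp (hW p hp)).1 hdvd] at hcq
      exact hcp hcq

theorem ratioSum_not (e : ℕ → ℕ) (c : ℕ → Bool) (R W : Finset ℕ) :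
    ratioSum e (fun p => !c p) R W = ratioSum e c R W := by
  simp [ratioSum, add_comm]

theorem sigma_eq_prod_geomFactor {n : ℕ} (hn : n ≠ 0) :
    _root_.sigma n = ∏ p ∈ n.primeFactors, geomFactor (⇑n.factorization) p :=
  Nat.sum_divisors hn

theorem prod_primeFactors_mul_ite {M N : ℕ} (hM : M ≠ 0) (hN : N ≠ 0) (hcop : Nat.Coprime M N)
    (f g : ℕ → ℕ) :
    (∏ p ∈ (M * N).primeFactors, if p ∣ M then f p else g p) =
      (∏ p ∈ M.primeFactors, f p) * ∏ p ∈ N.primeFactors, g p := by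
  rw [Nat.primeFactors_mul hM hN, prod_union hcop.disjoint_primeFactors]
  congr 1
  · exact prod_congr rfl fun p hp => if_pos (Nat.dvd_of_mem_primeFactors hp)
  · refine prod_congr rfl fun p hp => if_neg fun hdvd => ?_
    exact Nat.not_coprime_of_dvd_of_dvd (Nat.prime_of_mem_primeFactors hp).one_lt hdvd
      (Nat.dvd_of_mem_primeFactors hp) hcop

theorem prod_inv_one_sub_inv_sq_le {P : Finset ℕ} (hP : ∀ p ∈ P, p.Prime) :
    ∏ p ∈ P, (1 - 1 / (p : ℝ) ^ 2)⁻¹ ≤ Real.pi ^ 2 / 6 := by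
  let f : ℕ →* ℝ :=
    { toFun := fun n => 1 / (n : ℝ) ^ 2
      map_one' := by simp
      map_mul' := fun a b => by push_cast; rw [mul_pow, one_div_mul_one_div] }
  have hf : HasSum f (Real.pi ^ 2 / 6) := hasSum_zeta_two
  have h := EulerProduct.prod_filter_prime_geometric_eq_tsum_factoredNumbers hf.summable P
  rw [filter_true_of_mem hP] at h
  rw [← hf.tsum_eq]
  exact h.trans_le (hf.summable.tsum_subtype_le f _ fun n => by
    show 0 ≤ 1 / (n : ℝ) ^ 2
    positivity)

theorem prod_pow_succ_le {P : Finset ℕ} (hP : ∀ p ∈ P, p.Prime) {e : ℕ → ℕ}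
    (he : ∀ p ∈ P, 1 ≤ e p) :
    ((∏ p ∈ P, p ^ (e p + 1) : ℕ) : ℝ) ≤
      Real.pi ^ 2 / 6 * ((∏ p ∈ P, (p ^ (e p + 1) - 1) : ℕ) : ℝ) := by
  refine le_trans ?_ (mul_le_mul_of_nonneg_right (prod_inv_one_sub_inv_sq_le hP) (Nat.cast_nonneg _))
  rw [Nat.cast_prod, Nat.cast_prod, ← prod_mul_distrib]
  refine prod_le_prod (fun p _ => Nat.cast_nonneg _) fun p hp => ?_
  have hp2 : (2 : ℝ) ≤ p := by exact_mod_cast (hP p hp).two_le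
  have hsq : (p : ℝ) ^ 2 ≤ (p : ℝ) ^ (e p + 1) :=
    pow_le_pow_right₀ (by linarith) (by have := he p hp; omega)
  rw [Nat.cast_sub (Nat.one_le_pow _ _ (hP p hp).pos), Nat.cast_pow, Nat.cast_one]
  have h1 : 0 < (p : ℝ) ^ 2 - 1 := by nlinarith
  have e1 : (1 - 1 / (p : ℝ) ^ 2)⁻¹ = (p : ℝ) ^ 2 / ((p : ℝ) ^ 2 - 1) := by
    have := h1.ne'
    have h3 : 1 - 1 / (p : ℝ) ^ 2 = ((p : ℝ) ^ 2 - 1) / (p : ℝ) ^ 2 := by field_simp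
    rw [h3, inv_div]
  rw [e1, div_mul_eq_mul_div, le_div_iff₀ h1]
  linarith

theorem prod_pow_succ_sub_one_lt_of_amicable {M N : ℕ} (hM : M ≠ 0) (hN : N ≠ 0)
    (hσM : _root_.sigma M = M + N) (hσN : _root_.sigma N = M + N) (hcop : Nat.Coprime M N) :
    (∏ p ∈ (M * N).primeFactors, (p ^ ((M * N).factorization p + 1) - 1)) <
      (∏ p ∈ (M * N).primeFactors, p) *
        2 ^ (2 ^ (#(M * N).primeFactors + #(M * N).primeFactors) -
          2 * 2 ^ #(M * N).primeFactors) := by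
  set P := (M * N).primeFactors with hPdef
  set e : ℕ → ℕ := ⇑(M * N).factorization with hedef
  have hprime : ∀ p ∈ P, p.Prime := fun p hp => Nat.prime_of_mem_primeFactors hp
  have heM : ∀ p ∈ M.primeFactors, e p = M.factorization p := fun p hp =>
    Nat.factorization_eq_of_coprime_left hcop (Nat.mem_primeFactors_iff_mem_primeFactorsList.1 hp)
  have heN : ∀ p ∈ N.primeFactors, e p = N.factorization p := fun p hp =>
    Nat.factorization_eq_of_coprime_right hcop (Nat.mem_primeFactors_iff_mem_primeFactorsList.1 hp)
  have hgM : ∏ p ∈ M.primeFactors, geomFactor e p = M + N := by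
    rw [← hσM, sigma_eq_prod_geomFactor hM]
    exact prod_congr rfl fun p hp => by rw [geomFactor, geomFactor, heM p hp]
  have hgN : ∏ p ∈ N.primeFactors, geomFactor e p = M + N := by
    rw [← hσN, sigma_eq_prod_geomFactor hN]
    exact prod_congr rfl fun p hp => by rw [geomFactor, geomFactor, heN p hp]
  have hpM : ∏ p ∈ M.primeFactors, p ^ e p = M := by
    conv_rhs => rw [← Nat.prod_factorization_pow_eq_self hM]
    exact prod_congr rfl fun p hp => by rw [heM p hp]
  have hpN : ∏ p ∈ N.primeFactors, p ^ e p = N := by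
    conv_rhs => rw [← Nat.prod_factorization_pow_eq_self hN]
    exact prod_congr rfl fun p hp => by rw [heN p hp]
  let c : ℕ → Bool := fun p => decide (p ∣ M)
  have hsum : ratioSum e c P ∅ = ratioDenom e P ∅ := by
    have h1 : ratioNum e c P ∅ = M * (M + N) := by
      have := prod_primeFactors_mul_ite hM hN hcop (fun p => p ^ e p) (geomFactor e)
      rw [hpM, hgN] at this
      simpa [ratioNum, c] using this
    have h2 : ratioNum e (fun p => !c p) P ∅ = (M + N) * N := by
      have := prod_primeFactors_mul_ite hM hN hcop (geomFactor e) (fun p => p ^ e p)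
      rw [hgM, hpN] at this
      rw [← this, ratioNum, prod_empty, mul_one]
      refine prod_congr rfl fun p _ => ?_
      by_cases hp : p ∣ M <;> simp [c, hp]
    have h3 : ratioDenom e P ∅ = (M + N) * (M + N) := by
      have := prod_primeFactors_mul_ite hM hN hcop (geomFactor e) (geomFactor e)
      rw [hgM, hgN] at this
      simpa [ratioDenom] using this
    rw [ratioSum, h1, h2, h3]
    ring
  have hdvdP : ∀ p ∈ P, p ∣ M ∨ p ∣ N := fun p hp =>
    (hprime p hp).dvd_mul.1 (Nat.dvd_of_mem_primeFactors hp)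
  have hnot : ∀ p ∈ P, ¬ (p ∣ M ∧ p ∣ N) := fun p hp h =>
    Nat.not_coprime_of_dvd_of_dvd (hprime p hp).one_lt h.1 h.2 hcop
  have hne : ∀ R W, R ⊆ P → W ⊆ P \ R → W.Nonempty → ratioSum e c R W ≠ ratioDenom e R W := by
    intro R W hR hW hWne
    obtain ⟨q, hq, hmax⟩ := W.exists_max_image id hWne
    have hqP := mem_sdiff.1 (hW hq)
    have hRp : ∀ p ∈ R, p.Prime := fun p hp => hprime p (hR hp)
    have hWp : ∀ p ∈ W, p.Prime := fun p hp => hprime p (mem_sdiff.1 (hW hp)).1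
    by_cases hqM : q ∣ M
    · refine ratioSum_ne_ratioDenom hq (by simp [c, hqM]) hRp hWp hmax hqP.2 fun p hp hcp hdvd => ?_
      have hpM : ¬ p ∣ M := by simpa [c] using hcp
      have hpN := Nat.mem_primeFactors.2 ⟨hRp p hp, (hdvdP p (hR hp)).resolve_left hpM, hN⟩
      have h1 := hdvd.trans (hgN ▸ dvd_prod_of_mem (geomFactor e) hpN)
      exact hnot q hqP.1 ⟨hqM, (Nat.dvd_add_right hqM).1 h1⟩
    · rw [← ratioSum_not]
      have hqN := (hdvdP q hqP.1).resolve_left hqM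
      refine ratioSum_ne_ratioDenom hq (by simp [c, hqM]) hRp hWp hmax hqP.2 fun p hp hcp hdvd => ?_
      have hpM := Nat.mem_primeFactors.2 ⟨hRp p hp, by simpa [c] using hcp, hM⟩
      have h1 := hdvd.trans (hgM ▸ dvd_prod_of_mem (geomFactor e) hpM)
      exact hqM ((Nat.dvd_add_left hqN).1 h1)
  have he : ∀ p ∈ P, 1 ≤ e p := fun p hp =>
    (hprime p hp).factorization_pos_of_dvd (mul_ne_zero hM hN) (Nat.dvd_of_mem_primeFactors hp)
  have := prod_pow_succ_sub_one_mul_lt (fun p hp => (hprime p hp).two_le) he hsum hne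
    (R := ∅) (W := ∅) rfl (empty_subset _) (empty_subset _) (by simp [ratioDenom, ratioSum, ratioNum])
  simpa [ratioDenom] using this

end AmicableBound

theorem amicable_tuples_stmt1 (M N : ℕ) (hM : 0 < M) (hN : 0 < N) (hMN : M ≠ N)
    (hamic1 : sigma M = M + N) (hamic2 : sigma N = M + N)
    (hcop : Nat.gcd M N = 1)
    (K : ℕ) (hK : K = (M * N).primeFactors.card) :
    ((M * N : ℕ) : ℝ) <
      Real.pi ^ 2 / 6 * (2 : ℝ) ^ ((4 : ℝ) ^ K - 2 * (2 : ℝ) ^ K) := by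
  have hMN0 : M * N ≠ 0 := by positivity
  have hK1 : 1 ≤ K := by
    rw [hK, Nat.one_le_iff_ne_zero, Finset.card_ne_zero, Nat.nonempty_primeFactors]
    by_contra! hle
    have h1 : M * N = 1 := by omega
    exact hMN ((mul_eq_one.1 h1).1.trans (mul_eq_one.1 h1).2.symm)
  have hlt := prod_pow_succ_sub_one_lt_of_amicable hM.ne' hN.ne' hamic1 hamic2 hcop
  have hprime : ∀ p ∈ (M * N).primeFactors, p.Prime := fun p hp => Nat.prime_of_mem_primeFactors hp
  have hle := prod_pow_succ_le hprime (e := ⇑(M * N).factorization) fun p hp =>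
    (hprime p hp).factorization_pos_of_dvd hMN0 (Nat.dvd_of_mem_primeFactors hp)
  have hpow : ∏ p ∈ (M * N).primeFactors, p ^ ((M * N).factorization p + 1) =
      M * N * ∏ p ∈ (M * N).primeFactors, p := by
    simp only [pow_succ, Finset.prod_mul_distrib]
    congr 1
    exact Nat.prod_factorization_pow_eq_self hMN0
  rw [← hK] at hlt
  have hexp : (4 : ℝ) ^ K - 2 * (2 : ℝ) ^ K = ((2 ^ (K + K) - 2 * 2 ^ K : ℕ) : ℝ) := by
    have hle2 : 2 * 2 ^ K ≤ 2 ^ (K + K) := by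
      rw [pow_add]
      exact Nat.mul_le_mul_right _ (by simpa using Nat.pow_le_pow_right (n := 2) (by norm_num) hK1)
    rw [Nat.cast_sub hle2]
    push_cast
    rw [← two_mul, pow_mul]
    norm_num
  rw [hexp, Real.rpow_natCast]
  rw [hpow] at hle
  have hpos : (0 : ℝ) < ((∏ p ∈ (M * N).primeFactors, p : ℕ) : ℝ) := by
    exact_mod_cast Finset.prod_pos fun p hp => (hprime p hp).pos
  have hlt' : ((∏ p ∈ (M * N).primeFactors, (p ^ ((M * N).factorization p + 1) - 1) : ℕ) : ℝ) <
      ((∏ p ∈ (M * N).primeFactors, p : ℕ) : ℝ) * 2 ^ (2 ^ (K + K) - 2 * 2 ^ K) := by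
    exact_mod_cast hlt
  refine lt_of_mul_lt_mul_right ?_ hpos.le
  rw [← Nat.cast_mul]
  refine hle.trans_lt ?_
  rw [mul_assoc, mul_comm (2 ^ _ : ℝ)]
  exact mul_lt_mul_of_pos_left hlt' (by positivity)
end

section
/- Let k ≥ 2 and let (M_1, …, M_k) be an amicable k-tuple such that M_1, …, M_k are pairwise coprime and gcd(M_1 ⋯ M_k, M_1 + ⋯ + M_k) = 1, and set K = ω(M_1 ⋯ M_k). Then M_1 ⋯ M_k < (π²/6) · 2^{4^K − 2·2^K}. -/
def sylvesterProd : ℕ → ℕ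
  | 0 => 1
  | n + 1 => sylvesterProd n * (sylvesterProd n + 1)

lemma sylvesterProd_pos (n : ℕ) : 0 < sylvesterProd n := by
  induction n with
  | zero => simp [sylvesterProd]
  | succ n ih => simp only [sylvesterProd]; positivity

lemma sum_inv_add_mul_log_le {ι : Type*} [DecidableEq ι] (x : ι → ℝ) (d : ℕ → ℝ)
    (hd : ∀ n, 0 < d n) (hrec : ∀ n, d (n + 1) = d n * (d n + 1)) (T : Finset ι)
    (hx : ∀ i ∈ T, 0 < x i)
    (hbig : ∀ S ⊆ T, S.Nonempty → d S.card < d 0 * ∏ i ∈ S, x i)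
    (w : ℝ) (hw : 0 ≤ w) (hwx : ∀ i ∈ T, w ≤ 1 / x i) :
    ∑ i ∈ T, 1 / x i + w * (Real.log (d 0 * ∏ i ∈ T, x i) - Real.log (d T.card)) ≤
      1 / d 0 - 1 / d T.card := by
  induction T using Finset.induction_on_max_value x generalizing w with
  | empty => simp
  | insert a T ha hmax ih =>
    have hxa : 0 < x a := hx a (Finset.mem_insert_self a T)
    have hxT : ∀ i ∈ T, 0 < x i := fun i hi => hx i (Finset.mem_insert_of_mem hi)
    have key := ih hxT (fun S hS => hbig S (hS.trans (Finset.subset_insert a T)))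
      (1 / x a) (by positivity)
      (fun i hi => one_div_le_one_div_of_le (hxT i hi) (hmax i hi))
    have hlast := hbig _ subset_rfl (Finset.insert_nonempty a T)
    have hP : 0 < ∏ i ∈ T, x i := Finset.prod_pos hxT
    have hwa : w ≤ 1 / x a := hwx a (Finset.mem_insert_self a T)
    rw [Finset.sum_insert ha]
    rw [Finset.card_insert_of_notMem ha] at hlast ⊢
    have hlog : 0 ≤ Real.log (d 0 * ∏ i ∈ insert a T, x i) - Real.log (d (T.card + 1)) :=
      sub_nonneg.2 (Real.log_le_log (hd _) hlast.le)
    have hstep := mul_le_mul_of_nonneg_right hwa hlog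
    have hz : 0 < d T.card + 1 := by linarith [hd T.card]
    have hl1 : Real.log (d 0 * ∏ i ∈ insert a T, x i) =
        Real.log (d 0 * ∏ i ∈ T, x i) + Real.log (x a) := by
      rw [Finset.prod_insert ha, ← Real.log_mul (mul_pos (hd 0) hP).ne' hxa.ne']
      ring_nf
    have hl2 : Real.log (d (T.card + 1)) = Real.log (d T.card) + Real.log (d T.card + 1) := by
      rw [hrec, Real.log_mul (hd _).ne' hz.ne']
    have hd2 : 1 / d (T.card + 1) = 1 / d T.card - 1 / (d T.card + 1) := by
      have := hd T.card
      rw [hrec]; field_simp; ring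
    have hc : 1 / x a * (1 + (Real.log (x a) - Real.log (d T.card + 1))) ≤
        1 / (d T.card + 1) := by
      rw [← Real.log_div hxa.ne' hz.ne']
      have := Real.log_le_sub_one_of_pos (div_pos hxa hz)
      calc 1 / x a * (1 + Real.log (x a / (d T.card + 1)))
          ≤ 1 / x a * (x a / (d T.card + 1)) := by gcongr; linarith
        _ = 1 / (d T.card + 1) := by field_simp
    rw [hl1, hl2] at hstep ⊢
    rw [hd2]
    linarith

lemma exists_prod_le_sylvesterProd {ι : Type*} [DecidableEq ι] (x : ι → ℝ) (T : Finset ι)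
    (hx : ∀ i ∈ T, 0 < x i) (t : ℕ)
    (hsum : 1 / (sylvesterProd t : ℝ) ≤ ∑ i ∈ T, 1 / x i) :
    ∃ S ⊆ T, S.Nonempty ∧
      (sylvesterProd t : ℝ) * ∏ i ∈ S, x i ≤ sylvesterProd (t + S.card) := by
  by_contra! h
  have hd : ∀ n, (0 : ℝ) < sylvesterProd (t + n) := fun n => by
    exact_mod_cast sylvesterProd_pos _
  have := sum_inv_add_mul_log_le x (fun n => (sylvesterProd (t + n) : ℝ)) hd
    (fun n => by rw [← add_assoc]; simp [sylvesterProd]) T hx h 0 le_rfl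
    (fun i hi => one_div_nonneg.2 (hx i hi).le)
  have h1 := one_div_pos.2 (hd T.card)
  simp only [add_zero, zero_mul] at this
  linarith

lemma prod_sub_prod_mul_le {ι : Type*} [DecidableEq ι] (s : Finset ι) (c y : ι → ℝ)
    (hc0 : ∀ i ∈ s, 0 ≤ c i) (hc1 : ∀ i ∈ s, c i ≤ 1)
    (hy0 : ∀ i ∈ s, 0 ≤ y i) (hy1 : ∀ i ∈ s, y i ≤ 1) :
    ∏ i ∈ s, c i - ∏ i ∈ s, c i * y i ≤ ∑ i ∈ s, (1 - y i) := by
  have h1 : 1 - ∏ i ∈ s, y i ≤ ∑ i ∈ s, (1 - y i) := by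
    induction s using Finset.induction_on with
    | empty => simp
    | insert a s ha ih =>
      simp only [Finset.mem_insert, forall_eq_or_imp] at *
      rw [Finset.prod_insert ha, Finset.sum_insert ha]
      have := ih hc0.2 hc1.2 hy0.2 hy1.2
      have hP1 := Finset.prod_le_one hy0.2 hy1.2
      nlinarith
  have h2 := Finset.prod_le_one hc0 hc1
  have h3 := Finset.prod_nonneg hc0
  have h4 := Finset.prod_le_one hy0 hy1
  rw [Finset.prod_mul_distrib]
  nlinarith

lemma sylvesterProd_add_four_lt (n : ℕ) : sylvesterProd (n + 4) + 1 ≤ 2 ^ (11 * 2 ^ n) := by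
  induction n with
  | zero => decide
  | succ n ih =>
    have h : 2 ^ (11 * 2 ^ (n + 1)) = (2 ^ (11 * 2 ^ n)) ^ 2 := by
      rw [← pow_mul]; ring_nf
    rw [h, show n + 1 + 4 = (n + 4) + 1 by ring, sylvesterProd]
    nlinarith

/-- The sum of the divisors of `p ^ a p`, for `p` prime. -/
def geomSigma (a : ℕ → ℕ) (p : ℕ) : ℕ := ∑ i ∈ Finset.range (a p + 1), p ^ i

/-- Numerator of the factor attached to `p` when the exponents are known on `U` and the primes
are known on `W`. -/
def stateNum (a : ℕ → ℕ) (U W : Finset ℕ) (p : ℕ) : ℕ :=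
  if p ∈ U then p ^ a p else if p ∈ W then p - 1 else 1

/-- Denominator of the factor attached to `p`, see `stateNum`. -/
def stateDen (a : ℕ → ℕ) (U W : Finset ℕ) (p : ℕ) : ℕ :=
  if p ∈ U then geomSigma a p else if p ∈ W then p else 1

/-- The factor attached to `p`, see `stateNum`. -/
noncomputable def stateRatio (a : ℕ → ℕ) (U W : Finset ℕ) (p : ℕ) : ℝ :=
  (stateNum a U W p : ℝ) / stateDen a U W p

/-- The local data of an amicable tuple whose members are coprime to each other and to their
sum: `Q i` is the set of primes dividing the `i`-th member, `a p` is the exponent of `p`. -/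
structure AmicableData {ι : Type*} [Fintype ι] (P : Finset ℕ) (Q : ι → Finset ℕ)
    (a : ℕ → ℕ) : Prop where
  prime : ∀ p ∈ P, p.Prime
  disjoint : ∀ i j, i ≠ j → Disjoint (Q i) (Q j)
  union : Finset.univ.biUnion Q = P
  not_dvd : ∀ p ∈ P, ∀ q ∈ P, ¬ q ∣ geomSigma a p
  sum_eq : ∑ i, ∏ p ∈ Q i, ((p ^ a p : ℕ) : ℝ) / geomSigma a p = 1

lemma geomSigma_pos (a : ℕ → ℕ) (p : ℕ) : 0 < geomSigma a p := by
  rw [geomSigma, Finset.sum_range_succ']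
  simp

lemma geomSigma_mul_pred (a : ℕ → ℕ) (p : ℕ) :
    (geomSigma a p : ℝ) * (p - 1) = (p : ℝ) ^ (a p + 1) - 1 := by
  simp [geomSigma, geom_sum_mul]

lemma geomSigma_le {p : ℕ} (a : ℕ → ℕ) (hp : 2 ≤ p) :
    (geomSigma a p : ℝ) ≤ (p : ℝ) ^ (a p + 1) := by
  have h := geomSigma_mul_pred a p
  have h2 : (2 : ℝ) ≤ p := by exact_mod_cast hp
  have h3 : (0 : ℝ) < geomSigma a p := by exact_mod_cast geomSigma_pos a p
  nlinarith

lemma stateDen_pos {p : ℕ} (a : ℕ → ℕ) (U W : Finset ℕ) (hp : 0 < p) :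
    0 < stateDen a U W p := by
  unfold stateDen
  split_ifs
  exacts [geomSigma_pos a p, hp, one_pos]

lemma stateRatio_of_mem {p : ℕ} (a : ℕ → ℕ) {U : Finset ℕ} (W : Finset ℕ) (h : p ∈ U) :
    stateRatio a U W p = ((p ^ a p : ℕ) : ℝ) / geomSigma a p := by
  simp [stateRatio, stateNum, stateDen, h]

lemma stateRatio_of_mem_of_notMem {p : ℕ} (a : ℕ → ℕ) {U W : Finset ℕ} (hp : 1 ≤ p)
    (h : p ∉ U) (h' : p ∈ W) : stateRatio a U W p = 1 - 1 / p := by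
  have : (p : ℝ) ≠ 0 := by positivity
  simp only [stateRatio, stateNum, stateDen, h, h', if_true, if_false]
  push_cast [hp]
  field_simp

lemma stateRatio_of_notMem {p : ℕ} (a : ℕ → ℕ) {U W : Finset ℕ}
    (h : p ∉ U) (h' : p ∉ W) : stateRatio a U W p = 1 := by
  simp [stateRatio, stateNum, stateDen, h, h']

lemma pow_div_geomSigma_mul {p : ℕ} (a : ℕ → ℕ) (hp : 1 ≤ p) :
    ((p ^ a p : ℕ) : ℝ) / geomSigma a p * (1 - 1 / (p : ℝ) ^ (a p + 1)) = 1 - 1 / p := by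
  have h := geomSigma_mul_pred a p
  have h3 : (0 : ℝ) < geomSigma a p := by exact_mod_cast geomSigma_pos a p
  have hp' : (0 : ℝ) < p := by exact_mod_cast hp
  push_cast
  rw [eq_comm, div_mul_eq_mul_div, eq_div_iff h3.ne']
  have e : (p : ℝ) ^ a p * (1 - 1 / (p : ℝ) ^ (a p + 1)) = ((p : ℝ) ^ (a p + 1) - 1) / p := by
    rw [pow_succ]; field_simp
  rw [e, ← h]
  field_simp

lemma pow_div_geomSigma_le_one (a : ℕ → ℕ) (p : ℕ) :
    ((p ^ a p : ℕ) : ℝ) / geomSigma a p ≤ 1 := by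
  have h3 : (0 : ℝ) < geomSigma a p := by exact_mod_cast geomSigma_pos a p
  rw [div_le_one h3, geomSigma, Finset.sum_range_succ]
  push_cast
  have : (0 : ℝ) ≤ ∑ i ∈ Finset.range (a p), (p : ℝ) ^ i := by positivity
  linarith

lemma pow_div_geomSigma_lt_one {p : ℕ} {a : ℕ → ℕ} (ha : a p ≠ 0) :
    ((p ^ a p : ℕ) : ℝ) / geomSigma a p < 1 := by
  have h3 : (0 : ℝ) < geomSigma a p := by exact_mod_cast geomSigma_pos a p
  obtain ⟨b, hb⟩ := Nat.exists_eq_succ_of_ne_zero ha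
  rw [div_lt_one h3, geomSigma, Finset.sum_range_succ, hb, Finset.sum_range_succ']
  push_cast
  have : (0 : ℝ) ≤ ∑ i ∈ Finset.range b, (p : ℝ) ^ (i + 1) := by positivity
  simp only [Nat.succ_eq_add_one, pow_zero]
  linarith

lemma one_sub_inv_le_pow_div_geomSigma {p : ℕ} (a : ℕ → ℕ) (hp : 1 ≤ p) :
    1 - 1 / (p : ℝ) ≤ ((p ^ a p : ℕ) : ℝ) / geomSigma a p := by
  rw [← pow_div_geomSigma_mul a hp]
  have hp' : (0 : ℝ) < p := by exact_mod_cast hp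
  exact mul_le_of_le_one_right (by positivity) (by rw [sub_le_self_iff]; positivity)

lemma stateRatio_nonneg (a : ℕ → ℕ) (U W : Finset ℕ) (p : ℕ) : 0 ≤ stateRatio a U W p := by
  unfold stateRatio; positivity

lemma stateRatio_le_one {p : ℕ} (a : ℕ → ℕ) (U W : Finset ℕ) (hp : 1 ≤ p) :
    stateRatio a U W p ≤ 1 := by
  by_cases h : p ∈ U
  · rw [stateRatio_of_mem a W h]; exact pow_div_geomSigma_le_one a p
  by_cases h' : p ∈ W
  · rw [stateRatio_of_mem_of_notMem a hp h h', sub_le_self_iff]; positivity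
  · rw [stateRatio_of_notMem a h h']

namespace AmicableData

variable {ι : Type*} [Fintype ι] {P : Finset ℕ} {Q : ι → Finset ℕ} {a : ℕ → ℕ}

lemma subset (H : AmicableData P Q a) (i : ι) : Q i ⊆ P := by
  rw [← H.union]; exact Finset.subset_biUnion_of_mem Q (Finset.mem_univ i)

lemma sum_sub_sum_le (H : AmicableData P Q a) (c y : ℕ → ℝ)
    (hc0 : ∀ p ∈ P, 0 ≤ c p) (hc1 : ∀ p ∈ P, c p ≤ 1)
    (hy0 : ∀ p ∈ P, 0 ≤ y p) (hy1 : ∀ p ∈ P, y p ≤ 1) :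
    ∑ i, ∏ p ∈ Q i, c p - ∑ i, ∏ p ∈ Q i, c p * y p ≤ ∑ p ∈ P, (1 - y p) := by
  rw [← H.union, Finset.sum_biUnion (fun i _ j _ h => H.disjoint i j h),
    ← Finset.sum_sub_distrib]
  exact Finset.sum_le_sum fun i _ => prod_sub_prod_mul_le _ _ _
    (fun p hp => hc0 p (H.subset i hp)) (fun p hp => hc1 p (H.subset i hp))
    (fun p hp => hy0 p (H.subset i hp)) (fun p hp => hy1 p (H.subset i hp))

lemma sum_mul_prod_stateDen (H : AmicableData P Q a) (U W : Finset ℕ) :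
    (∑ i, ∏ p ∈ Q i, stateRatio a U W p) * ((∏ p ∈ P, stateDen a U W p : ℕ) : ℝ) =
      ((∑ i, (∏ p ∈ Q i, stateNum a U W p) * ∏ p ∈ P \ Q i, stateDen a U W p : ℕ) : ℝ) := by
  push_cast
  rw [Finset.sum_mul]
  refine Finset.sum_congr rfl fun i _ => ?_
  rw [← Finset.prod_sdiff (H.subset i), mul_comm (∏ p ∈ P \ Q i, _), ← mul_assoc,
    ← Finset.prod_mul_distrib]
  congr 1
  refine Finset.prod_congr rfl fun p hp => ?_
  have := stateDen_pos a U W (H.prime p (H.subset i hp)).pos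
  unfold stateRatio
  field_simp

lemma sum_stateRatio_ne_one (H : AmicableData P Q a) {U W : Finset ℕ} (hUW : U ⊆ W)
    (hWP : W ⊆ P) (hne : U ≠ W) : ∑ i, ∏ p ∈ Q i, stateRatio a U W p ≠ 1 := by
  intro h
  have key := H.sum_mul_prod_stateDen U W
  rw [h, one_mul, Nat.cast_inj] at key
  have hV : (W \ U).Nonempty := by
    rw [Finset.sdiff_nonempty]; exact fun h => hne (hUW.antisymm h)
  set q := (W \ U).max' hV with hq
  have hqV : q ∈ W \ U := Finset.max'_mem _ _
  have hqW := (Finset.mem_sdiff.1 hqV).1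
  have hqU := (Finset.mem_sdiff.1 hqV).2
  have hqP := hWP hqW
  have hqp := H.prime q hqP
  have hden : stateDen a U W q = q := by simp [stateDen, hqU, hqW]
  obtain ⟨i₀, -, hi₀⟩ := Finset.mem_biUnion.1 (H.union.symm ▸ hqP)
  have hdvd : q ∣ ∏ p ∈ P, stateDen a U W p :=
    (dvd_of_eq hden.symm).trans (Finset.dvd_prod_of_mem _ hqP)
  classical
  rw [key, ← Finset.add_sum_erase _ _ (Finset.mem_univ i₀), ← Nat.dvd_add_iff_left,
    hqp.dvd_mul, hqp.prime.dvd_finsetProd_iff, hqp.prime.dvd_finsetProd_iff] at hdvd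
  · rcases hdvd with ⟨p, hp, hd⟩ | ⟨p, hp, hd⟩
    · have hpP := H.subset i₀ hp
      have hpp := H.prime p hpP
      unfold stateNum at hd
      split_ifs at hd with h1 h2
      · have := (Nat.prime_dvd_prime_iff_eq hqp hpp).1 (hqp.dvd_of_dvd_pow hd)
        exact hqU (this ▸ h1)
      · have h3 : p ≤ q := Finset.le_max' _ _ (Finset.mem_sdiff.2 ⟨h2, h1⟩)
        have := Nat.le_of_dvd (by have := hpp.two_le; omega) hd
        have := hpp.two_le
        omega
      · exact hqp.one_lt.ne' (Nat.dvd_one.1 hd)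
    · obtain ⟨hpP, hpi⟩ := Finset.mem_sdiff.1 hp
      unfold stateDen at hd
      split_ifs at hd with h1 h2
      · exact H.not_dvd p hpP q hqP hd
      · have := (Nat.prime_dvd_prime_iff_eq hqp (H.prime p hpP)).1 hd
        exact hpi (this ▸ hi₀)
      · exact hqp.one_lt.ne' (Nat.dvd_one.1 hd)
  · refine Finset.dvd_sum fun j hj => ?_
    have hqj : q ∈ P \ Q j := Finset.mem_sdiff.2 ⟨hqP, fun hqj =>
      Finset.disjoint_left.1 (H.disjoint j i₀ (Finset.ne_of_mem_erase hj)) hqj hi₀⟩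
    exact ((dvd_of_eq hden.symm).trans (Finset.dvd_prod_of_mem _ hqj)).mul_left _

lemma prod_stateDen_le (H : AmicableData P Q a) {U W : Finset ℕ} (hUW : U ⊆ W) (hWP : W ⊆ P) :
    ((∏ p ∈ P, stateDen a U W p : ℕ) : ℝ) ≤
      (∏ p ∈ W, (p : ℝ)) * ∏ p ∈ U, (p : ℝ) ^ (a p + 1) := by
  have e1 : ∏ p ∈ W, (p : ℝ) = ∏ p ∈ P, if p ∈ W then (p : ℝ) else 1 := by
    rw [Finset.prod_ite_mem, Finset.inter_eq_right.2 hWP]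
  have e2 : ∏ p ∈ U, (p : ℝ) ^ (a p + 1) =
      ∏ p ∈ P, if p ∈ U then (p : ℝ) ^ (a p + 1) else 1 := by
    rw [Finset.prod_ite_mem, Finset.inter_eq_right.2 (hUW.trans hWP)]
  rw [e1, e2, ← Finset.prod_mul_distrib]
  push_cast
  refine Finset.prod_le_prod (fun _ _ => by positivity) fun p hp => ?_
  have h2 := (H.prime p hp).two_le
  have h2' : (2 : ℝ) ≤ p := by exact_mod_cast h2
  by_cases hU : p ∈ U
  · have := geomSigma_le a h2
    have h0 : (0 : ℝ) ≤ (p : ℝ) ^ (a p + 1) := by positivity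
    simp only [stateDen, hU, hUW hU, if_true]
    nlinarith
  · by_cases hW : p ∈ W <;> simp [stateDen, hU, hW]

lemma inv_le_abs_sub_one (H : AmicableData P Q a) {U W : Finset ℕ} (hUW : U ⊆ W) (hWP : W ⊆ P)
    (hne : ∑ i, ∏ p ∈ Q i, stateRatio a U W p ≠ 1) :
    1 / ((∏ p ∈ W, (p : ℝ)) * ∏ p ∈ U, (p : ℝ) ^ (a p + 1)) ≤
      |∑ i, ∏ p ∈ Q i, stateRatio a U W p - 1| := by
  have key := H.sum_mul_prod_stateDen U W
  have hle := H.prod_stateDen_le hUW hWP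
  have hD : (0 : ℝ) < (∏ p ∈ P, stateDen a U W p : ℕ) := by
    exact_mod_cast Finset.prod_pos fun p hp => stateDen_pos a U W (H.prime p hp).pos
  refine (one_div_le_one_div_of_le hD hle).trans ?_
  generalize (∏ p ∈ P, stateDen a U W p) = D at *
  generalize (∑ i, (∏ p ∈ Q i, stateNum a U W p) * ∏ p ∈ P \ Q i, stateDen a U W p) = A at *
  generalize ∑ i, ∏ p ∈ Q i, stateRatio a U W p = F at *
  have hF : F - 1 = ((A : ℤ) - (D : ℤ) : ℤ) / (D : ℝ) := by
    push_cast; rw [← key]; field_simp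
  have hAD : (A : ℤ) - D ≠ 0 := by
    intro h0
    rw [h0] at hF
    simp at hF
    exact hne (by linarith)
  rw [hF, abs_div, abs_of_pos hD]
  gcongr
  exact_mod_cast Int.one_le_abs hAD

/-- From a state in which not everything is known, one can reach a later state without
exceeding the bound given by `sylvesterProd`. -/
lemma exists_next (H : AmicableData P Q a) (ha : ∀ p ∈ P, a p ≠ 0) {U W : Finset ℕ}
    (hUW : U ⊆ W) (hWP : W ⊆ P) (hU : U ≠ P)
    (hle : (∏ p ∈ W, (p : ℝ)) * ∏ p ∈ U, (p : ℝ) ^ (a p + 1) ≤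
      sylvesterProd (U.card + W.card)) :
    ∃ U' W' : Finset ℕ, U' ⊆ W' ∧ W' ⊆ P ∧ U.card + W.card < U'.card + W'.card ∧
      (∏ p ∈ W', (p : ℝ)) * ∏ p ∈ U', (p : ℝ) ^ (a p + 1) ≤
        sylvesterProd (U'.card + W'.card) := by
  have hP0 : ∀ p ∈ P, (0 : ℝ) < p := fun p hp => by exact_mod_cast (H.prime p hp).pos
  have hP1 : ∀ p ∈ P, 1 ≤ p := fun p hp => (H.prime p hp).pos
  have hX : 0 < (∏ p ∈ W, (p : ℝ)) * ∏ p ∈ U, (p : ℝ) ^ (a p + 1) :=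
    mul_pos (Finset.prod_pos fun p hp => hP0 p (hWP hp))
      (Finset.prod_pos fun p hp => pow_pos (hP0 p (hWP (hUW hp))) _)
  have hinv := one_div_le_one_div_of_le hX hle
  rcases lt_or_ge 1 (∑ i, ∏ p ∈ Q i, stateRatio a U W p) with hF | hF
  · have hgap := H.inv_le_abs_sub_one hUW hWP hF.ne'
    rw [abs_of_pos (by linarith)] at hgap
    have hyP : ∀ p ∈ P, (1 : ℝ) / p ≤ 1 := fun p hp => by
      rw [div_le_one (hP0 p hp)]; exact_mod_cast hP1 p hp
    have hsub := H.sum_sub_sum_le (stateRatio a U W)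
      (fun p => if p ∈ P \ W then 1 - 1 / (p : ℝ) else 1)
      (fun p _ => stateRatio_nonneg a U W p) (fun p hp => stateRatio_le_one a U W (hP1 p hp))
      (fun p hp => by
        split_ifs
        · linarith [hyP p hp]
        · norm_num)
      (fun p hp => by
        split_ifs
        · rw [sub_le_self_iff]; positivity
        · exact le_rfl)
    have hlow : ∑ i, ∏ p ∈ Q i,
        stateRatio a U W p * (if p ∈ P \ W then 1 - 1 / (p : ℝ) else 1) ≤ 1 := by
      refine le_of_le_of_eq ?_ H.sum_eq
      refine Finset.sum_le_sum fun i _ => Finset.prod_le_prod (fun p hp => ?_) fun p hp => ?_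
      · refine mul_nonneg (stateRatio_nonneg a U W p) ?_
        split_ifs
        · linarith [hyP p (H.subset i hp)]
        · norm_num
      · have hpP := H.subset i hp
        have h1 := one_sub_inv_le_pow_div_geomSigma a (hP1 p hpP)
        by_cases hW : p ∈ W
        · by_cases hU : p ∈ U
          · simp [stateRatio_of_mem a W hU, hW]
          · rw [stateRatio_of_mem_of_notMem a (hP1 p hpP) hU hW]
            simpa [hW] using h1
        · rw [stateRatio_of_notMem a (fun h => hW (hUW h)) hW]
          simpa [hW, hpP] using h1
    have hsum : ∑ p ∈ P, (1 - (if p ∈ P \ W then 1 - 1 / (p : ℝ) else 1)) =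
        ∑ p ∈ P \ W, 1 / (p : ℝ) := by
      rw [← Finset.sum_sdiff hWP]
      have z : ∑ p ∈ W, (1 - (if p ∈ P \ W then 1 - 1 / (p : ℝ) else 1)) = 0 :=
        Finset.sum_eq_zero fun p hp => by simp [hp]
      rw [z, add_zero]
      exact Finset.sum_congr rfl fun p hp => by rw [if_pos hp]; ring
    rw [hsum] at hsub
    obtain ⟨S, hS, hSne, hSle⟩ := exists_prod_le_sylvesterProd (fun p : ℕ => (p : ℝ)) (P \ W)
      (fun p hp => hP0 p (Finset.mem_sdiff.1 hp).1) (U.card + W.card) (by linarith)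
    have hdisj : Disjoint W S := Finset.disjoint_left.2 fun p hp hpS =>
      (Finset.mem_sdiff.1 (hS hpS)).2 hp
    have hc := hSne.card_pos
    refine ⟨U, W ∪ S, hUW.trans Finset.subset_union_left,
      Finset.union_subset hWP (hS.trans Finset.sdiff_subset), ?_, ?_⟩
    · rw [Finset.card_union_of_disjoint hdisj]; omega
    · rw [Finset.card_union_of_disjoint hdisj, Finset.prod_union hdisj, ← add_assoc]
      refine le_trans ?_ hSle
      rw [mul_right_comm]
      gcongr
  · have hne : ∑ i, ∏ p ∈ Q i, stateRatio a U W p ≠ 1 := by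
      by_cases hUW' : U = W
      · subst hUW'
        obtain ⟨q, hqP, hqU⟩ := Finset.exists_of_ssubset (hWP.ssubset_of_ne hU)
        obtain ⟨i₀, -, hi₀⟩ := Finset.mem_biUnion.1 (H.union.symm ▸ hqP)
        have hcmp : ∀ p, ((p ^ a p : ℕ) : ℝ) / geomSigma a p ≤ stateRatio a U U p := fun p => by
          by_cases hp : p ∈ U
          · rw [stateRatio_of_mem a U hp]
          · rw [stateRatio_of_notMem a hp hp]; exact pow_div_geomSigma_le_one a p
        refine (H.sum_eq.symm.trans_lt ?_).ne'
        refine Finset.sum_lt_sum (fun i _ => Finset.prod_le_prod (fun _ _ => by positivity)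
          fun p _ => hcmp p) ⟨i₀, Finset.mem_univ _, ?_⟩
        refine Finset.prod_lt_prod (fun p hp => ?_) (fun p _ => hcmp p) ⟨q, hi₀, ?_⟩
        · have h1 := hP0 p (H.subset i₀ hp)
          have h2 : (0 : ℝ) < geomSigma a p := by exact_mod_cast geomSigma_pos a p
          push_cast
          positivity
        · rw [stateRatio_of_notMem a hqU hqU]
          exact pow_div_geomSigma_lt_one (ha q hqP)
      · exact H.sum_stateRatio_ne_one hUW hWP hUW'
    have hgap := H.inv_le_abs_sub_one hUW hWP hne
    have hF' := lt_of_le_of_ne hF hne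
    rw [abs_of_neg (by linarith)] at hgap
    have hyP : ∀ p ∈ P, (1 : ℝ) / (p : ℝ) ^ (a p + 1) ≤ 1 := fun p hp => by
      rw [div_le_one (pow_pos (hP0 p hp) _)]
      exact one_le_pow₀ (by exact_mod_cast hP1 p hp)
    have hsub := H.sum_sub_sum_le (stateRatio a W W)
      (fun p => if p ∈ W \ U then 1 - 1 / (p : ℝ) ^ (a p + 1) else 1)
      (fun p _ => stateRatio_nonneg a W W p) (fun p hp => stateRatio_le_one a W W (hP1 p hp))
      (fun p hp => by
        split_ifs
        · linarith [hyP p hp]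
        · norm_num)
      (fun p hp => by
        split_ifs
        · rw [sub_le_self_iff]; positivity
        · exact le_rfl)
    have hhigh : 1 ≤ ∑ i, ∏ p ∈ Q i, stateRatio a W W p := by
      refine H.sum_eq.symm.trans_le ?_
      refine Finset.sum_le_sum fun i _ => Finset.prod_le_prod (fun _ _ => by positivity)
        fun p _ => ?_
      by_cases hp : p ∈ W
      · rw [stateRatio_of_mem a W hp]
      · rw [stateRatio_of_notMem a hp hp]; exact pow_div_geomSigma_le_one a p
    have heq : ∑ i, ∏ p ∈ Q i, stateRatio a W W p *
        (if p ∈ W \ U then 1 - 1 / (p : ℝ) ^ (a p + 1) else 1) =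
        ∑ i, ∏ p ∈ Q i, stateRatio a U W p := by
      refine Finset.sum_congr rfl fun i _ => Finset.prod_congr rfl fun p hp => ?_
      have hpP := H.subset i hp
      by_cases hU : p ∈ U
      · simp [stateRatio_of_mem a W hU, stateRatio_of_mem a W (hUW hU), hU]
      · by_cases hW : p ∈ W
        · rw [stateRatio_of_mem a W hW, stateRatio_of_mem_of_notMem a (hP1 p hpP) hU hW,
            if_pos (Finset.mem_sdiff.2 ⟨hW, hU⟩), pow_div_geomSigma_mul a (hP1 p hpP)]
        · simp [stateRatio_of_notMem a hU hW, stateRatio_of_notMem a hW hW, hW]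
    have hsum : ∑ p ∈ P, (1 - (if p ∈ W \ U then 1 - 1 / (p : ℝ) ^ (a p + 1) else 1)) =
        ∑ p ∈ W \ U, 1 / (p : ℝ) ^ (a p + 1) := by
      rw [← Finset.sum_sdiff (Finset.sdiff_subset.trans hWP : W \ U ⊆ P)]
      have z : ∑ p ∈ P \ (W \ U),
          (1 - (if p ∈ W \ U then 1 - 1 / (p : ℝ) ^ (a p + 1) else 1)) = 0 :=
        Finset.sum_eq_zero fun p hp => by rw [if_neg (Finset.mem_sdiff.1 hp).2, sub_self]
      rw [z, zero_add]
      exact Finset.sum_congr rfl fun p hp => by rw [if_pos hp]; ring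
    rw [hsum, heq] at hsub
    obtain ⟨S, hS, hSne, hSle⟩ := exists_prod_le_sylvesterProd
      (fun p : ℕ => (p : ℝ) ^ (a p + 1)) (W \ U)
      (fun p hp => pow_pos (hP0 p (hWP (Finset.mem_sdiff.1 hp).1)) _) (U.card + W.card)
      (by linarith)
    have hdisj : Disjoint U S := Finset.disjoint_left.2 fun p hp hpS =>
      (Finset.mem_sdiff.1 (hS hpS)).2 hp
    have hc := hSne.card_pos
    refine ⟨U ∪ S, W, Finset.union_subset hUW (hS.trans Finset.sdiff_subset), hWP, ?_, ?_⟩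
    · rw [Finset.card_union_of_disjoint hdisj]; omega
    · rw [Finset.card_union_of_disjoint hdisj, Finset.prod_union hdisj, add_right_comm]
      refine le_trans ?_ hSle
      rw [← mul_assoc]
      gcongr

lemma prod_le_sylvesterProd_of_state (H : AmicableData P Q a) (ha : ∀ p ∈ P, a p ≠ 0) (n : ℕ)
    {U W : Finset ℕ} (hUW : U ⊆ W) (hWP : W ⊆ P) (hn : 2 * P.card ≤ U.card + W.card + n)
    (hle : (∏ p ∈ W, (p : ℝ)) * ∏ p ∈ U, (p : ℝ) ^ (a p + 1) ≤
      sylvesterProd (U.card + W.card)) :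
    (∏ p ∈ P, (p : ℝ)) * ∏ p ∈ P, (p : ℝ) ^ (a p + 1) ≤ sylvesterProd (2 * P.card) := by
  induction n generalizing U W with
  | zero =>
    have h1 := Finset.card_le_card hUW
    have h2 := Finset.card_le_card hWP
    obtain rfl := Finset.eq_of_subset_of_card_le hWP (by omega)
    obtain rfl := Finset.eq_of_subset_of_card_le hUW (by omega)
    rwa [← two_mul] at hle
  | succ n ih =>
    by_cases hU : U = P
    · obtain rfl : W = P := hWP.antisymm (hU ▸ hUW)
      subst hU
      rwa [← two_mul] at hle
    · obtain ⟨U', W', hUW', hWP', hlt, hle'⟩ := H.exists_next ha hUW hWP hU hle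
      exact ih hUW' hWP' (by omega) hle'

lemma prod_le_sylvesterProd (H : AmicableData P Q a) (ha : ∀ p ∈ P, a p ≠ 0) :
    (∏ p ∈ P, p) * ∏ p ∈ P, p ^ (a p + 1) ≤ sylvesterProd (2 * P.card) := by
  have := H.prod_le_sylvesterProd_of_state ha (2 * P.card) (Finset.empty_subset ∅)
    (Finset.empty_subset P) (by simp) (by simp [sylvesterProd])
  rw [← Nat.cast_le (α := ℝ)]
  push_cast
  exact this

end AmicableData

lemma amicableData_of_coprime {k : ℕ} [NeZero k] (M : Fin k → ℕ) (hpos : ∀ i, 0 < M i)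
    (hamic : ∀ i, sigma (M i) = ∑ j, M j)
    (hcop : ∀ i j, i ≠ j → Nat.gcd (M i) (M j) = 1)
    (hcop' : Nat.gcd (∏ i, M i) (∑ i, M i) = 1) :
    AmicableData (∏ i, M i).primeFactors (fun i => (M i).primeFactors)
      (∏ i, M i).factorization := by
  have hN : ∏ i, M i ≠ 0 := Finset.prod_ne_zero_iff.2 fun i _ => (hpos i).ne'
  have hdisj : ∀ i j, i ≠ j → Disjoint (M i).primeFactors (M j).primeFactors :=
    fun i j h => Nat.Coprime.disjoint_primeFactors (hcop i j h)
  have hfac : ∀ i, ∀ p ∈ (M i).primeFactors,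
      (M i).factorization p = (∏ j, M j).factorization p := by
    intro i p hp
    rw [Nat.factorization_prod fun j _ => (hpos j).ne', Finsupp.finsetSum_apply,
      Finset.sum_eq_single i]
    · intro j _ hji
      rw [← Finsupp.notMem_support_iff, Nat.support_factorization]
      exact Finset.disjoint_left.1 (hdisj i j hji.symm) hp
    · simp
  have hunion : Finset.univ.biUnion (fun i => (M i).primeFactors) =
      (∏ i, M i).primeFactors := by
    ext p
    simp only [Finset.mem_biUnion, Finset.mem_univ, true_and, Nat.mem_primeFactors]
    constructor
    · rintro ⟨i, hp, hd, -⟩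
      exact ⟨hp, hd.trans (Finset.dvd_prod_of_mem M (Finset.mem_univ i)), hN⟩
    · rintro ⟨hp, hd, -⟩
      obtain ⟨i, -, hi⟩ := (hp.prime.dvd_finsetProd_iff _).1 hd
      exact ⟨i, hp, hi, (hpos i).ne'⟩
  have hsig : ∀ i, ∏ p ∈ (M i).primeFactors, geomSigma (∏ j, M j).factorization p =
      ∑ j, M j := by
    intro i
    rw [← hamic i, sigma, Nat.sum_divisors (hpos i).ne']
    exact Finset.prod_congr rfl fun p hp => by rw [geomSigma, hfac i p hp]
  have hself : ∀ i, ∏ p ∈ (M i).primeFactors, p ^ (∏ j, M j).factorization p = M i := by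
    intro i
    conv_rhs => rw [← Nat.prod_factorization_pow_eq_self (hpos i).ne']
    exact Finset.prod_congr rfl fun p hp => by rw [hfac i p hp]
  refine ⟨fun p hp => Nat.prime_of_mem_primeFactors hp, hdisj, hunion, ?_, ?_⟩
  · intro p hp q hq hd
    rw [← hunion] at hp
    obtain ⟨i, -, hi⟩ := Finset.mem_biUnion.1 hp
    have h1 : q ∣ ∑ j, M j := by
      rw [← hsig i]; exact hd.trans (Finset.dvd_prod_of_mem _ hi)
    have h2 := Nat.dvd_gcd (Nat.dvd_of_mem_primeFactors hq) h1
    rw [hcop'] at h2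
    exact (Nat.prime_of_mem_primeFactors hq).one_lt.ne' (Nat.dvd_one.1 h2)
  · have hS : ((∑ j, M j : ℕ) : ℝ) ≠ 0 := by
      have : 0 < ∑ j, M j := Finset.sum_pos (fun j _ => hpos j) Finset.univ_nonempty
      positivity
    calc ∑ i, ∏ p ∈ (M i).primeFactors, ((p ^ (∏ j, M j).factorization p : ℕ) : ℝ) /
            geomSigma (∏ j, M j).factorization p
        = ∑ i, (M i : ℝ) / (∑ j, M j : ℕ) := by
          refine Finset.sum_congr rfl fun i _ => ?_
          rw [Finset.prod_div_distrib, ← Nat.cast_prod, ← Nat.cast_prod, hself, hsig]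
      _ = 1 := by
          rw [← Finset.sum_div, ← Nat.cast_sum]
          exact div_self hS

lemma four_pow_card_le {P : Finset ℕ} (hP : ∀ p ∈ P, p.Prime) :
    4 ^ P.card ≤ (∏ p ∈ P, p) * ∏ p ∈ P, p := by
  rw [← Finset.prod_mul_distrib, ← Finset.prod_const]
  exact Finset.prod_le_prod' fun p hp => Nat.mul_le_mul (hP p hp).two_le (hP p hp).two_le

lemma one_lt_pi_sq_div_six : 1 < Real.pi ^ 2 / 6 := by
  nlinarith [Real.pi_gt_three]

lemma lt_of_mul_four_pow_le_sylvesterProd {N K : ℕ} (hK : K ≠ 0)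
    (h : N * 4 ^ K ≤ sylvesterProd (2 * K)) :
    (N : ℝ) < Real.pi ^ 2 / 6 * (2 : ℝ) ^ ((4 : ℝ) ^ K - 2 * (2 : ℝ) ^ K) := by
  have hpi := one_lt_pi_sq_div_six
  obtain rfl | ⟨m, rfl⟩ : K = 1 ∨ ∃ m, K = m + 2 := by
    rcases K with _ | _ | m
    exacts [absurd rfl hK, Or.inl rfl, Or.inr ⟨m, rfl⟩]
  · have hN : N ≤ 1 := by norm_num [sylvesterProd] at h; omega
    have hN' : (N : ℝ) ≤ 1 := by exact_mod_cast hN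
    norm_num
    linarith
  · have h1 := sylvesterProd_add_four_lt (2 * m)
    have h2 : N * 4 ^ (m + 2) < 2 ^ (11 * 2 ^ (2 * m)) := by
      rw [show 2 * (m + 2) = 2 * m + 4 by ring] at h; omega
    have h3 : (N : ℝ) * 4 ^ (m + 2) < (2 : ℝ) ^ (11 * 2 ^ (2 * m)) := by exact_mod_cast h2
    have h4 : (N : ℝ) * 4 ^ (m + 2) <
        (2 : ℝ) ^ ((4 : ℝ) ^ (m + 2) - 2 * (2 : ℝ) ^ (m + 2)) * 4 ^ (m + 2) := by
      refine h3.trans_le ?_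
      rw [show (4 : ℝ) ^ (m + 2) = (2 : ℝ) ^ ((2 * (m + 2) : ℕ) : ℝ) by
          rw [Real.rpow_natCast, pow_mul]; norm_num, ← Real.rpow_add two_pos,
        ← Real.rpow_natCast 2 (11 * 2 ^ (2 * m))]
      refine Real.rpow_le_rpow_of_exponent_le one_le_two ?_
      rw [Real.rpow_natCast]
      push_cast
      have e : (2 : ℝ) ^ (2 * m) = (2 ^ m) ^ 2 := by rw [← pow_mul, mul_comm]
      have e' : (2 : ℝ) ^ (2 * (m + 2)) = 16 * (2 ^ m) ^ 2 := by
        rw [← pow_mul]; ring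
      rw [e, e', pow_add]
      have hm : (0 : ℝ) ≤ m := Nat.cast_nonneg m
      nlinarith [sq_nonneg ((2 : ℝ) ^ m - 4 / 5)]
    have h5 := lt_of_mul_lt_mul_right h4 (by positivity)
    have h6 : (0 : ℝ) < (2 : ℝ) ^ ((4 : ℝ) ^ (m + 2) - 2 * (2 : ℝ) ^ (m + 2)) := by positivity
    nlinarith

theorem amicable_tuples_stmt2 (k : ℕ) (hk : 2 ≤ k) (M : Fin k → ℕ)
    (hpos : ∀ i, 0 < M i)
    (hamic : ∀ i, sigma (M i) = ∑ j, M j)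
    (hcop : ∀ i j, i ≠ j → Nat.gcd (M i) (M j) = 1)
    (hcop' : Nat.gcd (∏ i, M i) (∑ i, M i) = 1)
    (K : ℕ) (hK : K = (∏ i, M i).primeFactors.card) :
    ((∏ i, M i : ℕ) : ℝ) <
      Real.pi ^ 2 / 6 * (2 : ℝ) ^ ((4 : ℝ) ^ K - 2 * (2 : ℝ) ^ K) := by
  subst hK
  have hN : ∏ i, M i ≠ 0 := Finset.prod_ne_zero_iff.2 fun i _ => (hpos i).ne'
  have : NeZero k := ⟨by omega⟩
  have H := amicableData_of_coprime M hpos hamic hcop hcop'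
  have hbound := H.prod_le_sylvesterProd fun p hp => by
    rwa [← Nat.support_factorization, Finsupp.mem_support_iff] at hp
  have hself : ∏ p ∈ (∏ i, M i).primeFactors, p ^ (∏ i, M i).factorization p = ∏ i, M i :=
    Nat.prod_factorization_pow_eq_self hN
  refine lt_of_mul_four_pow_le_sylvesterProd ?_ (le_trans ?_ hbound)
  · intro h0
    have h1 : ∏ i, M i = 1 := by
      rw [Finset.card_eq_zero] at h0
      rw [← hself, h0, Finset.prod_empty]
    have hM : ∀ i, M i = 1 := fun i => (Finset.prod_eq_one_iff.1 h1) i (Finset.mem_univ i)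
    have h2 := hamic ⟨0, by omega⟩
    simp [hM, sigma] at h2
    omega
  · simp only [pow_succ, Finset.prod_mul_distrib, hself]
    calc (∏ i, M i) * 4 ^ (∏ i, M i).primeFactors.card
        ≤ (∏ i, M i) * ((∏ p ∈ (∏ i, M i).primeFactors, p) *
            ∏ p ∈ (∏ i, M i).primeFactors, p) :=
          Nat.mul_le_mul_left _ (four_pow_card_le H.prime)
      _ = _ := by ring
end

section
/- Let k ≥ 2 and let (M_1, …, M_k) be a harmonious k-tuple of positive integers, and set L = Ω(M_1 ⋯ M_k). Then M_1 ⋯ M_k ≤ k^{−k} · (2^{2^L} − 2^{2^{L−1}}). -/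
open Finset in
/-- Abel summation: antitone weights applied to a sequence with nonpositive partial sums. -/
lemma sum_mul_le_mul_sum_of_antitone (N : ℕ) (w D : ℕ → ℝ)
    (hw : ∀ i, i + 1 < N → w (i + 1) ≤ w i)
    (hD : ∀ j ≤ N, ∑ i ∈ range j, D i ≤ 0) :
    ∀ j < N, ∑ i ∈ range (j + 1), w i * D i ≤ w j * ∑ i ∈ range (j + 1), D i := by
  intro j
  induction j with
  | zero => simp
  | succ j ih =>
    intro hj
    rw [sum_range_succ, sum_range_succ D (j + 1), mul_add]
    have h1 := ih (by omega)
    have h2 := mul_le_mul_of_nonpos_right (hw j hj) (hD (j + 1) (by omega))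
    linarith

/-- The tangent line inequality for the concave function `u ↦ log (1 - exp (-u))`. -/
lemma log_one_sub_inv_sub_le {x z : ℝ} (hx : 1 < x) (hz : 1 < z) :
    Real.log (1 - 1 / z) - Real.log (1 - 1 / x) ≤
      1 / (x - 1) * (Real.log z - Real.log x) := by
  have hx0 : 0 < x := by linarith
  have hz0 : 0 < z := by linarith
  have hx1 : 0 < x - 1 := by linarith
  have hz1 : 0 < z - 1 := by linarith
  have ha : 0 < 1 - 1 / z := by rw [one_sub_div hz0.ne']; positivity
  have hb : 0 < 1 - 1 / x := by rw [one_sub_div hx0.ne']; positivity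
  rw [← Real.log_div ha.ne' hb.ne', ← Real.log_div hz0.ne' hx0.ne']
  have h1 := Real.log_le_sub_one_of_pos (div_pos ha hb)
  have h2 := Real.one_sub_inv_le_log_of_pos (div_pos hz0 hx0)
  have h3 : (1 - 1 / z) / (1 - 1 / x) - 1 = 1 / (x - 1) * (1 - (z / x)⁻¹) := by
    rw [one_sub_div hz0.ne', one_sub_div hx0.ne']
    field_simp
    ring
  rw [h3] at h1
  exact h1.trans (mul_le_mul_of_nonneg_left h2 (by positivity))

open Finset in
/-- Comparison of `∏ (1 - 1 / x i)` with the product for a sequence with smaller partial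
products, given as the ratios of consecutive terms of `R`. -/
lemma prod_one_sub_div_lt_prod (N : ℕ) (x R : ℕ → ℝ) (hx : ∀ i < N, 1 < x i)
    (hmono : ∀ i j, i ≤ j → j < N → x i ≤ x j) (hR : ∀ i ≤ N, 0 < R i)
    (hRlt : ∀ i < N, R i < R (i + 1))
    (hle : ∀ j ≤ N, R j ≤ R 0 * ∏ i ∈ range j, x i)
    (hlt : R N < R 0 * ∏ i ∈ range N, x i) :
    ∏ i ∈ range N, (1 - R i / R (i + 1)) < ∏ i ∈ range N, (1 - 1 / x i) := by
  obtain _ | N := N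
  · simp at hlt
  set D : ℕ → ℝ := fun i => Real.log (R (i + 1) / R i) - Real.log (x i) with hD
  have hpx : ∀ j ≤ N + 1, 0 < ∏ i ∈ range j, x i := fun j hj =>
    prod_pos fun i hi => by linarith [hx i (by have := mem_range.1 hi; omega)]
  have hsum : ∀ j ≤ N + 1,
      ∑ i ∈ range j, D i = Real.log (R j) - Real.log (R 0 * ∏ i ∈ range j, x i) := by
    intro j hj
    rw [Real.log_mul (hR 0 (by omega)).ne' (hpx j hj).ne', Real.log_prod, ← sub_sub,
      ← sum_range_sub (fun i => Real.log (R i)), ← sum_sub_distrib]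
    · refine sum_congr rfl fun i hi => ?_
      have := mem_range.1 hi
      rw [hD]
      simp only
      rw [Real.log_div (hR _ (by omega)).ne' (hR _ (by omega)).ne']
    · intro i hi
      have := mem_range.1 hi
      linarith [hx i (by omega)]
  have hS : ∀ j ≤ N + 1, ∑ i ∈ range j, D i ≤ 0 := fun j hj => by
    rw [hsum j hj]
    linarith [Real.log_le_log (hR j hj) (hle j hj)]
  have hS' : ∑ i ∈ range (N + 1), D i < 0 := by
    rw [hsum _ le_rfl]
    linarith [Real.log_lt_log (hR _ le_rfl) hlt]
  have hfx : ∀ i ∈ range (N + 1), 0 < 1 - 1 / x i := fun i hi => by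
    have := hx i (mem_range.1 hi)
    rw [sub_pos, div_lt_one (by linarith)]
    exact this
  have hfR : ∀ i ∈ range (N + 1), 0 < 1 - R i / R (i + 1) := fun i hi => by
    have := mem_range.1 hi
    rw [sub_pos, div_lt_one (hR _ (by omega))]
    exact hRlt i this
  rw [← Real.log_lt_log_iff (prod_pos hfR) (prod_pos hfx),
    Real.log_prod fun i hi => (hfR i hi).ne', Real.log_prod fun i hi => (hfx i hi).ne',
    ← sub_neg, ← sum_sub_distrib]
  have habel := sum_mul_le_mul_sum_of_antitone (N + 1) (fun i => 1 / (x i - 1)) D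
    (fun i hi => one_div_le_one_div_of_le (by linarith [hx i (by omega)])
      (by linarith [hmono i (i + 1) (by omega) hi])) hS N (by omega)
  have hneg : 1 / (x N - 1) * ∑ i ∈ range (N + 1), D i < 0 :=
    mul_neg_of_pos_of_neg (one_div_pos.2 (by linarith [hx N (by omega)])) hS'
  refine lt_of_le_of_lt (sum_le_sum fun i hi => ?_) (habel.trans_lt hneg)
  have hi' := mem_range.1 hi
  have hz : 1 < R (i + 1) / R i := (one_lt_div (hR i (by omega))).2 (hRlt i hi')
  have := log_one_sub_inv_sub_le (hx i hi') hz
  rwa [one_div_div] at this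

open Finset in
/-- A Cook-type bound for the product of a sorted sequence whose tail products
`∏ (1 - 1 / x t)` are controlled by the initial products. -/
lemma prod_le_two_pow_sub_of_tail_prod_le (L : ℕ) (hL : 0 < L) (x : ℕ → ℝ)
    (hx : ∀ i < L, 1 < x i) (hmono : ∀ i j, i ≤ j → j < L → x i ≤ x j)
    (htail : ∀ m < L, ∏ t ∈ Ico m L, (1 - 1 / x t) ≤
      (∏ t ∈ range m, x t) / ((∏ t ∈ range m, x t) + 1)) :
    ∏ t ∈ range L, x t ≤ (2 : ℝ) ^ (2 ^ L) - (2 : ℝ) ^ (2 ^ (L - 1)) := by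
  by_contra! hcon
  set q : ℕ → ℝ := fun j => (2 : ℝ) ^ (2 ^ j) with hq
  have hq1 : ∀ j, q (j + 1) = q j ^ 2 := fun j => by simp only [hq]; rw [pow_succ 2 j, pow_mul]
  have hq2 : ∀ j, 2 ≤ q j := fun j => by
    simpa using pow_le_pow_right₀ (one_le_two : (1 : ℝ) ≤ 2) (Nat.one_le_two_pow (n := j))
  obtain ⟨m, hmL, hPm, hmax⟩ : ∃ m < L, ∏ t ∈ range m, x t ≤ q m - 1 ∧
      ∀ j, m < j → j < L → q j - 1 < ∏ t ∈ range j, x t := by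
    classical
    let s := (range L).filter fun m => ∏ t ∈ range m, x t ≤ q m - 1
    have hs : s.Nonempty := ⟨0, by simp [s, hL, hq]; norm_num⟩
    have hmem := mem_filter.1 (s.max'_mem hs)
    refine ⟨s.max' hs, mem_range.1 hmem.1, hmem.2, fun j hj hjL => ?_⟩
    by_contra! hc
    have := s.le_max' j (mem_filter.2 ⟨mem_range.2 hjL, hc⟩)
    omega
  have hP1 : 1 ≤ ∏ t ∈ range m, x t := one_le_prod fun i hi =>
    (hx i (by have := mem_range.1 hi; omega)).le
  obtain ⟨n, rfl⟩ : ∃ n, L = m + (n + 1) := ⟨L - m - 1, by omega⟩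
  have ht := htail m hmL
  rw [prod_Ico_eq_prod_range, Nat.add_sub_cancel_left] at ht
  rw [show m + (n + 1) - 1 = m + n by omega] at hcon
  have hcon' : q (m + n) ^ 2 - q (m + n) < ∏ t ∈ range (m + (n + 1)), x t := by
    rw [← hq1]; exact hcon
  set P := ∏ t ∈ range m, x t with hP
  set R : ℕ → ℝ := fun i => if i = 0 then P else if i ≤ n then q (m + i) - 1
    else q (m + n) ^ 2 - q (m + n) with hRdef
  have hR0 : R 0 = P := by simp [hRdef]
  have hRmid : ∀ i, 1 ≤ i → i ≤ n → R i = q (m + i) - 1 := fun i h1 h2 => by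
    simp only [hRdef]; rw [if_neg (by omega), if_pos h2]
  have hRlast : R (n + 1) = q (m + n) ^ 2 - q (m + n) := by
    simp only [hRdef]; rw [if_neg (by omega), if_neg (by omega)]
  have hPx : ∀ j, R 0 * ∏ i ∈ range j, x (m + i) = ∏ t ∈ range (m + j), x t := fun j => by
    rw [hR0, prod_range_add]
  have hRle : ∀ i ≤ n, R i ≤ q (m + i) - 1 := fun i hi => by
    obtain rfl | h := Nat.eq_zero_or_pos i
    · rw [hR0]; exact hPm
    · rw [hRmid i h hi]
  have hRpos : ∀ i ≤ n + 1, 0 < R i := by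
    intro i hi
    obtain rfl | h := Nat.eq_zero_or_pos i
    · rw [hR0]; linarith
    obtain h' | rfl := Nat.le_succ_iff.1 hi
    · rw [hRmid i h h']; linarith [hq2 (m + i)]
    · rw [hRlast]; nlinarith [hq2 (m + n)]
  have hkey : P / (P + 1) ≤ ∏ i ∈ range (n + 1), (1 - R i / R (i + 1)) := by
    have hQ := hq2 m
    obtain rfl | hn := Nat.eq_zero_or_pos n
    · have h1 : P / (q m ^ 2 - q m) ≤ 1 / (P + 1) := by
        rw [div_le_div_iff₀ (by nlinarith) (by linarith)]
        nlinarith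
      have h2 : P / (P + 1) = 1 - 1 / (P + 1) := by
        field_simp
        ring
      rw [prod_range_one, hR0, hRlast, add_zero, h2]
      linarith
    · have hind : ∀ j, j + 1 ≤ n → ∏ i ∈ range (j + 1), (1 - R i / R (i + 1)) =
          (q m ^ 2 - 1 - P) / q m ^ 2 * (q (m + (j + 1)) / (q (m + (j + 1)) - 1)) := by
        intro j
        induction j with
        | zero =>
          intro hj
          have : q m ^ 2 - 1 ≠ 0 := by nlinarith
          rw [zero_add, prod_range_one, hR0, hRmid 1 le_rfl hj, hq1]
          field_simp
        | succ j ih =>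
          intro hj
          rw [prod_range_succ, ih (by omega), hRmid _ (by omega) (by omega : j + 1 ≤ n),
            hRmid _ (by omega) hj, ← add_assoc m (j + 1) 1, hq1]
          have h2 := hq2 (m + (j + 1))
          have h3 : q (m + (j + 1)) - 1 ≠ 0 := by linarith
          have h4 : q (m + (j + 1)) ^ 2 - 1 ≠ 0 := by nlinarith
          have h5 : q m ≠ 0 := by linarith
          field_simp
          ring
      obtain ⟨n, rfl⟩ : ∃ n', n = n' + 1 := ⟨n - 1, by omega⟩
      rw [prod_range_succ, hind n le_rfl, hRlast, hRmid _ (by omega) le_rfl]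
      have h2 := hq2 (m + (n + 1))
      have h3 : q (m + (n + 1)) - 1 ≠ 0 := by linarith
      have h5 : q m ≠ 0 := by linarith
      have : (q m ^ 2 - 1 - P) / q m ^ 2 * (q (m + (n + 1)) / (q (m + (n + 1)) - 1)) *
          (1 - (q (m + (n + 1)) - 1) / (q (m + (n + 1)) ^ 2 - q (m + (n + 1)))) =
          (q m ^ 2 - 1 - P) / q m ^ 2 := by
        have h6 : q (m + (n + 1)) ^ 2 - q (m + (n + 1)) =
          q (m + (n + 1)) * (q (m + (n + 1)) - 1) := by ring
        rw [h6]
        field_simp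
      rw [this, div_le_div_iff₀ (by linarith) (by positivity)]
      nlinarith
  refine absurd ht (not_le.2 (hkey.trans_lt ?_))
  refine prod_one_sub_div_lt_prod (n + 1) (fun i => x (m + i)) R (fun i hi => hx _ (by omega))
    (fun i j hij hj => hmono _ _ (by omega) (by omega)) hRpos ?_ ?_ ?_
  · intro i hi
    refine (hRle i (by omega)).trans_lt ?_
    have h2 := hq2 (m + i)
    obtain h | rfl := Nat.lt_succ_iff_lt_or_eq.1 hi
    · rw [hRmid _ (by omega) (by omega), ← add_assoc, hq1]
      nlinarith
    · rw [hRlast]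
      nlinarith
  · intro j hj
    obtain rfl | h := Nat.eq_zero_or_pos j
    · simp
    rw [hPx]
    obtain h' | rfl := Nat.le_succ_iff.1 hj
    · rw [hRmid j h h']
      exact (hmax _ (by omega) (by omega)).le
    · rw [hRlast]
      exact hcon'.le
  · rw [hPx, hRlast]
    exact hcon'

open Finset in
/-- If sums of products of factors `1 - 1 / x t` add up to `1`, then the tails satisfy the
hypothesis of `prod_le_two_pow_sub_of_tail_prod_le`. -/
lemma tail_prod_le_of_sum_prod_eq_one {ι : Type*} [Fintype ι] [DecidableEq ι] (L : ℕ)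
    (a : ℕ → ι) (x : ℕ → ℕ) (hx : ∀ t < L, 2 ≤ x t)
    (hsum : ∑ i, ∏ t ∈ range L, (if a t = i then 1 - 1 / (x t : ℝ) else 1) = 1)
    (m : ℕ) (hm : m < L) :
    ∏ t ∈ Ico m L, (1 - 1 / (x t : ℝ)) ≤
      (∏ t ∈ range m, (x t : ℝ)) / ((∏ t ∈ range m, (x t : ℝ)) + 1) := by
  have hx' : ∀ t < L, (2 : ℝ) ≤ x t := fun t ht => by exact_mod_cast hx t ht
  have hf0 : ∀ t < L, 0 < 1 - 1 / (x t : ℝ) := fun t ht => by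
    have := hx' t ht
    rw [sub_pos, div_lt_one (by linarith)]
    linarith
  have hf1 : ∀ t < L, 1 - 1 / (x t : ℝ) < 1 := fun t ht => by
    have := hx' t ht
    have : 0 < 1 / (x t : ℝ) := by positivity
    linarith
  set F : ι → ℕ → ℝ := fun i t => if a t = i then 1 - 1 / (x t : ℝ) else 1 with hF
  have hF0 : ∀ i, ∀ t < L, 0 < F i t := fun i t ht => by
    simp only [hF]; split_ifs
    exacts [hf0 t ht, one_pos]
  have hF1 : ∀ i, ∀ t < L, F i t ≤ 1 := fun i t ht => by
    simp only [hF]; split_ifs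
    exacts [(hf1 t ht).le, le_rfl]
  have hFf : ∀ i, ∀ t < L, 1 - 1 / (x t : ℝ) ≤ F i t := fun i t ht => by
    simp only [hF]; split_ifs
    exacts [le_rfl, (hf1 t ht).le]
  have hsplit : ∀ i, ∏ t ∈ range L, F i t = (∏ t ∈ range m, F i t) * ∏ t ∈ Ico m L, F i t :=
    fun i => (prod_range_mul_prod_Ico _ hm.le).symm
  have hhead : ∀ i, 0 < ∏ t ∈ range m, F i t := fun i =>
    prod_pos fun t ht => hF0 i t ((mem_range.1 ht).trans hm)
  set P : ℝ := ∏ t ∈ range m, (x t : ℝ) with hP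
  have hPpos : 0 < P := prod_pos fun t ht => by
    linarith [hx' t ((mem_range.1 ht).trans hm)]
  set S := ∑ i, ∏ t ∈ range m, F i t with hS
  have hS1 : 1 < S := by
    rw [← hsum]
    refine sum_lt_sum (fun i _ => ?_) ⟨a m, mem_univ _, ?_⟩
    · rw [hsplit]
      refine mul_le_of_le_one_right (hhead i).le (prod_le_one (fun t ht => ?_) fun t ht => ?_)
      · exact (hF0 i t (mem_Ico.1 ht).2).le
      · exact hF1 i t (mem_Ico.1 ht).2
    · rw [hsplit]
      refine mul_lt_of_lt_one_right (hhead _) ?_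
      rw [prod_eq_prod_Ico_succ_bot hm]
      have h1 : F (a m) m < 1 := by simp only [hF, if_true]; exact hf1 m hm
      refine lt_of_le_of_lt (mul_le_of_le_one_right (hF0 _ m hm).le ?_) h1
      refine prod_le_one (fun t ht => ?_) fun t ht => ?_
      · exact (hF0 _ t (mem_Ico.1 ht).2).le
      · exact hF1 _ t (mem_Ico.1 ht).2
  have hint : P + 1 ≤ P * S := by
    have hN : P * S = ((∑ i, ∏ t ∈ range m, (if a t = i then x t - 1 else x t) : ℕ) : ℝ) := by
      rw [hS, mul_sum]
      push_cast
      refine sum_congr rfl fun i _ => ?_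
      rw [hP, ← prod_mul_distrib]
      refine prod_congr rfl fun t ht => ?_
      have htL := (mem_range.1 ht).trans hm
      have h2 := hx' t htL
      simp only [hF]
      split_ifs
      · rw [Nat.cast_sub (by linarith [hx t htL])]
        field_simp
        simp
      · simp
    have hlt : P < P * S := lt_mul_of_one_lt_right hPpos hS1
    have hPN : P = ((∏ t ∈ range m, x t : ℕ) : ℝ) := by rw [hP]; push_cast; rfl
    rw [hN, hPN] at hlt ⊢
    exact_mod_cast hlt
  have hT : S * ∏ t ∈ Ico m L, (1 - 1 / (x t : ℝ)) ≤ 1 := by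
    refine le_of_le_of_eq ?_ hsum
    rw [hS, sum_mul]
    refine sum_le_sum fun i _ => ?_
    rw [hsplit]
    refine mul_le_mul_of_nonneg_left (prod_le_prod (fun t ht => ?_) fun t ht => ?_) (hhead i).le
    · exact (hf0 t (mem_Ico.1 ht).2).le
    · exact hFf i t (mem_Ico.1 ht).2
  have hT0 : 0 < ∏ t ∈ Ico m L, (1 - 1 / (x t : ℝ)) :=
    prod_pos fun t ht => hf0 t (mem_Ico.1 ht).2
  rw [le_div_iff₀ (by linarith)]
  calc (∏ t ∈ Ico m L, (1 - 1 / (x t : ℝ))) * (P + 1)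
      ≤ (∏ t ∈ Ico m L, (1 - 1 / (x t : ℝ))) * (P * S) := mul_le_mul_of_nonneg_left hint hT0.le
    _ = P * (S * ∏ t ∈ Ico m L, (1 - 1 / (x t : ℝ))) := by ring
    _ ≤ P := mul_le_of_le_one_right hPpos.le hT

lemma sigma_mul_of_coprime {a b : ℕ} (h : a.Coprime b) : sigma (a * b) = sigma a * sigma b :=
  h.sum_divisors_mul

lemma sigma_prime_pow_succ {p : ℕ} (hp : p.Prime) (n : ℕ) :
    sigma (p ^ (n + 1)) = p * sigma (p ^ n) + 1 := by
  simp only [sigma]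
  rw [Nat.sum_divisors_prime_pow hp, Nat.sum_divisors_prime_pow hp, Finset.sum_range_succ',
    Finset.mul_sum]
  simp [pow_succ, mul_comm]

lemma sigma_pos {n : ℕ} (h : 0 < n) : 0 < sigma n :=
  Finset.sum_pos (fun _ hd => Nat.pos_of_mem_divisors hd) ⟨1, by simp [h.ne']⟩

/-- `M / σ(M)` is a product of `Ω(M)` factors `1 - 1 / x` whose `x` multiply to at least
`σ(M)`. -/
lemma exists_list_div_sigma_eq_prod (M : ℕ) (hM : 0 < M) :
    ∃ l : List ℕ, l.length = ArithmeticFunction.cardFactors M ∧ (∀ x ∈ l, 2 ≤ x) ∧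
      (M : ℝ) / sigma M = (l.map fun x : ℕ => 1 - 1 / (x : ℝ)).prod ∧ sigma M ≤ l.prod := by
  induction M using Nat.recOnPrimeCoprime with
  | zero => omega
  | prime_pow p n hp =>
    clear hM
    induction n with
    | zero => exact ⟨[], by simp [sigma]⟩
    | succ n ih =>
      obtain ⟨l, h1, h2, h3, h4⟩ := ih
      have hs := sigma_prime_pow_succ hp n
      have hpos := sigma_pos (pow_pos hp.pos n)
      have hprod : 1 ≤ l.prod := hpos.trans_le h4
      refine ⟨sigma (p ^ (n + 1)) :: l, ?_, ?_, ?_, ?_⟩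
      · rw [List.length_cons, h1, ArithmeticFunction.cardFactors_apply_prime_pow hp,
          ArithmeticFunction.cardFactors_apply_prime_pow hp]
      · intro x hx
        obtain rfl | hx := List.mem_cons.1 hx
        · rw [hs]
          have := Nat.mul_pos hp.pos hpos
          omega
        · exact h2 x hx
      · rw [List.map_cons, List.prod_cons, ← h3, hs]
        have : (sigma (p ^ n) : ℝ) ≠ 0 := by positivity
        have : (p : ℝ) * sigma (p ^ n) + 1 ≠ 0 := by positivity
        push_cast
        field_simp
        ring
      · rw [List.prod_cons]
        exact Nat.le_mul_of_pos_right _ hprod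
  | coprime a b ha hb hab iha ihb =>
    obtain ⟨l, h1, h2, h3, h4⟩ := iha (by omega)
    obtain ⟨l', h1', h2', h3', h4'⟩ := ihb (by omega)
    refine ⟨l ++ l', ?_, ?_, ?_, ?_⟩
    · rw [List.length_append, h1, h1', ArithmeticFunction.cardFactors_mul (by omega) (by omega)]
    · intro x hx
      obtain hx | hx := List.mem_append.1 hx
      exacts [h2 x hx, h2' x hx]
    · rw [List.map_append, List.prod_append, ← h3, ← h3', sigma_mul_of_coprime hab]
      push_cast
      exact (div_mul_div_comm _ _ _ _).symm
    · rw [List.prod_append, sigma_mul_of_coprime hab]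
      exact Nat.mul_le_mul h4 h4'

/-- A finite family of naturals can be enumerated in increasing order by an initial segment
of `ℕ`. -/
lemma exists_sorted_enumeration {α : Type*} [Fintype α] (L : ℕ) (hL : 0 < L)
    (hcard : Fintype.card α = L) (X : α → ℕ) :
    ∃ e : ℕ → α, (∀ i j, i ≤ j → j < L → X (e i) ≤ X (e j)) ∧
      ∀ f : α → ℝ, ∏ t ∈ Finset.range L, f (e t) = ∏ s, f s := by
  let e₀ : Fin L ≃ α := (Fintype.equivFinOfCardEq hcard).symm
  let e₁ : Fin L ≃ α := (Tuple.sort (X ∘ e₀)).trans e₀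
  have hmono : Monotone (X ∘ e₁) := Tuple.monotone_sort (X ∘ e₀)
  let e : ℕ → α := fun t => if h : t < L then e₁ ⟨t, h⟩ else e₁ ⟨0, hL⟩
  have he : ∀ t (h : t < L), e t = e₁ ⟨t, h⟩ := fun t h => dif_pos h
  refine ⟨e, fun i j hij hj => ?_, fun f => ?_⟩
  · rw [he i (by omega), he j hj]
    exact hmono (show (⟨i, _⟩ : Fin L) ≤ ⟨j, hj⟩ from hij)
  · rw [← Fin.prod_univ_eq_prod_range (fun t => f (e t)) L, ← e₁.prod_comp]
    exact Finset.prod_congr rfl fun t _ => by rw [he t t.2]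

/-- AM-GM for nonnegative reals with sum `1`. -/
lemma prod_le_zpow_neg_of_sum_eq_one (k : ℕ) (hk : 0 < k) (r : Fin k → ℝ) (hr : ∀ i, 0 ≤ r i)
    (hsum : ∑ i, r i = 1) : ∏ i, r i ≤ (k : ℝ) ^ (-(k : ℤ)) := by
  have hk' : (0 : ℝ) < k := by exact_mod_cast hk
  have h := Real.geom_mean_le_arith_mean Finset.univ (fun _ => (1 : ℝ)) r (fun _ _ => zero_le_one)
    (by simpa using hk) fun i _ => hr i
  simp only [Real.rpow_one, Finset.sum_const, Finset.card_univ, Fintype.card_fin, nsmul_eq_mul,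
    mul_one, one_mul, hsum] at h
  have h0 : 0 ≤ ∏ i, r i := Finset.prod_nonneg fun i _ => hr i
  calc ∏ i, r i = ((∏ i, r i) ^ ((k : ℝ)⁻¹)) ^ k := (Real.rpow_inv_natCast_pow h0 hk.ne').symm
    _ ≤ (1 / (k : ℝ)) ^ k := pow_le_pow_left₀ (Real.rpow_nonneg h0 _) h k
    _ = (k : ℝ) ^ (-(k : ℤ)) := by rw [zpow_neg, zpow_natCast, one_div, inv_pow]

theorem amicable_tuples_stmt3 (k : ℕ) (hk : 2 ≤ k) (M : Fin k → ℕ)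
    (hpos : ∀ i, 0 < M i)
    (hharm : ∑ i, (M i : ℝ) / (sigma (M i) : ℝ) = 1)
    (L : ℕ) (hL : L = (∏ i, M i).primeFactorsList.length) :
    ((∏ i, M i : ℕ) : ℝ) ≤
      (k : ℝ) ^ (-(k : ℤ)) * ((2 : ℝ) ^ (2 ^ L) - (2 : ℝ) ^ (2 ^ (L - 1))) := by
  choose l hlen hl2 hlprod hlsig using fun i => exists_list_div_sigma_eq_prod (M i) (hpos i)
  have hcard : Fintype.card (Σ i, Fin (l i).length) = L := by
    have hM0 : (Finset.univ.val.map M).prod ≠ 0 :=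
      Finset.prod_ne_zero_iff.2 fun i _ => (hpos i).ne'
    have hΩ := ArithmeticFunction.cardFactors_multiset_prod hM0
    rw [Multiset.map_map] at hΩ
    rw [hL, ← ArithmeticFunction.cardFactors_apply, Fintype.card_sigma]
    simp only [Fintype.card_fin, hlen]
    exact hΩ.symm
  let X : (Σ i, Fin (l i).length) → ℕ := fun s => (l s.1)[s.2]
  have hX2 : ∀ s, 2 ≤ X s := fun s => hl2 s.1 _ (List.getElem_mem _)
  have hratio : ∀ i, (M i : ℝ) / sigma (M i) = ∏ j : Fin (l i).length, (1 - 1 / (X ⟨i, j⟩ : ℝ)) :=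
    fun i => by
      rw [hlprod i]
      exact (Fin.prod_univ_fun_getElem (l i) fun x : ℕ => 1 - 1 / (x : ℝ)).symm
  have hL0 : 0 < L := by
    rw [Nat.pos_iff_ne_zero]
    rintro rfl
    have hemp := Fintype.card_eq_zero_iff.1 hcard
    have h1 : ∀ i, (M i : ℝ) / sigma (M i) = 1 := fun i => by
      rw [hratio i]
      exact Finset.prod_eq_one fun j _ => (hemp.false ⟨i, j⟩).elim
    simp only [h1, Finset.sum_const, Finset.card_univ, Fintype.card_fin, nsmul_eq_mul,
      mul_one] at hharm
    have : k = 1 := by exact_mod_cast hharm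
    omega
  obtain ⟨e, hmono, hprod⟩ := exists_sorted_enumeration L hL0 hcard X
  have hsum : ∑ i, ∏ t ∈ Finset.range L,
      (if (e t).1 = i then 1 - 1 / (X (e t) : ℝ) else 1) = 1 := by
    refine (Finset.sum_congr rfl fun i _ => ?_).trans hharm
    rw [hprod fun s => if s.1 = i then 1 - 1 / (X s : ℝ) else 1, Fintype.prod_sigma, hratio i,
      Finset.prod_eq_single i (fun b _ hb => by simp [hb]) (by simp)]
    simp
  have hbound := prod_le_two_pow_sub_of_tail_prod_le L hL0 (fun t => (X (e t) : ℝ))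
    (fun t _ => by exact_mod_cast hX2 (e t))
    (fun i j hij hj => by exact_mod_cast hmono i j hij hj)
    (tail_prod_le_of_sum_prod_eq_one L (fun t => (e t).1) (fun t => X (e t))
      (fun t _ => hX2 (e t)) hsum)
  rw [hprod fun s => (X s : ℝ)] at hbound
  have hsig : ∏ i, (sigma (M i) : ℝ) ≤ ∏ s, (X s : ℝ) := by
    rw [Fintype.prod_sigma]
    refine Finset.prod_le_prod (fun i _ => by positivity) fun i _ => ?_
    rw [← Nat.cast_prod]
    refine Nat.cast_le.2 ((hlsig i).trans_eq ?_)
    exact (Fin.prod_univ_getElem (l i)).symm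
  have hamgm := prod_le_zpow_neg_of_sum_eq_one k (by omega)
    (fun i => (M i : ℝ) / sigma (M i)) (fun i => by positivity) hharm
  have hM : ((∏ i, M i : ℕ) : ℝ) =
      (∏ i, (M i : ℝ) / sigma (M i)) * ∏ i, (sigma (M i) : ℝ) := by
    rw [← Finset.prod_mul_distrib, Nat.cast_prod]
    refine Finset.prod_congr rfl fun i _ => ?_
    have : (sigma (M i) : ℝ) ≠ 0 := by exact_mod_cast (sigma_pos (hpos i)).ne'
    field_simp
  rw [hM]
  exact mul_le_mul hamgm (hsig.trans hbound) (by positivity) (by positivity)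
end
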